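/- Suppose in addition that f and t are computable. Then every individual conjugacy problem in G is decidable: for every fixed word w₀ ∈ F, the predicate on F sending a word v to the truth value of 'mk(v) is conjugate to mk(w₀) in G' is a computable predicate (the algorithm may depend non-uniformly on w₀). -/

import Mathlib

/-- A word over the alphabet `α`: a list of generators with signs. -/
abbrev Word (α : Type*) := List (α × Bool)

/-- The formal inverse of a word. -/
def wordInv {α : Type*} (w : Word α) : Word α := FreeGroup.invRev w

/-- A word is reduced if it equals its free reduction. -/
def Reduced {α : Type*} [DecidableEq α] (w : Word α) : Prop := FreeGroup.reduce w = w

/-- A word is cyclically reduced if it is reduced and its first letter is not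
the inverse of its last letter. -/
def CyclicallyReduced {α : Type*} [DecidableEq α] (w : Word α) : Prop :=
  Reduced w ∧ ∀ a ∈ w.head?, ∀ b ∈ w.getLast?, a ≠ (b.1, !b.2)

/-- A nonempty word `b` is a piece relative to `R` if it is an initial segment of two
distinct elements of `R`. -/
def Piece {α : Type*} (R : Set (Word α)) (b : Word α) : Prop :=
  b ≠ [] ∧ ∃ r₁ ∈ R, ∃ r₂ ∈ R, r₁ ≠ r₂ ∧ b <+: r₁ ∧ b <+: r₂

/-- The symmetrized closure of a set of (cyclically reduced) words: all cyclic
permutations of the words and of their formal inverses. -/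
def symClosure {α : Type*} (S : Set (Word α)) : Set (Word α) :=
  {w | ∃ r ∈ S, w ~r r ∨ w ~r wordInv r}

/-! The 46 generators: `a₁,…,a₂₀` are `0,…,19`, `b₁,…,b₂₀` are `20,…,39`,
`c₁,c₂,c₃` are `40,41,42` and `d₁,d₂,d₃` are `43,44,45`. -/

def genA (k : Fin 20) : Fin 46 := ⟨(k : ℕ), by have := k.isLt; omega⟩
def genB (k : Fin 20) : Fin 46 := ⟨20 + (k : ℕ), by have := k.isLt; omega⟩
def genC (k : Fin 3) : Fin 46 := ⟨40 + (k : ℕ), by have := k.isLt; omega⟩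
def genD (k : Fin 3) : Fin 46 := ⟨43 + (k : ℕ), by have := k.isLt; omega⟩

/-- The word `x^n` (with sign `s`: `true` is `x^n`, `false` is `x^{-n}`). -/
def genPow (x : Fin 46) (s : Bool) (n : ℕ) : Word (Fin 46) := List.replicate n (x, s)

/-- The word `a₁^j a₂^j ⋯ a₂₀^j`. -/
def aWord (j : ℕ) : Word (Fin 46) :=
  (List.ofFn fun k : Fin 20 => genPow (genA k) true j).flatten

/-- The word `b₁^j b₂^j ⋯ b₂₀^j`. -/
def bWord (j : ℕ) : Word (Fin 46) :=
  (List.ofFn fun k : Fin 20 => genPow (genB k) true j).flatten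

/-- The word `b₂₀^{-j} b₁₉^{-j} ⋯ b₁^{-j}`. -/
def bWordRevInv (j : ℕ) : Word (Fin 46) :=
  (List.ofFn fun k : Fin 20 => genPow (genB k.rev) false j).flatten

/-- The conjugating word `c₁^i d₁^{t} c₂^i d₂^{t} c₃^i d₃^{t}`. -/
def conjWord (i ti : ℕ) : Word (Fin 46) :=
  genPow (genC 0) true i ++ genPow (genD 0) true ti ++
  genPow (genC 1) true i ++ genPow (genD 1) true ti ++
  genPow (genC 2) true i ++ genPow (genD 2) true ti

/-- The inverse conjugating word `d₃^{-t} c₃^{-i} d₂^{-t} c₂^{-i} d₁^{-t} c₁^{-i}`. -/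
def conjWordInv (i ti : ℕ) : Word (Fin 46) :=
  genPow (genD 2) false ti ++ genPow (genC 2) false i ++
  genPow (genD 1) false ti ++ genPow (genC 1) false i ++
  genPow (genD 0) false ti ++ genPow (genC 0) false i

/-- The relator
`r_i = a₁^j ⋯ a₂₀^j · c₁^i d₁^{t(i)} ⋯ c₃^i d₃^{t(i)} · b₂₀^{-j} ⋯ b₁^{-j} · d₃^{-t(i)} ⋯ c₁^{-i}`
where `j = f i`. -/
def relatorWord (f t : ℕ → ℕ) (i : ℕ) : Word (Fin 46) :=
  aWord (f i) ++ conjWord i (t i) ++ bWordRevInv (f i) ++ conjWordInv i (t i)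

/-- The set of relators `{r_i : i ≥ 1}` as elements of the free group. -/
def relatorSet (f t : ℕ → ℕ) : Set (FreeGroup (Fin 46)) :=
  {r | ∃ i : ℕ, 1 ≤ i ∧ r = FreeGroup.mk (relatorWord f t i)}

/-- The group `G`: the quotient of the free group on the 46 generators by the
normal closure of the relators `r_i`, `i ≥ 1`. -/
abbrev GroupG (f t : ℕ → ℕ) : Type :=
  FreeGroup (Fin 46) ⧸ Subgroup.normalClosure (relatorSet f t)

/-- The quotient map `mk : F → G` (on words). -/
def mkG (f t : ℕ → ℕ) (w : Word (Fin 46)) : GroupG f t :=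
  QuotientGroup.mk (FreeGroup.mk w)


namespace ICP

theorem red_right {X : Type*} {u v : Word X} (h : FreeGroup.IsReduced (u ++ v)) : FreeGroup.IsReduced v :=
  (List.isChain_append.1 h).2.1
theorem red_left {X : Type*} {u v : Word X} (h : FreeGroup.IsReduced (u ++ v)) : FreeGroup.IsReduced u :=
  (List.isChain_append.1 h).1


section lcp
variable {α : Type*} [DecidableEq α]

/-- length of the longest common initial segment -/
def lcp : List α → List α → ℕ
  | a :: u, b :: v => if a = b then lcp u v + 1 else 0
  | [], _ => 0
  | _ :: _, [] => 0

theorem le_lcp_iff (u v : List α) (n : ℕ) :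
    n ≤ lcp u v ↔ n ≤ u.length ∧ n ≤ v.length ∧ u.take n = v.take n := by
  induction u generalizing v n with
  | nil => cases v <;> simp [lcp] <;> omega
  | cons a u ih =>
    cases v with
    | nil => simp [lcp]; omega
    | cons b v =>
      cases n with
      | zero => simp
      | succ n =>
        by_cases h : a = b
        · simp [lcp, h, ih]
        · simp [lcp, h]

theorem lcp_le_left (u v : List α) : lcp u v ≤ u.length := ((le_lcp_iff u v _).1 le_rfl).1
theorem lcp_le_right (u v : List α) : lcp u v ≤ v.length := ((le_lcp_iff u v _).1 le_rfl).2.1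
theorem take_lcp (u v : List α) : u.take (lcp u v) = v.take (lcp u v) :=
  ((le_lcp_iff u v _).1 le_rfl).2.2

theorem lcp_comm (u v : List α) : lcp u v = lcp v u := by
  apply le_antisymm <;> rw [le_lcp_iff] <;> refine ⟨?_, ?_, (take_lcp _ _).symm⟩ <;>
  first | apply lcp_le_left | apply lcp_le_right

theorem lcp_ultra (u v w : List α) : min (lcp u v) (lcp v w) ≤ lcp u w := by
  have h1 := (le_lcp_iff u v _).1 (min_le_left (lcp u v) (lcp v w))
  have h2 := (le_lcp_iff v w _).1 (min_le_right (lcp u v) (lcp v w))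
  exact (le_lcp_iff u w _).2 ⟨h1.1, h2.2.1, h1.2.2.trans h2.2.2⟩

theorem lcp_split (u v : List α) : ∃ p u' v', u = p ++ u' ∧ v = p ++ v' ∧ p.length = lcp u v ∧
    (∀ a b, u'.head? = some a → v'.head? = some b → a ≠ b) := by
  induction u generalizing v with
  | nil => exact ⟨[], [], v, by simp, by simp, by cases v <;> simp [lcp], by simp⟩
  | cons a u ih =>
    cases v with
    | nil => exact ⟨[], _, [], rfl, rfl, by simp [lcp], by simp⟩
    | cons b v =>
      by_cases h : a = b
      · obtain ⟨p, u', v', h1, h2, h3, h4⟩ := ih v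
        refine ⟨a :: p, u', v', by rw [h1]; rfl, by rw [h2, h]; rfl, by simp [lcp, h, h3], h4⟩
      · refine ⟨[], _, _, rfl, rfl, by simp [lcp, h], ?_⟩
        rintro x y h1 h2
        simp at h1 h2; rw [← h1, ← h2]; exact h

theorem lcp_getElem? (u v : List α) (n : ℕ) (h : n < lcp u v) : u[n]? = v[n]? := by
  have := congrArg (fun l => l[n]?) (take_lcp u v)
  simpa [List.getElem?_take, h] using this

theorem lcp_le_of_ne (u v : List α) (n : ℕ) (h : u[n]? ≠ v[n]?) : lcp u v ≤ n := by
  by_contra hc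
  exact h (lcp_getElem? u v n (by omega))
end lcp

section fg
variable {X : Type*} [DecidableEq X]
open FreeGroup

theorem isReduced_invRev {u : List (X × Bool)} (h : FreeGroup.IsReduced u) : FreeGroup.IsReduced (invRev u) := by
  rw [isReduced_iff_reduce_eq] at *
  rw [reduce_invRev, h]

theorem toWord_inv_mul (g h : FreeGroup X) : ∃ p u v, g.toWord = p ++ u ∧ h.toWord = p ++ v ∧
    p.length = lcp g.toWord h.toWord ∧ (g⁻¹ * h).toWord = invRev u ++ v := by
  obtain ⟨p, u, v, h1, h2, h3, h4⟩ := lcp_split g.toWord h.toWord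
  refine ⟨p, u, v, h1, h2, h3, ?_⟩
  have e : g⁻¹ * h = mk (invRev u ++ v) := by
    rw [← mk_toWord (x := g), ← mk_toWord (x := h), h1, h2, inv_mk, mul_mk, invRev_append,
      ← mul_mk, ← mul_mk, ← mul_mk, ← mul_mk, ← inv_mk, ← inv_mk]
    group
  have hu : IsReduced u := red_right (h1 ▸ isReduced_toWord (x := g))
  have hv : IsReduced v := red_right (h2 ▸ isReduced_toWord (x := h))
  rw [e, toWord_mk, ← isReduced_iff_reduce_eq]
  have hu' : IsReduced (invRev u) := isReduced_invRev hu
  unfold FreeGroup.IsReduced at *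
  rw [List.isChain_append]
  refine ⟨hu', hv, ?_⟩
  rintro ⟨x, s⟩ hx ⟨y, t⟩ hy hxy
  simp at hxy; subst hxy
  have hx' : u.head? = some (x, !s) := by
    cases u with
    | nil => simp at hx
    | cons a u => obtain ⟨a1, a2⟩ := a; simp [invRev] at hx ⊢; grind
  have := h4 _ _ hx' (by simpa using hy)
  cases s <;> cases t <;> simp_all

theorem norm_inv_mul (g h : FreeGroup X) :
    (g⁻¹ * h).norm + 2 * lcp g.toWord h.toWord = g.norm + h.norm := by
  obtain ⟨p, u, v, h1, h2, h3, h4⟩ := toWord_inv_mul g h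
  unfold FreeGroup.norm
  rw [h4, ← h3, h1, h2]; simp; omega

end fg
end ICP

namespace ICP
open FreeGroup hiding map_mul map_one map_inv IsReduced norm

/-- letters of the free factor `K` : `(true, m)` is `a_{m+1}`, `(false, m)` is `b_{m+1}` -/
abbrev Kl := Bool × Fin 20
/-- basis of `E` : `(j, true)` maps to `A_{j+1}`, `(j, false)` maps to `B_{j+1}` -/
abbrev Zt := ℕ × Bool

def zl (z : Zt) (s : Bool) (n : ℕ) : Kl × Bool :=
  if s then ((z.2, Fin.ofNat 20 (n / (z.1 + 1))), true)
  else ((z.2, Fin.ofNat 20 (19 - n / (z.1 + 1))), false)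

def zw (z : Zt) (s : Bool) : List (Kl × Bool) := (List.range (20 * (z.1 + 1))).map (zl z s)

@[simp] theorem length_zw (z s) : (zw z s).length = 20 * (z.1 + 1) := by simp [zw]

theorem zw_getElem? (z s n) (h : n < 20 * (z.1 + 1)) : (zw z s)[n]? = some (zl z s n) := by
  simp [zw, h]

theorem invRev_zw (z s) : invRev (zw z s) = zw z (!s) := by
  apply List.ext_getElem
  · simp
  · intro n h1 h2
    simp only [length_zw] at h2
    have e : (20 * (z.1 + 1) - 1 - n) / (z.1 + 1) = 19 - n / (z.1 + 1) := by
      have h3 := Nat.div_add_mod n (z.1 + 1)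
      have h4 := Nat.mod_lt n (Nat.succ_pos z.1)
      have h5 : n / (z.1 + 1) < 20 := Nat.div_lt_of_lt_mul (by rw [mul_comm]; exact h2)
      set q := n / (z.1 + 1)
      set r := n % (z.1 + 1)
      apply Nat.div_eq_of_lt_le
      · zify [show q ≤ 19 by omega, show n ≤ 20 * (z.1 + 1) - 1 by omega,
          show 1 ≤ 20 * (z.1 + 1) by omega]
        zify at h3 h4
        nlinarith
      · zify [show q ≤ 19 by omega, show n ≤ 20 * (z.1 + 1) - 1 by omega,
          show 1 ≤ 20 * (z.1 + 1) by omega]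
        zify at h3 h4
        nlinarith
    have h5 : n / (z.1 + 1) < 20 := Nat.div_lt_of_lt_mul (by rw [mul_comm]; exact h2)
    cases s <;> simp [invRev, zw, zl, e]
    generalize n / (z.1 + 1) = q at h5
    congr 1; omega

theorem isReduced_zw (z s) : FreeGroup.IsReduced (zw z s) := by
  unfold FreeGroup.IsReduced
  rw [List.isChain_iff_getElem]
  intro i h _
  cases s <;> simp [zw, zl]

@[simp] theorem toWord_mk_zw (z s) : (mk (zw z s)).toWord = zw z s := by
  rw [toWord_mk]; exact (isReduced_iff_reduce_eq).1 (isReduced_zw z s)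

theorem zl_inj_aux {z z' : Zt} {s s' : Bool} {n n' : ℕ} (hn : n < 20 * (z.1 + 1))
    (hn' : n' < 20 * (z'.1 + 1)) (h : zl z s n = zl z' s' n') :
    s = s' ∧ z.2 = z'.2 ∧ n / (z.1 + 1) = n' / (z'.1 + 1) := by
  have h5 : n / (z.1 + 1) < 20 := Nat.div_lt_of_lt_mul (by rw [mul_comm]; exact hn)
  have h6 : n' / (z'.1 + 1) < 20 := Nat.div_lt_of_lt_mul (by rw [mul_comm]; exact hn')
  unfold zl at h
  generalize n / (z.1 + 1) = q at *
  generalize n' / (z'.1 + 1) = q' at *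
  cases s <;> cases s' <;> simp [Fin.ext_iff] at h ⊢
  · refine ⟨h.1, ?_⟩
    have := h.2
    rw [Nat.mod_eq_of_lt (by omega), Nat.mod_eq_of_lt (by omega)] at this
    omega
  · refine ⟨h.1, ?_⟩
    have := h.2
    rwa [Nat.mod_eq_of_lt (by omega), Nat.mod_eq_of_lt (by omega)] at this

theorem lcp_zw_le {z z' : Zt} {s s' : Bool} (h : (z, s) ≠ (z', s')) :
    lcp (zw z s) (zw z' s') ≤ z.1 + 1 := by
  by_contra hc
  push Not at hc
  have l1 := lcp_le_left (zw z s) (zw z' s')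
  have l2 := lcp_le_right (zw z s) (zw z' s')
  simp only [length_zw] at l1 l2
  have e0 := lcp_getElem? (zw z s) (zw z' s') (z.1 + 1) hc
  rw [zw_getElem? _ _ _ (by omega), zw_getElem? _ _ _ (by omega)] at e0
  obtain ⟨h1, h2, h3⟩ := zl_inj_aux (by omega) (by omega) (Option.some.inj e0)
  rw [Nat.div_self (by omega)] at h3
  have h4 : z'.1 ≤ z.1 := by
    by_contra h5
    rw [Nat.div_eq_of_lt (by omega)] at h3; omega
  rcases h4.lt_or_eq with h5 | h5
  · have e1 := lcp_getElem? (zw z s) (zw z' s') (z'.1 + 1) (by omega)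
    rw [zw_getElem? _ _ _ (by omega), zw_getElem? _ _ _ (by omega)] at e1
    obtain ⟨_, _, h3⟩ := zl_inj_aux (by omega) (by omega) (Option.some.inj e1)
    rw [Nat.div_self (by omega), Nat.div_eq_of_lt (by omega)] at h3
    omega
  · exact h (by rw [h1, Prod.ext h5.symm h2])

/-- The embedding of `E` in `K`. -/
def alph : FreeGroup Zt →* FreeGroup Kl := FreeGroup.lift fun z => mk (zw z true)

theorem alph_cons (z s l) : alph (mk ((z, s) :: l)) = mk (zw z s) * alph (mk l) := by
  have : (mk ((z, s) :: l) : FreeGroup Zt) = mk [(z, s)] * mk l := by simp [mul_mk]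
  rw [this, map_mul]
  congr 1
  cases s
  · have : (mk [(z, false)] : FreeGroup Zt) = (of z)⁻¹ := by simp [of, inv_mk, invRev]
    rw [this, map_inv]; simp [alph, inv_mk, invRev_zw]
  · have : (mk [(z, true)] : FreeGroup Zt) = (of z) := rfl
    rw [this]; simp [alph]

def omg (l : List (Zt × Bool)) : ℕ := (l.map fun x => x.1.1 + 1).sum

/-- weight omitting the outermost generators -/
def wt0 (u : List (Kl × Bool)) : ℕ := u.countP fun x => decide (x.1.2 ≠ 0 ∧ x.1.2 ≠ 19)

theorem wt0_append (u v) : wt0 (u ++ v) = wt0 u + wt0 v := List.countP_append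
theorem wt0_invRev (u) : wt0 (invRev u) = wt0 u := by
  simp [wt0, invRev, List.countP_map, Function.comp_def]

theorem range_map_div {β : Type*} (h : ℕ → β) (N m : ℕ) (hN : 0 < N) :
    (List.range (m * N)).map (fun n => h (n / N)) =
      (List.range m).flatMap fun q => List.replicate N (h q) := by
  induction m with
  | zero => simp
  | succ m ih =>
    rw [List.range_succ, List.flatMap_append, ← ih, Nat.succ_mul, List.range_add, List.map_append]
    congr 1
    simp only [List.map_map, List.flatMap_cons, List.flatMap_nil, List.append_nil]
    rw [List.eq_replicate_iff]
    refine ⟨by simp, ?_⟩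
    intro b hb
    simp only [List.mem_map, List.mem_range, Function.comp] at hb
    obtain ⟨n, hn, rfl⟩ := hb
    congr 1
    rw [mul_comm, Nat.mul_add_div hN, Nat.div_eq_of_lt hn]; rfl

theorem zw_true_eq (z : Zt) : zw z true =
    (List.range 20).flatMap fun q => List.replicate (z.1 + 1) ((z.2, Fin.ofNat 20 q), true) := by
  rw [← range_map_div (fun q => (((z.2, Fin.ofNat 20 q), true) : Kl × Bool)) _ _ (Nat.succ_pos _)]
  rfl

theorem wt0_zw (z s) : wt0 (zw z s) = 18 * (z.1 + 1) := by
  have : wt0 (zw z true) = 18 * (z.1 + 1) := by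
    rw [zw_true_eq]
    have key : ∀ (P : ℕ → Bool) (N : ℕ) (l : List ℕ),
        (l.map fun q => if P q then N else 0).sum = l.countP P * N := by
      intro P N l
      induction l with
      | nil => simp
      | cons a l ih =>
        by_cases h : P a
        · simp [h, ih]; ring
        · simp [h, ih]
    unfold wt0
    rw [List.countP_flatMap]
    simp only [List.countP_replicate, Function.comp_def]
    rw [key (fun q => decide (Fin.ofNat 20 q ≠ 0 ∧ Fin.ofNat 20 q ≠ 19))]
    congr 1
  cases s
  · rw [show false = !true from rfl, ← invRev_zw, wt0_invRev, this]
  · exact this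

theorem wt0_take_zw (z s n) (hn : n ≤ z.1 + 1) : wt0 ((zw z s).take n) = 0 := by
  unfold wt0
  rw [List.countP_eq_zero]
  intro a ha
  simp only [zw, ← List.map_take, List.take_range, List.mem_map, List.mem_range] at ha
  obtain ⟨m, hm, rfl⟩ := ha
  have : m / (z.1 + 1) = 0 := Nat.div_eq_of_lt (by omega)
  cases s <;> simp [zl, this, Fin.ext_iff]

theorem alph_main (l : List (Zt × Bool)) (hl : FreeGroup.IsReduced l) :
    (∀ z s l', l = (z, s) :: l' → 19 * (z.1 + 1) ≤ lcp (zw z s) (alph (mk l)).toWord) ∧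
    18 * omg l ≤ (alph (mk l)).norm ∧ wt0 (alph (mk l)).toWord = 18 * omg l := by
  induction l with
  | nil => simp [omg, ← one_eq_mk, wt0]
  | cons x l ih =>
    obtain ⟨z, s⟩ := x
    have hl' : FreeGroup.IsReduced l := red_right (u := [(z, s)]) hl
    obtain ⟨i1, i2, i3⟩ := ih hl'
    set g' := alph (mk l) with hg'
    have hL : lcp (zw z (!s)) g'.toWord ≤ z.1 + 1 ∧
        wt0 (g'.toWord.take (lcp (zw z (!s)) g'.toWord)) = 0 := by
      cases l with
      | nil =>
        have : g' = 1 := by rw [hg', ← one_eq_mk, map_one]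
        rw [this]
        have : lcp (zw z (!s)) (1 : FreeGroup Kl).toWord = 0 := by
          have := lcp_le_right (zw z (!s)) (1 : FreeGroup Kl).toWord
          simpa using this
        rw [this]; simp [wt0]
      | cons y l =>
        obtain ⟨z', s'⟩ := y
        have hne : (z, !s) ≠ (z', s') := by
          intro h
          simp [FreeGroup.IsReduced] at hl
          simp only [Prod.mk.injEq] at h
          have := hl.1 h.1
          rw [← h.2] at this
          simp at this
        have i := i1 z' s' l rfl
        have u := lcp_ultra (zw z (!s)) g'.toWord (zw z' s')
        rw [lcp_comm g'.toWord] at u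
        have a1 := lcp_zw_le hne
        have a2 := lcp_zw_le hne.symm
        rw [lcp_comm] at a2
        have b1 : lcp (zw z (!s)) g'.toWord ≤ z.1 + 1 ∧ lcp (zw z (!s)) g'.toWord ≤ z'.1 + 1 := by
          omega
        refine ⟨b1.1, ?_⟩
        have hh : lcp (zw z (!s)) g'.toWord ≤ lcp (zw z' s') g'.toWord := by omega
        rw [← ((le_lcp_iff _ _ _).1 hh).2.2]
        exact wt0_take_zw _ _ _ b1.2
    obtain ⟨p, u, v, h1, h2, h3, h4⟩ := toWord_inv_mul (mk (zw z (!s))) g'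
    rw [inv_mk, invRev_zw, Bool.not_not] at h4
    simp only [toWord_mk_zw] at h1 h2 h3
    have hz : zw z s = invRev u ++ invRev p := by
      rw [← invRev_append, ← h1, invRev_zw, Bool.not_not]
    have hlen := congrArg List.length hz
    simp only [length_zw, List.length_append, invRev_length] at hlen
    rw [← h3] at hL
    obtain ⟨hL1, hL2⟩ := hL
    have hp : wt0 p = 0 := by rw [h2] at hL2; simpa using hL2
    have hg'l : g'.norm = p.length + v.length := by rw [FreeGroup.norm, h2]; simp
    rw [h2, wt0_append, hp] at i3
    have hw := congrArg wt0 hz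
    rw [wt0_zw, wt0_append, wt0_invRev, wt0_invRev, hp] at hw
    rw [alph_cons, ← hg', FreeGroup.norm, h4]
    refine ⟨?_, ?_, ?_⟩
    · rintro z1 s1 l1 h
      simp at h
      obtain ⟨⟨rfl, rfl⟩, -⟩ := h
      rw [le_lcp_iff]
      refine ⟨by rw [length_zw]; omega, by simp; omega, ?_⟩
      rw [hz, List.take_append_of_le_length (by simp; omega),
        List.take_append_of_le_length (by simp; omega)]
    · simp [omg] at *; omega
    · rw [wt0_append, wt0_invRev]; simp [omg] at *; omega

theorem alph_injective : Function.Injective alph := by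
  rw [injective_iff_map_eq_one]
  intro e he
  have := (alph_main e.toWord isReduced_toWord).2.1
  rw [mk_toWord, he] at this
  simp at this
  rw [← toWord_eq_nil_iff]
  cases h : e.toWord with
  | nil => rfl
  | cons x l => rw [h] at this; simp [omg] at this

end ICP

namespace ICP
open FreeGroup hiding map_mul map_one map_inv IsReduced norm

/-- `k` cannot be shortened by multiplying with one basis element of `E` -/
def DK (k : FreeGroup Kl) : Prop :=
  ∀ z s, k.norm ≤ (mk (zw z s) * k).norm ∧ k.norm ≤ (k * mk (zw z s)).norm

theorem div_window {p p' N N' : ℕ} (hN : 0 < N) (hNN : N ≤ N')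
    (h : ∀ n ≤ 2 * N, (p + n) / N = (p' + n) / N') : N = N' ∧ p = p' := by
  obtain ⟨n0, hn0, hn0', q, hq⟩ : ∃ n0, 1 ≤ n0 ∧ n0 ≤ N ∧ ∃ q, p + n0 = (q + 1) * N := by
    have h1 := Nat.div_add_mod p N
    have h2 := Nat.mod_lt p hN
    refine ⟨N - p % N, by omega, by omega, p / N, ?_⟩
    rw [add_mul, mul_comm (p / N)]; omega
  have hN' : 0 < N' := by omega
  have jump : ∀ a q, (a + 1) / N' = q + 1 → a / N' = q → a + 1 = (q + 1) * N' := by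
    intro a q h1 h2
    have h3 := Nat.div_mul_le_self (a + 1) N'
    rw [h1] at h3
    have h4 := Nat.lt_div_mul_add (a := a) hN'
    rw [h2] at h4
    have : q * N' + N' = (q + 1) * N' := by ring
    omega
  have left : ∀ q, ∀ a, a + 1 = (q + 1) * N → (a + 1) / N = q + 1 ∧ a / N = q := by
    intro q a ha
    refine ⟨by rw [ha]; exact Nat.mul_div_cancel _ hN, ?_⟩
    have : q * N + N = (q + 1) * N := by ring
    exact Nat.div_eq_of_lt_le (by omega) (by omega)
  have j1 : p' + n0 = (q + 1) * N' := by
    obtain ⟨l1, l2⟩ := left q (p + (n0 - 1)) (by omega)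
    have e1 := h (n0 - 1) (by omega)
    have e2 := h n0 (by omega)
    have := jump (p' + (n0 - 1)) q (by rw [← l1]; convert e2.symm using 2 <;> omega)
      (by rw [← e1, l2])
    omega
  have j2 : p' + (n0 + N) = (q + 1 + 1) * N' := by
    have h5 : p + (n0 + N - 1) + 1 = (q + 1 + 1) * N := by
      have : (q + 1 + 1) * N = (q + 1) * N + N := by ring
      omega
    obtain ⟨l1, l2⟩ := left (q + 1) (p + (n0 + N - 1)) h5
    have e1 := h (n0 + N - 1) (by omega)
    have e2 := h (n0 + N) (by omega)
    have := jump (p' + (n0 + N - 1)) (q + 1) (by rw [← l1]; convert e2.symm using 2 <;> omega)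
      (by rw [← e1, l2])
    omega
  have h6 : (q + 1 + 1) * N' = (q + 1) * N' + N' := by ring
  have h7 : N = N' := by omega
  refine ⟨h7, ?_⟩
  subst h7
  omega

theorem alph_start (e : FreeGroup Zt) (he : e ≠ 1) : ∃ z s, z.1 + 1 ≤ omg e.toWord ∧
    19 * (z.1 + 1) ≤ lcp (zw z s) (alph e).toWord ∧ 18 * omg e.toWord ≤ (alph e).norm := by
  have := alph_main e.toWord isReduced_toWord
  rw [mk_toWord] at this
  cases h : e.toWord with
  | nil => exact absurd (toWord_eq_nil_iff.1 h) he
  | cons x l =>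
    rw [h] at this
    exact ⟨x.1, x.2, by simp [omg], this.1 _ _ _ rfl, this.2.1⟩

theorem lcp_DK_left {k : FreeGroup Kl} (hk : DK k) {z s} {g : FreeGroup Kl}
    (hg : 19 * (z.1 + 1) ≤ lcp (zw z s) g.toWord) : lcp g.toWord k.toWord ≤ 10 * (z.1 + 1) := by
  have h1 := (hk z (!s)).1
  have h2 := norm_inv_mul (mk (zw z s)) k
  rw [inv_mk, invRev_zw, toWord_mk_zw] at h2
  have h3 := lcp_ultra (zw z s) g.toWord k.toWord
  have h4 : (mk (zw z s)).norm = 20 * (z.1 + 1) := by rw [FreeGroup.norm, toWord_mk_zw, length_zw]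
  omega

theorem DK.inv {k : FreeGroup Kl} (hk : DK k) : DK k⁻¹ := by
  intro z s
  have h := hk z (!s)
  rw [norm_inv_eq]
  constructor
  · rw [← norm_inv_eq (x := mk (zw z s) * k⁻¹)]
    simpa [inv_mk, invRev_zw] using h.2
  · rw [← norm_inv_eq (x := k⁻¹ * mk (zw z s))]
    simpa [inv_mk, invRev_zw] using h.1

theorem crit {k g h : FreeGroup Kl} (hk1 : k ≠ 1) {z s z' s'} 
    (hg : 19 * (z.1 + 1) ≤ lcp (zw z s) g.toWord)
    (hh : 19 * (z'.1 + 1) ≤ lcp (zw z' s') h.toWord)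
    (hp1 : lcp g.toWord k.toWord ≤ 10 * (z.1 + 1))
    (hp2 : lcp k⁻¹.toWord h.toWord ≤ 10 * (z'.1 + 1))
    (hs : lcp g.toWord k.toWord + lcp k⁻¹.toWord h.toWord = k.norm) :
    lcp g.toWord (k * h).toWord ≤ lcp g.toWord k.toWord + 2 * min (z.1 + 1) (z'.1 + 1) := by
  by_contra hc
  push Not at hc
  set p1 := lcp g.toWord k.toWord with hp1d
  set p2 := lcp k⁻¹.toWord h.toWord with hp2d
  obtain ⟨p, u, v, h1, h2, h3, h4⟩ := toWord_inv_mul k⁻¹ h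
  rw [inv_inv] at h4
  have hk' : k.toWord = invRev u ++ invRev p := by
    rw [← invRev_append, ← h1, toWord_inv, invRev_invRev]
  have hul : u.length = p1 := by
    have := congrArg List.length hk'
    simp only [List.length_append, invRev_length] at this
    rw [FreeGroup.norm] at hs
    omega
  have key : ∀ n ≤ 2 * min (z.1 + 1) (z'.1 + 1), zl z s (p1 + n) = zl z' s' (p2 + n) := by
    intro n hn
    have e1 := lcp_getElem? _ _ (p1 + n) (show p1 + n < lcp g.toWord (k * h).toWord by omega)
    rw [h4, List.getElem?_append_right (by simp; omega)] at e1
    simp only [invRev_length, hul, Nat.add_sub_cancel_left] at e1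
    have e2 := lcp_getElem? _ _ (p1 + n) (show p1 + n < lcp (zw z s) g.toWord by omega)
    have e3 := lcp_getElem? _ _ (p2 + n) (show p2 + n < lcp (zw z' s') h.toWord by omega)
    rw [h2, List.getElem?_append_right (by omega), h3, ← hp2d, Nat.add_sub_cancel_left] at e3
    rw [← e2, ← e3, zw_getElem? _ _ _ (by omega), zw_getElem? _ _ _ (by omega)] at e1
    exact Option.some.inj e1
  have key2 : ∀ n ≤ 2 * min (z.1 + 1) (z'.1 + 1), s = s' ∧ z.2 = z'.2 ∧
      (p1 + n) / (z.1 + 1) = (p2 + n) / (z'.1 + 1) := fun n hn =>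
    zl_inj_aux (by omega) (by omega) (key n hn)
  obtain ⟨k1, k2, -⟩ := key2 0 (by omega)
  have k3 : z.1 + 1 = z'.1 + 1 ∧ p1 = p2 := by
    rcases le_total (z.1 + 1) (z'.1 + 1) with h | h
    · exact div_window (by omega) h fun n hn => (key2 n (by omega)).2.2
    · have := div_window (by omega) h fun n hn => (key2 n (by omega)).2.2.symm
      exact ⟨this.1.symm, this.2.symm⟩
  have hz : z = z' := Prod.ext (by omega) k2
  have hpp := k3.2
  subst k1 hz
  have e1 : invRev u = p := by
    have a1 := take_lcp g.toWord k.toWord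
    have a0 : (invRev u ++ invRev p).take p1 = invRev u := by
      rw [← hul, ← invRev_length (L₁ := u)]; exact List.take_left
    rw [← hp1d, hk', a0] at a1
    have a2 := ((le_lcp_iff (zw z s) g.toWord p1).1 (by omega)).2.2
    have a3 := ((le_lcp_iff (zw z s) h.toWord p1).1 (by omega)).2.2
    have a4 : (p ++ v).take p1 = p := by
      rw [hpp, hp2d, ← h3]; exact List.take_left
    rw [h2, a4] at a3
    rw [← a1, ← a2, a3]
  apply hk1
  rw [← mk_toWord (x := k), hk', e1, ← mul_mk, ← inv_mk, mul_inv_cancel]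

theorem LB {k : FreeGroup Kl} (hk1 : k ≠ 1) (hk : DK k) (e e' : FreeGroup Zt) :
    k.norm + 18 * omg e.toWord + 18 * omg e'.toWord ≤ 5 * ((alph e)⁻¹ * k * alph e').norm := by
  set g := alph e
  set h := alph e'
  have n1 := norm_inv_mul g (k * h)
  rw [← mul_assoc] at n1
  have n2 := norm_inv_mul k⁻¹ h
  rw [inv_inv, norm_inv_eq] at n2
  have n3 := norm_inv_mul k (k * h)
  rw [inv_mul_cancel_left] at n3
  have u1 := lcp_ultra g.toWord (k * h).toWord k.toWord
  have u2 := lcp_ultra k.toWord g.toWord (k * h).toWord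
  rw [lcp_comm k.toWord g.toWord] at u2
  rw [lcp_comm (k * h).toWord k.toWord] at u1
  have l1 := lcp_le_left g.toWord k.toWord
  have l2 := lcp_le_right k⁻¹.toWord h.toWord
  have l3 := lcp_le_left g.toWord (k * h).toWord
  have l4 := lcp_le_left k.toWord (k * h).toWord
  rcases eq_or_ne e 1 with he | he
  · have hg : g = 1 := by simp [g, he]
    have hgn : g.norm = 0 := by simp [hg]
    have ho : omg e.toWord = 0 := by simp [he, omg]
    rw [FreeGroup.norm] at hgn
    rw [hgn] at l1 l3
    rcases eq_or_ne e' 1 with he' | he'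
    · have hhn : h.norm = 0 := by simp [h, he']
      have ho' : omg e'.toWord = 0 := by simp [he', omg]
      rw [FreeGroup.norm] at hhn
      simp only [FreeGroup.norm] at *
      omega
    · obtain ⟨z', s', b1, b2, b3⟩ := alph_start e' he'
      have q2 := lcp_DK_left hk.inv b2
      rw [lcp_comm] at q2
      simp only [FreeGroup.norm] at *
      change _ ≤ h.toWord.length at b3
      change lcp k⁻¹.toWord h.toWord ≤ _ at q2
      omega
  · obtain ⟨z, s, a1, a2, a3⟩ := alph_start e he
    have q1 := lcp_DK_left hk a2
    change lcp g.toWord k.toWord ≤ _ at q1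
    change _ ≤ g.norm at a3
    rcases eq_or_ne e' 1 with he' | he'
    · have hh : h = 1 := by simp [h, he']
      have hhn : h.norm = 0 := by simp [hh]
      have ho' : omg e'.toWord = 0 := by simp [he', omg]
      have hkh : k * h = k := by rw [hh, mul_one]
      have hgk : g⁻¹ * k * h = g⁻¹ * k := by rw [hh, mul_one]
      simp only [hkh] at n1 n2 n3 u1 u2 l3 l4
      have l2' : lcp k⁻¹.toWord h.toWord = 0 := by rw [FreeGroup.norm] at hhn; omega
      omega
    · obtain ⟨z', s', b1, b2, b3⟩ := alph_start e' he'
      have q2 := lcp_DK_left hk.inv b2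
      rw [lcp_comm] at q2
      change lcp k⁻¹.toWord h.toWord ≤ _ at q2
      change _ ≤ h.norm at b3
      have c := crit hk1 a2 b2 q1 q2
      change _ → lcp g.toWord (k * h).toWord ≤ lcp g.toWord k.toWord + _ at c
      change lcp g.toWord k.toWord + lcp k⁻¹.toWord h.toWord = _ → _ at c
      rcases lt_trichotomy (lcp g.toWord k.toWord + lcp k⁻¹.toWord h.toWord) k.norm with o | o | o
      · omega
      · have c' := c o
        omega
      · omega

end ICP

namespace ICP

section amalg
variable {E K Q P : Type} [Group E] [Group K] [Group Q] [Group P]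

/-- membership in the amalgamated subgroup -/
def inE (a : E →* K) (b : E →* Q) : K ⊕ Q → Prop
  | .inl k => k ∈ a.range
  | .inr q => q ∈ b.range

def RedL (a : E →* K) (b : E →* Q) (l : List (K ⊕ Q)) : Prop :=
  (∀ x ∈ l, ¬ inE a b x) ∧ l.IsChain fun x y => x.isLeft ≠ y.isLeft

def lprod (i : K →* P) (j : Q →* P) (l : List (K ⊕ Q)) : P := (l.map (Sum.elim i j)).prod

/-- the facts about an amalgamated product which are used -/
structure Amalg (a : E →* K) (b : E →* Q) (i : K →* P) (j : Q →* P) : Prop where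
  ab : ∀ e, i (a e) = j (b e)
  ainj : Function.Injective a
  binj : Function.Injective b
  iinj : Function.Injective i
  jinj : Function.Injective j
  nf : ∀ l, RedL a b l → lprod i j l = 1 → l = []

abbrev Gf (K Q : Type) : Bool → Type := fun x => cond x K Q
instance (K Q : Type) [Group K] [Group Q] : ∀ x, Group (Gf K Q x)
  | true => inferInstanceAs (Group K)
  | false => inferInstanceAs (Group Q)

def phiB (a : E →* K) (b : E →* Q) : ∀ x, E →* Gf K Q x
  | true => a
  | false => b

abbrev PP (a : E →* K) (b : E →* Q) := Monoid.PushoutI (phiB a b)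

def iP (a : E →* K) (b : E →* Q) : K →* PP a b := Monoid.PushoutI.of (φ := phiB a b) true
def jP (a : E →* K) (b : E →* Q) : Q →* PP a b := Monoid.PushoutI.of (φ := phiB a b) false

def toSig (x : K ⊕ Q) : Σ x, Gf K Q x := match x with
  | .inl k => ⟨true, k⟩
  | .inr q => ⟨false, q⟩

theorem amalgP (a : E →* K) (b : E →* Q) (ha : Function.Injective a) (hb : Function.Injective b) :
    Amalg a b (iP a b) (jP a b) := by
  have hinj : ∀ x, Function.Injective (phiB a b x) := by
    intro x; cases x; exacts [hb, ha]
  refine ⟨?_, ha, hb, Monoid.PushoutI.of_injective hinj true,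
    Monoid.PushoutI.of_injective hinj false, ?_⟩
  · intro e
    exact (Monoid.PushoutI.of_apply_eq_base (phiB a b) true e).trans
      (Monoid.PushoutI.of_apply_eq_base (phiB a b) false e).symm
  · intro l hl h1
    have hrange : ∀ x ∈ l, (toSig x).2 ∉ (phiB a b (toSig x).1).range := by
      intro x hx
      have := hl.1 x hx
      cases x <;> exact this
    let w : Monoid.CoprodI.Word (Gf K Q) :=
      { toList := l.map toSig
        ne_one := by
          intro y hy
          obtain ⟨x, hx, rfl⟩ := List.mem_map.1 hy
          intro h
          exact hrange x hx (by rw [h]; exact one_mem _)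
        chain_ne := by
          rw [List.isChain_map]
          refine hl.2.imp ?_
          intro x y h
          cases x <;> cases y <;> simp [toSig] at h ⊢ }
    have hw : Monoid.PushoutI.Reduced (phiB a b) w := by
      rintro ⟨b, g⟩ hg
      obtain ⟨x, hx, h⟩ := List.mem_map.1 hg
      have := hrange x hx
      rw [h] at this
      exact this
    have hp : Monoid.PushoutI.ofCoprodI (φ := phiB a b) w.prod = lprod (iP a b) (jP a b) l := by
      rw [Monoid.CoprodI.Word.prod, map_list_prod, lprod]
      simp only [w, List.map_map]
      congr 1
      apply List.map_congr_left
      intro x _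
      cases x <;> simp [toSig, iP, jP] <;> rfl
    have := hw.eq_empty_of_mem_range hinj (by rw [hp, h1]; exact one_mem _)
    have h2 := congrArg Monoid.CoprodI.Word.toList this
    simpa [w] using h2
end amalg
end ICP

namespace ICP

section amalg
variable {E K Q P : Type} [Group E] [Group K] [Group Q] [Group P]
variable {a : E →* K} {b : E →* Q} {i : K →* P} {j : Q →* P}

def lm (a : E →* K) (b : E →* Q) (e : E) : K ⊕ Q → K ⊕ Q
  | .inl k => .inl (a e * k)
  | .inr q => .inr (b e * q)
def rm (a : E →* K) (b : E →* Q) (x : K ⊕ Q) (e : E) : K ⊕ Q := match x with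
  | .inl k => .inl (k * a e)
  | .inr q => .inr (q * b e)
def sinv : K ⊕ Q → K ⊕ Q
  | .inl k => .inl k⁻¹
  | .inr q => .inr q⁻¹

@[simp] theorem lprod_nil : lprod i j [] = 1 := rfl
@[simp] theorem lprod_cons (x l) : lprod i j (x :: l) = Sum.elim i j x * lprod i j l := by
  simp [lprod]
@[simp] theorem lprod_append (l l') : lprod i j (l ++ l') = lprod i j l * lprod i j l' := by
  simp [lprod]

@[simp] theorem isLeft_lm (e) (x : K ⊕ Q) : (lm a b e x).isLeft = x.isLeft := by cases x <;> rfl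
@[simp] theorem isLeft_rm (e) (x : K ⊕ Q) : (rm a b x e).isLeft = x.isLeft := by cases x <;> rfl
@[simp] theorem isLeft_sinv (x : K ⊕ Q) : (sinv x).isLeft = x.isLeft := by cases x <;> rfl
@[simp] theorem inE_lm (e) (x : K ⊕ Q) : inE a b (lm a b e x) ↔ inE a b x := by
  cases x <;> exact Subgroup.mul_mem_cancel_left _ ⟨e, rfl⟩
@[simp] theorem inE_rm (e) (x : K ⊕ Q) : inE a b (rm a b x e) ↔ inE a b x := by
  cases x <;> exact Subgroup.mul_mem_cancel_right _ ⟨e, rfl⟩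
@[simp] theorem inE_sinv (x : K ⊕ Q) : inE a b (sinv x) ↔ inE a b x := by
  cases x <;> exact inv_mem_iff
@[simp] theorem ev_sinv (x : K ⊕ Q) : Sum.elim i j (sinv x) = (Sum.elim i j x)⁻¹ := by
  cases x <;> simp [sinv]

theorem Amalg.ev_lm (H : Amalg a b i j) (e) (x : K ⊕ Q) :
    Sum.elim i j (lm a b e x) = i (a e) * Sum.elim i j x := by
  cases x <;> simp [lm, H.ab]
theorem Amalg.ev_rm (H : Amalg a b i j) (e) (x : K ⊕ Q) :
    Sum.elim i j (rm a b x e) = Sum.elim i j x * i (a e) := by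
  cases x <;> simp [rm, H.ab]

theorem Amalg.ev_of_inE (H : Amalg a b i j) (x : K ⊕ Q) (h : inE a b x) :
    ∃ e, Sum.elim i j x = i (a e) ∧ (∀ k, x = .inl k → k = a e) ∧ (∀ q, x = .inr q → q = b e) := by
  cases x
  · obtain ⟨e, rfl⟩ := h; exact ⟨e, rfl, by simp, by simp⟩
  · obtain ⟨e, rfl⟩ := h; exact ⟨e, by simp [H.ab], by simp, by simp⟩

theorem RedL.tail {x : K ⊕ Q} {l} (h : RedL a b (x :: l)) : RedL a b l :=
  ⟨fun y hy => h.1 y (List.mem_cons_of_mem _ hy), h.2.tail⟩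

theorem RedL.head {x : K ⊕ Q} {l} (h : RedL a b (x :: l)) : ¬ inE a b x :=
  h.1 x List.mem_cons_self

/-- replacing the first element by one of the same type -/
theorem RedL.replace {x y : K ⊕ Q} {l} (h : RedL a b (x :: l)) (hy : ¬ inE a b y)
    (he : y.isLeft = x.isLeft) : RedL a b (y :: l) := by
  refine ⟨?_, ?_⟩
  · intro z hz
    rcases List.mem_cons.1 hz with rfl | hz
    · exact hy
    · exact h.tail.1 z hz
  · have := h.2
    cases l with
    | nil => simp
    | cons z l => simp only [List.isChain_cons_cons] at this ⊢; rw [he]; exact this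

theorem RedL.cons {x y : K ⊕ Q} {l} (h : RedL a b (y :: l)) (hx : ¬ inE a b x)
    (he : x.isLeft ≠ y.isLeft) : RedL a b (x :: y :: l) := by
  refine ⟨?_, ?_⟩
  · intro z hz
    rcases List.mem_cons.1 hz with rfl | hz
    · exact hx
    · exact h.1 z hz
  · rw [List.isChain_cons_cons]; exact ⟨he, h.2⟩

theorem RedL.single {x : K ⊕ Q} (hx : ¬ inE a b x) : RedL a b [x] :=
  ⟨by simpa using hx, by simp⟩

def revinv (l : List (K ⊕ Q)) : List (K ⊕ Q) := (l.map sinv).reverse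

@[simp] theorem lprod_revinv (l) : lprod i j (revinv l) = (lprod i j l)⁻¹ := by
  induction l with
  | nil => simp [revinv]
  | cons x l ih =>
    have : revinv (x :: l) = revinv l ++ [sinv x] := by simp [revinv]
    rw [this, lprod_append, ih]; simp

theorem RedL.glue {x y : K ⊕ Q} {l l'} (h : RedL a b (x :: l)) (h' : RedL a b (y :: l'))
    (he : x.isLeft = y.isLeft) : RedL a b (revinv l ++ y :: l') := by
  refine ⟨?_, ?_⟩
  · intro z hz
    rcases List.mem_append.1 hz with hz | hz
    · simp only [revinv, List.mem_reverse, List.mem_map] at hz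
      obtain ⟨w, hw, rfl⟩ := hz
      rw [inE_sinv]; exact h.tail.1 w hw
    · exact h'.1 z hz
  · have h1 : (revinv l).IsChain fun x y => x.isLeft ≠ y.isLeft := by
      rw [revinv, List.isChain_reverse, List.isChain_map]
      exact h.tail.2.imp fun x y h => by simpa using h.symm
    rw [List.isChain_append]
    refine ⟨h1, h'.2, ?_⟩
    intro z hz w hw
    simp only [List.head?_cons, Option.mem_def, Option.some.injEq] at hw
    subst hw
    cases l with
    | nil => simp [revinv] at hz
    | cons u l =>
      simp [revinv] at hz
      subst hz
      have := h.2
      rw [List.isChain_cons_cons] at this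
      rw [isLeft_sinv, ← he]; exact this.1.symm

theorem RedL.glue2 {x y : K ⊕ Q} {l l'} (h : RedL a b (x :: l)) (h' : RedL a b (y :: l'))
    (he : x.isLeft ≠ y.isLeft) : RedL a b (revinv (x :: l) ++ y :: l') := by
  refine RedL.glue (x := y) (l := x :: l) ?_ h' rfl
  exact h.cons h'.head he.symm

/-- two reduced sequences represent the same element up to the subgroup `E` -/
def Mt (a : E →* K) (b : E →* Q) : E → List (K ⊕ Q) → List (K ⊕ Q) → Prop
  | e, [], [] => e = 1
  | e, x :: l, y :: l' => ∃ e', y = lm a b e⁻¹ (rm a b x e') ∧ Mt a b e' l l'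
  | _, _, _ => False

theorem Amalg.unique (H : Amalg a b i j) (l : List (K ⊕ Q)) :
    ∀ (l' : List (K ⊕ Q)) (e : E), RedL a b l → RedL a b l' →
      lprod i j l = i (a e) * lprod i j l' → Mt a b e l l' := by
  induction l with
  | nil =>
    intro l' e h h' hp
    cases l' with
    | nil =>
      simp at hp
      exact H.ainj (H.iinj (by simpa using hp.symm))
    | cons y l' =>
      have := H.nf (lm a b e y :: l') (h'.replace (by simpa using h'.head) (by simp))
        (by rw [lprod_cons, H.ev_lm, mul_assoc, ← lprod_cons, ← hp, lprod_nil])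
      simp at this
  | cons x l ih =>
    intro l' e h h' hp
    cases l' with
    | nil =>
      have := H.nf (lm a b e⁻¹ x :: l) (h.replace (by simpa using h.head) (by simp))
        (by rw [lprod_cons, H.ev_lm, mul_assoc, ← lprod_cons, hp]; simp)
      simp at this
    | cons y l' =>
      have hy' : RedL a b (lm a b e y :: l') := h'.replace (by simpa using h'.head) (by simp)
      by_cases ht : x.isLeft = y.isLeft
      · -- same type
        have : ∃ c : K ⊕ Q, c.isLeft = x.isLeft ∧
            Sum.elim i j c = (Sum.elim i j x)⁻¹ * i (a e) * Sum.elim i j y ∧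
            (∀ e', Sum.elim i j c = i (a e') → y = lm a b e⁻¹ (rm a b x e')) := by
          cases x with
          | inl k =>
            cases y with
            | inl k' =>
              refine ⟨.inl (k⁻¹ * a e * k'), rfl, by simp, ?_⟩
              intro e' he'
              have := H.iinj he'
              simp only [lm, rm, map_inv, ← this]; congr 1; group
            | inr q => simp at ht
          | inr q =>
            cases y with
            | inr q' =>
              refine ⟨.inr (q⁻¹ * b e * q'), rfl, by simp [H.ab], ?_⟩
              intro e' he'
              rw [H.ab] at he'
              have := H.jinj he'
              simp only [lm, rm, map_inv, ← this]; congr 1; group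
            | inl q => simp at ht
        obtain ⟨c, c1, c2, c3⟩ := this
        by_cases hc : inE a b c
        · obtain ⟨e', he', -⟩ := H.ev_of_inE c hc
          refine ⟨e', c3 e' he', ih l' e' h.tail h'.tail ?_⟩
          rw [← he', c2]
          simp only [lprod_cons] at hp
          rw [← mul_assoc] at hp
          simp only [mul_assoc] at hp ⊢
          rw [← hp, inv_mul_cancel_left]
        · exfalso
          have := H.nf _ (h.glue (h'.replace hc (c1.trans ht)) c1.symm) (by
            rw [lprod_append, lprod_revinv, lprod_cons, c2]
            simp only [lprod_cons] at hp
            have h2 : i (a e) * Sum.elim i j y * lprod i j l' = Sum.elim i j x * lprod i j l := by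
              rw [hp, mul_assoc]
            simp only [mul_assoc] at h2 ⊢
            rw [h2]; simp)
          simp at this
      · exfalso
        have := H.nf _ (h.glue2 hy' (by simpa using ht)) (by
          rw [lprod_append, lprod_revinv, lprod_cons (lm a b e y), H.ev_lm, mul_assoc,
            ← lprod_cons, ← hp]; simp)
        simp at this

/-! costs -/

structure Cost (a : E →* K) (b : E →* Q) (cK : K → ℕ) (cQ : Q → ℕ) : Prop where
  one : cK 1 = 0
  mulK : ∀ x y, cK (x * y) ≤ cK x + cK y
  mulQ : ∀ x y, cQ (x * y) ≤ cQ x + cQ y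
  eq : ∀ e, cK (a e) = cQ (b e)

variable {cK : K → ℕ} {cQ : Q → ℕ}

def lcost (cK : K → ℕ) (cQ : Q → ℕ) (l : List (K ⊕ Q)) : ℕ := (l.map (Sum.elim cK cQ)).sum
@[simp] theorem lcost_nil : lcost cK cQ [] = 0 := rfl
@[simp] theorem lcost_cons (x l) :
    lcost cK cQ (x :: l) = Sum.elim cK cQ x + lcost cK cQ l := by simp [lcost]
@[simp] theorem lcost_append (l l') :
    lcost cK cQ (l ++ l') = lcost cK cQ l + lcost cK cQ l' := by simp [lcost]

theorem Cost.lm (C : Cost a b cK cQ) (e x) :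
    Sum.elim cK cQ (lm a b e x) ≤ cK (a e) + Sum.elim cK cQ x := by
  cases x
  · exact C.mulK _ _
  · rw [C.eq]; exact C.mulQ _ _
theorem Cost.rm (C : Cost a b cK cQ) (e x) :
    Sum.elim cK cQ (rm a b x e) ≤ Sum.elim cK cQ x + cK (a e) := by
  cases x
  · exact C.mulK _ _
  · rw [C.eq]; exact C.mulQ _ _

theorem Amalg.inE_cost (H : Amalg a b i j) (C : Cost a b cK cQ) (x : K ⊕ Q) (h : inE a b x) :
    ∃ e, Sum.elim i j x = i (a e) ∧ Sum.elim cK cQ x = cK (a e) := by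
  obtain ⟨e, h1, h2, h3⟩ := H.ev_of_inE x h
  refine ⟨e, h1, ?_⟩
  cases x
  · rw [← h2 _ rfl]; rfl
  · rw [C.eq, ← h3 _ rfl]; rfl

theorem Amalg.reduce (H : Amalg a b i j) (C : Cost a b cK cQ) (l : List (K ⊕ Q)) :
    (∃ l', RedL a b l' ∧ l' ≠ [] ∧ lprod i j l' = lprod i j l ∧ lcost cK cQ l' ≤ lcost cK cQ l) ∨
    (∃ e, lprod i j l = i (a e) ∧ cK (a e) ≤ lcost cK cQ l) := by
  induction l with
  | nil => exact .inr ⟨1, by simp, by simp [C.one]⟩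
  | cons x l ih =>
    rcases ih with ⟨l', h1, h2, h3, h4⟩ | ⟨e, h1, h2⟩
    · obtain ⟨y, m, rfl⟩ := List.exists_cons_of_ne_nil h2
      simp only [lcost_cons, lprod_cons] at *
      by_cases hx : inE a b x
      · obtain ⟨e, he, he'⟩ := H.inE_cost C x hx
        left
        refine ⟨lm a b e y :: m, h1.replace (by simpa using h1.head) (by simp), by simp, ?_, ?_⟩
        · rw [lprod_cons, H.ev_lm, he, ← h3, mul_assoc]
        · have := C.lm e y
          rw [lcost_cons]; omega
      by_cases ht : x.isLeft = y.isLeft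
      · have : ∃ c : K ⊕ Q, c.isLeft = x.isLeft ∧
            Sum.elim i j c = Sum.elim i j x * Sum.elim i j y ∧
            Sum.elim cK cQ c ≤ Sum.elim cK cQ x + Sum.elim cK cQ y := by
          cases x with
          | inl k =>
            cases y with
            | inl k' => exact ⟨.inl (k * k'), rfl, by simp, C.mulK _ _⟩
            | inr q => simp at ht
          | inr q =>
            cases y with
            | inr q' => exact ⟨.inr (q * q'), rfl, by simp, C.mulQ _ _⟩
            | inl q => simp at ht
        obtain ⟨c, c1, c2, c3⟩ := this
        by_cases hc : inE a b c
        · obtain ⟨e, he, he'⟩ := H.inE_cost C c hc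
          rw [he] at c2
          cases m with
          | nil =>
            right
            refine ⟨e, ?_, ?_⟩
            · rw [c2, ← h3]; simp
            · simp at h4; omega
          | cons u m =>
            left
            have h5 := h1.tail
            refine ⟨lm a b e u :: m, h5.replace (by simpa using h5.head) (by simp), by simp, ?_, ?_⟩
            · rw [lprod_cons, H.ev_lm, c2, ← h3, lprod_cons]; simp only [mul_assoc]
            · have := C.lm e u
              simp only [lcost_cons] at *; omega
        · left
          refine ⟨c :: m, h1.replace hc (c1.trans ht), by simp, ?_, ?_⟩
          · rw [lprod_cons, c2, ← h3, mul_assoc]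
          · rw [lcost_cons]; omega
      · left
        refine ⟨x :: y :: m, h1.cons hx ht, by simp, ?_, ?_⟩
        · rw [lprod_cons, lprod_cons, h3]
        · simp only [lcost_cons]; omega
    · simp only [lcost_cons, lprod_cons]
      have h3 := C.rm e x
      have h4 := H.ev_rm e x
      by_cases hx : inE a b (rm a b x e)
      · right
        obtain ⟨e', he, he'⟩ := H.inE_cost C _ hx
        exact ⟨e', by rw [h1, ← he, h4], by omega⟩
      · left
        exact ⟨[rm a b x e], RedL.single hx, by simp, by simp [h4, h1], by simp; omega⟩

theorem Amalg.cost_le_single (H : Amalg a b i j) (C : Cost a b cK cQ) (x : K ⊕ Q)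
    (l : List (K ⊕ Q)) (h : Sum.elim i j x = lprod i j l) :
    Sum.elim cK cQ x ≤ lcost cK cQ l := by
  rcases H.reduce C l with ⟨l', h1, h2, h3, h4⟩ | ⟨e, h1, h2⟩
  · by_cases hx : inE a b x
    · obtain ⟨e, he, he'⟩ := H.inE_cost C x hx
      have := H.unique [] l' e⁻¹ ⟨by simp, by simp⟩ h1 (by rw [h3, ← h, he]; simp)
      cases l' with
      | nil => exact absurd rfl h2
      | cons => simp [Mt] at this
    · have := H.unique [x] l' 1 (RedL.single hx) h1 (by rw [h3, ← h]; simp)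
      cases l' with
      | nil => exact absurd rfl h2
      | cons y l' =>
        obtain ⟨e', he', hm⟩ := this
        cases l' with
        | cons => simp [Mt] at hm
        | nil =>
          simp only [Mt] at hm
          subst hm
          have : y = x := by rw [he']; cases x <;> simp [ICP.lm, ICP.rm]
          rw [this] at h4
          simpa using h4
  · have hx : inE a b x := by
      rw [h1] at h
      cases x with
      | inl k => exact ⟨e, (H.iinj h).symm⟩
      | inr q =>
        rw [H.ab] at h
        exact ⟨e, (H.jinj h).symm⟩
    obtain ⟨e', he, he'⟩ := H.inE_cost C x hx
    rw [he'] 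
    have : e' = e := H.ainj (H.iinj (by rw [← he, h, h1]))
    rw [this]; exact h2

/-- lower bound for sequences equivalent to `l` -/
theorem Mt.cost_ge (C : Cost a b cK cQ) (h : K ⊕ Q → ℕ) (M : ℕ) (l : List (K ⊕ Q))
    (hK : ∀ k, .inl k ∈ l → ∀ e e', h (.inl k) + cK (a e) + cK (a e') ≤ M * cK ((a e)⁻¹ * k * a e'))
    (hQ : ∀ q, .inr q ∈ l → ∀ e e', h (.inr q) ≤ M * cQ ((b e)⁻¹ * q * b e') + cK (a e) + cK (a e'))
    (hc : l.IsChain fun x y => x.isLeft ≠ y.isLeft) :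
    ∀ (e : E) (l' : List (K ⊕ Q)), Mt a b e l l' →
      (l.map h).sum ≤ M * lcost cK cQ l' + cK (a e) ∧
      (∀ k m, l = .inl k :: m → (l.map h).sum + cK (a e) ≤ M * lcost cK cQ l') := by
  induction l with
  | nil => intro e l' _; simp
  | cons x l ih =>
    intro e l' hm
    cases l' with
    | nil => simp [Mt] at hm
    | cons y l' =>
      obtain ⟨e', he', hm⟩ := hm
      obtain ⟨i1, i2⟩ := ih (fun k hk => hK k (List.mem_cons_of_mem _ hk))
        (fun k hk => hQ k (List.mem_cons_of_mem _ hk)) hc.tail e' l' hm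
      cases x with
      | inl k =>
        have := hK k List.mem_cons_self e e'
        have hy : y = .inl ((a e)⁻¹ * k * a e') := by rw [he']; simp [ICP.lm, ICP.rm, mul_assoc]
        subst hy
        simp only [List.map_cons, List.sum_cons, lcost_cons, Sum.elim_inl, mul_add]
        refine ⟨by omega, fun _ _ _ => by omega⟩
      | inr q =>
        have := hQ q List.mem_cons_self e e'
        have hy : y = .inr ((b e)⁻¹ * q * b e') := by rw [he']; simp [ICP.lm, ICP.rm, mul_assoc]
        subst hy
        simp only [List.map_cons, List.sum_cons, lcost_cons, Sum.elim_inr, mul_add]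
        refine ⟨?_, fun _ _ h => by simp at h⟩
        cases l with
        | nil =>
          cases l' with
          | cons => simp [Mt] at hm
          | nil =>
            simp only [Mt] at hm
            subst hm
            simp [C.one] at this ⊢; omega
        | cons u l =>
          cases u with
          | inl k' =>
            have := i2 k' l rfl
            omega
          | inr q' => simp at hc

theorem Amalg.cost_ge (H : Amalg a b i j) (C : Cost a b cK cQ) (h : K ⊕ Q → ℕ) (M : ℕ)
    (l l' : List (K ⊕ Q)) (hl : RedL a b l) (hne : l ≠ [])
    (hK : ∀ k, .inl k ∈ l → ∀ e e', h (.inl k) + cK (a e) + cK (a e') ≤ M * cK ((a e)⁻¹ * k * a e'))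
    (hQ : ∀ q, .inr q ∈ l → ∀ e e', h (.inr q) ≤ M * cQ ((b e)⁻¹ * q * b e') + cK (a e) + cK (a e'))
    (hp : lprod i j l = lprod i j l') : (l.map h).sum ≤ M * lcost cK cQ l' := by
  rcases H.reduce C l' with ⟨l'', h1, h2, h3, h4⟩ | ⟨e, h1, h2⟩
  · have := (Mt.cost_ge C h M l hK hQ hl.2 1 l'' (H.unique l l'' 1 hl h1 (by rw [h3, hp]; simp))).1
    rw [map_one, C.one] at this
    calc _ ≤ _ := this
      _ ≤ _ := by simpa using Nat.mul_le_mul_left M h4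
  · have := H.unique l [] e hl ⟨by simp, by simp⟩ (by rw [hp, h1]; simp)
    cases l with
    | nil => exact absurd rfl hne
    | cons => simp [Mt] at this

theorem stable_le {A B C : ℕ} (h : ∀ N, N * A ≤ C + N * B) : A ≤ B := by
  by_contra hc
  have := h (C + 1)
  have h2 : (C + 1) * (B + 1) ≤ (C + 1) * A := Nat.mul_le_mul_left _ (by omega)
  nlinarith

theorem lprod_replicate (N : ℕ) (l : List (K ⊕ Q)) :
    lprod i j (List.replicate N l).flatten = lprod i j l ^ N := by
  induction N with
  | zero => simp
  | succ N ih => simp [List.replicate_succ, ih, pow_succ']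
theorem lcost_replicate (N : ℕ) (l : List (K ⊕ Q)) :
    lcost cK cQ (List.replicate N l).flatten = N * lcost cK cQ l := by
  induction N with
  | zero => simp
  | succ N ih => simp [List.replicate_succ, ih]; ring

theorem Amalg.conj_pow {p x y w : P} (h : x * y = 1) (hp : p = x * w * y) (N : ℕ) :
    p ^ N = x * w ^ N * y := by
  have : y = x⁻¹ := (inv_eq_of_mul_eq_one_right h).symm
  subst this
  rw [hp, _root_.conj_pow]

theorem Amalg.stable_single (H : Amalg a b i j) (C : Cost a b cK cQ) (x : ℕ → K ⊕ Q) (p : P)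
    (hx : ∀ N, Sum.elim i j (x N) = p ^ N) (A : ℕ) (hA : ∀ N, N * A ≤ Sum.elim cK cQ (x N))
    (lx ly lw : List (K ⊕ Q)) (hxy : lprod i j lx * lprod i j ly = 1)
    (hp : p = lprod i j lx * lprod i j lw * lprod i j ly) : A ≤ lcost cK cQ lw := by
  refine stable_le (C := lcost cK cQ lx + lcost cK cQ ly) fun N => ?_
  have := H.cost_le_single C (x N) (lx ++ ((List.replicate N lw).flatten ++ ly)) (by
    rw [hx, Amalg.conj_pow hxy hp, lprod_append, lprod_append, lprod_replicate, mul_assoc])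
  rw [lcost_append, lcost_append, lcost_replicate] at this
  have := hA N
  omega

theorem Amalg.stable_list (H : Amalg a b i j) (C : Cost a b cK cQ) (h : K ⊕ Q → ℕ) (M : ℕ)
    (l : List (K ⊕ Q)) (hl : ∀ N, RedL a b (List.replicate N l).flatten) (hne : l ≠ [])
    (hK : ∀ k, .inl k ∈ l → ∀ e e', h (.inl k) + cK (a e) + cK (a e') ≤ M * cK ((a e)⁻¹ * k * a e'))
    (hQ : ∀ q, .inr q ∈ l → ∀ e e', h (.inr q) ≤ M * cQ ((b e)⁻¹ * q * b e') + cK (a e) + cK (a e'))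
    (lx ly lw : List (K ⊕ Q)) (hxy : lprod i j lx * lprod i j ly = 1)
    (hp : lprod i j l = lprod i j lx * lprod i j lw * lprod i j ly) :
    (l.map h).sum ≤ M * lcost cK cQ lw := by
  refine stable_le (C := M * (lcost cK cQ lx + lcost cK cQ ly)) fun N => ?_
  cases N with
  | zero => simp
  | succ N =>
  have hmem : ∀ x, x ∈ (List.replicate (N + 1) l).flatten → x ∈ l := by
    intro x hx
    simpa using hx
  have := H.cost_ge C h M (List.replicate (N + 1) l).flatten
    (lx ++ ((List.replicate (N + 1) lw).flatten ++ ly)) (hl _)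
    (by simp [List.replicate_succ, hne]) (fun k hk => hK k (hmem _ hk))
    (fun k hk => hQ k (hmem _ hk)) (by
      rw [lprod_replicate, Amalg.conj_pow hxy hp, lprod_append, lprod_append, lprod_replicate,
        mul_assoc])
  rw [lcost_append, lcost_append, lcost_replicate] at this
  have h5 : ((List.replicate (N + 1) l).flatten.map h).sum = (N + 1) * (l.map h).sum := by
    simp [List.map_flatten, List.sum_flatten]
  rw [h5] at this
  nlinarith
end amalg
end ICP

namespace ICP
open FreeGroup hiding map_mul map_one map_inv IsReduced norm

abbrev Lg := FreeGroup (Fin 6)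
abbrev Gen := Zt × Lg
abbrev NQ := FreeGroup Gen

def shE (l : Lg) : Gen ≃ Gen := Equiv.prodCongr (Equiv.refl Zt) (Equiv.mulLeft l)

def act : Lg →* MulAut NQ where
  toFun l := freeGroupCongr (shE l)
  map_one' := by
    have : shE 1 = Equiv.refl _ := by ext x <;> simp [shE]
    rw [this, freeGroupCongr_refl]; rfl
  map_mul' x y := by
    have : shE (x * y) = (shE y).trans (shE x) := by ext z <;> simp [shE, mul_assoc]
    rw [this, ← freeGroupCongr_trans]; rfl

def sh (l : Lg) (x : Gen × Bool) : Gen × Bool := ((x.1.1, l * x.1.2), x.2)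

theorem act_mk (l : Lg) (u) : act l (mk u) = mk (u.map (sh l)) := rfl

theorem isReduced_map {X Y : Type*} {g : X → Y} (hg : Function.Injective g)
    {u : List (X × Bool)} (h : FreeGroup.IsReduced u) :
    FreeGroup.IsReduced (u.map fun x => (g x.1, x.2)) := by
  unfold FreeGroup.IsReduced at *
  rw [List.isChain_map]
  exact h.imp fun x y h e => h (hg e)

theorem toWord_map_inj {X Y : Type*} [DecidableEq X] [DecidableEq Y] {g : X → Y}
    (hg : Function.Injective g) (x : FreeGroup X) :
    (FreeGroup.map g x).toWord = x.toWord.map fun y => (g y.1, y.2) := by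
  conv_lhs => rw [← mk_toWord (x := x), map.mk, toWord_mk]
  exact isReduced_iff_reduce_eq.1 (isReduced_map hg isReduced_toWord)

theorem toWord_act (l : Lg) (x : NQ) : (act l x).toWord = x.toWord.map (sh l) :=
  toWord_map_inj (shE l).injective x

theorem sh_sh (l m : Lg) (x) : sh l (sh m x) = sh (l * m) x := by simp [sh, mul_assoc]
@[simp] theorem sh_one (x) : sh 1 x = x := by simp [sh]

theorem isReduced_sh (l : Lg) {u} (h : FreeGroup.IsReduced u) : FreeGroup.IsReduced (u.map (sh l)) :=
  isReduced_map (shE l).injective h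

abbrev Qg := NQ ⋊[act] Lg

section can
variable (wf : ℕ → Option Lg)

/-- canonical representative of a generator -/
def can (x : Gen) : Gen := match x with
  | ((j, true), p) => ((j, true), p)
  | ((j, false), p) => match wf j with
    | none => ((j, false), p)
    | some W => ((j, true), p * W⁻¹)

def canL (x : Gen × Bool) : Gen × Bool := (can wf x.1, x.2)

theorem can_smul (l : Lg) (z p) : can wf (z, l * p) = shE l (can wf (z, p)) := by
  obtain ⟨j, s⟩ := z
  cases s <;> simp [can, shE]
  cases wf j <;> simp [mul_assoc]

theorem canL_sh (l : Lg) (x) : canL wf (sh l x) = sh l (canL wf x) := by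
  have := can_smul wf l x.1.1 x.1.2
  simp only [canL, sh, this]
  rfl

theorem can_can (x) : can wf (can wf x) = can wf x := by
  obtain ⟨⟨j, s⟩, p⟩ := x
  cases s <;> simp [can]
  cases h : wf j <;> simp [can, h]

theorem can_fst (x) : (can wf x).1.1 = x.1.1 := by
  obtain ⟨⟨j, s⟩, p⟩ := x
  cases s <;> simp [can]
  cases h : wf j <;> simp

def canE (z : Zt) : Gen := can wf (z, 1)

def beta : FreeGroup Zt →* Qg := SemidirectProduct.inl.comp (FreeGroup.map (canE wf))

variable {wf}
theorem canE_inj (hW : ∀ j W, wf j = some W → W ≠ 1) : Function.Injective (canE wf) := by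
  rintro ⟨j, s⟩ ⟨j', s'⟩ h
  have h0 := congrArg (fun x => x.1.1) h
  simp only [canE, can_fst] at h0
  subst h0
  cases s <;> cases s' <;> simp [canE, can] at h ⊢
  all_goals
    cases hw : wf j with
    | none => simp [hw] at h
    | some W =>
      have := hW j W hw
      simp [hw] at h
      first
      | exact this h
      | exact this h.symm

theorem beta_inj (hW : ∀ j W, wf j = some W → W ≠ 1) : Function.Injective (beta wf) :=
  SemidirectProduct.inl_injective.comp (map_injective (canE_inj hW))

theorem toWord_beta (hW : ∀ j W, wf j = some W → W ≠ 1) (e) :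
    (beta wf e).left.toWord = e.toWord.map fun y => (canE wf y.1, y.2) :=
  toWord_map_inj (canE_inj hW) e

@[simp] theorem beta_right (e) : (beta wf e).right = 1 := rfl

/-! first cost -/
def cK1 (k : FreeGroup Kl) : ℕ := max (10 * wt0 k.toWord) (9 * k.norm)
def zwt (u : List (Gen × Bool)) : ℕ := (u.map fun x => x.1.1.1 + 1).sum
def cQ1 (q : Qg) : ℕ := 180 * zwt q.left.toWord

theorem zwt_append (u v) : zwt (u ++ v) = zwt u + zwt v := by simp [zwt]
theorem zwt_sh (l u) : zwt (u.map (sh l)) = zwt u := by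
  simp [zwt, sh, Function.comp_def]
theorem zwt_sublist {u v} (h : List.Sublist u v) : zwt u ≤ zwt v := by
  exact (h.map _).sum_le_sum (by simp)
theorem zwt_canL (u) : zwt (u.map (canL wf)) = zwt u := by
  simp [zwt, canL, Function.comp_def, can_fst]

theorem norm_zw (z s) : (mk (zw z s)).norm = 20 * (z.1 + 1) := by
  rw [FreeGroup.norm, toWord_mk_zw, length_zw]

theorem norm_alph_le (l : List (Zt × Bool)) : (alph (mk l)).norm ≤ 20 * omg l := by
  induction l with
  | nil => simp [← one_eq_mk, omg]
  | cons x l ih =>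
    obtain ⟨z, s⟩ := x
    rw [alph_cons]
    have := norm_mul_le (mk (zw z s)) (alph (mk l))
    rw [norm_zw] at this
    simp [omg] at *; omega

theorem cK1_alph (e) : cK1 (alph e) = 180 * omg e.toWord := by
  have h := (alph_main e.toWord isReduced_toWord).2.2
  have h2 := norm_alph_le e.toWord
  rw [mk_toWord] at h h2
  unfold cK1
  omega

theorem cost1 (hW : ∀ j W, wf j = some W → W ≠ 1) : Cost alph (beta wf) cK1 cQ1 where
  one := by simp [cK1, wt0]
  mulK x y := by
    have h1 := norm_mul_le x y
    have h2 : wt0 (x * y).toWord ≤ wt0 x.toWord + wt0 y.toWord := by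
      rw [← wt0_append]; exact (toWord_mul_sublist x y).countP_le
    unfold cK1; omega
  mulQ x y := by
    have : zwt (x * y).left.toWord ≤ zwt x.left.toWord + zwt y.left.toWord := by
      rw [SemidirectProduct.mul_left, ← zwt_sh x.right y.left.toWord, ← toWord_act, ← zwt_append]
      exact zwt_sublist (toWord_mul_sublist _ _)
    unfold cQ1; omega
  eq e := by
    rw [cK1_alph, cQ1, toWord_beta hW]
    simp only [zwt, omg, List.map_map, Function.comp_def, canE, can_fst]

/-! second cost -/

/-- length of the path from `a` through the given points to `e` -/
def plen (a : Lg) : List Lg → Lg → ℕ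
  | [], e => (a⁻¹ * e).norm
  | p :: l, e => (a⁻¹ * p).norm + plen p l e

theorem d_tri (a b c : Lg) : (a⁻¹ * c).norm ≤ (a⁻¹ * b).norm + (b⁻¹ * c).norm := by
  have := norm_mul_le (a⁻¹ * b) (b⁻¹ * c)
  simpa [mul_assoc] using this
theorem d_symm (a b : Lg) : (a⁻¹ * b).norm = (b⁻¹ * a).norm := by
  rw [← norm_inv_eq]; simp

theorem plen_tri (a b : Lg) (l e) : plen a l e ≤ (a⁻¹ * b).norm + plen b l e := by
  cases l with
  | nil => exact d_tri a b e
  | cons p l =>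
    have := d_tri a b p
    simp only [plen]; omega

theorem plen_append (a : Lg) (l m b e) : plen a (l ++ b :: m) e = plen a l b + plen b m e := by
  induction l generalizing a with
  | nil => simp [plen]
  | cons p l ih => simp [plen, ih, add_assoc]

theorem plen_append_le (a : Lg) (l m b e) : plen a (l ++ m) e ≤ plen a l b + plen b m e := by
  induction l generalizing a with
  | nil => simpa [plen] using plen_tri a b m e
  | cons p l ih => have := ih p; simp only [plen, List.cons_append] at *; omega

theorem plen_smul (c a : Lg) (l e) : plen (c * a) (l.map (c * ·)) (c * e) = plen a l e := by
  induction l generalizing a with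
  | nil => simp [plen, mul_assoc]
  | cons p l ih => simp [plen, ih, mul_assoc]

theorem plen_sublist {l l' : List Lg} (h : List.Sublist l l') (a e) : plen a l e ≤ plen a l' e := by
  induction h generalizing a with
  | slnil => rfl
  | @cons l₁ l₂ x h ih =>
    have := ih x
    have := plen_tri a x l₁ e
    simp only [plen]
    omega
  | cons_cons x h ih => have := ih x; simp only [plen]; omega

theorem plen_mem {l : List Lg} {p} (hp : p ∈ l) (a e) : (a⁻¹ * p).norm ≤ plen a l e := by
  induction l generalizing a with
  | nil => simp at hp
  | cons q l ih =>
    simp only [plen]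
    rcases List.mem_cons.1 hp with rfl | hp
    · omega
    · have := ih hp q
      have := d_tri a q p
      omega

theorem plen_end (l : List Lg) (a e) : (a⁻¹ * e).norm ≤ plen a l e := by
  induction l generalizing a with
  | nil => exact le_rfl
  | cons q l ih => have := ih q; have := d_tri a q e; simp only [plen]; omega

variable (wf) in
/-- admissible positions of a generator -/
def Adm (p : Lg) (x : Gen) : Prop := p = x.2 ∨ (x.1.2 = true ∧ ∃ W, wf x.1.1 = some W ∧ p = x.2 * W)

variable (wf) in
def Bw (j : ℕ) : ℕ := match wf j with
  | none => 0
  | some W => W.norm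

theorem adm_can (x : Gen) : Adm wf x.2 (can wf x) := by
  obtain ⟨⟨j, s⟩, p⟩ := x
  cases s
  · cases h : wf j with
    | none => left; simp [can, h]
    | some W => right; simp [can, h]
  · left; rfl

theorem Adm.dist {p p' x} (h : Adm wf p x) (h' : Adm wf p' x) : (p⁻¹ * p').norm ≤ Bw wf x.1.1 := by
  rcases h with rfl | ⟨_, W, hW, rfl⟩ <;> rcases h' with rfl | ⟨_, W', hW', rfl⟩
  · simp
  · simp [Bw, hW']
  · simp [Bw, hW]
  · rw [hW] at hW'; cases hW'; simp

theorem Adm.smul {p x} (l : Lg) (h : Adm wf p x) : Adm wf (l * p) (x.1, l * x.2) := by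
  rcases h with rfl | ⟨h1, W, hW, rfl⟩
  · left; rfl
  · right; exact ⟨h1, W, hW, by simp [mul_assoc]⟩

/-- sequences of positioned letters -/
abbrev Pos := List (Lg × (Gen × Bool))

variable (wf) in
def AdmL (D : Pos) : Prop := ∀ y ∈ D, Adm wf y.1 y.2.1

def shP (l : Lg) (D : Pos) : Pos := D.map fun y => (l * y.1, sh l y.2)

theorem AdmL.sh {D} (h : AdmL wf D) (l : Lg) : AdmL wf (shP l D) := by
  intro y hy
  obtain ⟨x, hx, rfl⟩ := List.mem_map.1 hy
  exact (h x hx).smul l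

variable (wf) in
noncomputable def cQ2 (q : Qg) : ℕ := sInf {n | ∃ D : Pos, AdmL wf D ∧ mk (D.map Prod.snd) = q.left ∧
  n = plen 1 (D.map Prod.fst) q.right}

theorem cQ2_le {q : Qg} {D : Pos} (h : AdmL wf D) (h2 : mk (D.map Prod.snd) = q.left) :
    cQ2 wf q ≤ plen 1 (D.map Prod.fst) q.right := Nat.sInf_le ⟨D, h, h2, rfl⟩

theorem cQ2_spec (q : Qg) : ∃ D : Pos, AdmL wf D ∧ mk (D.map Prod.snd) = q.left ∧
    cQ2 wf q = plen 1 (D.map Prod.fst) q.right := by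
  apply Nat.sInf_mem (s := {n | ∃ D : Pos, AdmL wf D ∧ mk (D.map Prod.snd) = q.left ∧
    n = plen 1 (D.map Prod.fst) q.right})
  refine ⟨_, q.left.toWord.map (fun x => (x.1.2, x)), ?_, ?_, rfl⟩
  · intro y hy
    obtain ⟨x, hx, rfl⟩ := List.mem_map.1 hy
    exact .inl rfl
  · rw [List.map_map]
    simp [Function.comp_def, mk_toWord]

theorem cQ2_beta (e) : cQ2 wf (beta wf e) = 0 := by
  have h : ∀ y ∈ e.toWord.map (fun y => ((1 : Lg), ((canE wf y.1, y.2) : Gen × Bool))),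
      Adm wf y.1 y.2.1 := by
    intro y hy
    obtain ⟨x, hx, rfl⟩ := List.mem_map.1 hy
    exact adm_can (wf := wf) (x.1, 1)
  have h2 := cQ2_le (wf := wf) (q := beta wf e) h (by
    rw [List.map_map]
    conv_rhs => rw [← mk_toWord (x := e)]
    rfl)
  have h3 : ∀ n : ℕ, plen 1 (List.replicate n 1) 1 = 0 := by
    intro n; induction n with
    | zero => simp [plen]
    | succ n ih => simp [List.replicate_succ, plen, ih]
  rw [List.map_map] at h2
  have h4 : (e.toWord.map (Prod.fst ∘ fun y => ((1 : Lg), ((canE wf y.1, y.2) : Gen × Bool)))) =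
    List.replicate e.toWord.length 1 := by
      rw [List.eq_replicate_iff]; simp
  rw [h4, beta_right, h3] at h2
  omega

theorem cost2 : Cost alph (beta wf) (fun _ => 0) (cQ2 wf) where
  one := rfl
  mulK x y := by simp
  mulQ x y := by
    obtain ⟨D, h1, h2, h3⟩ := cQ2_spec (wf := wf) x
    obtain ⟨D', h1', h2', h3'⟩ := cQ2_spec (wf := wf) y
    have a1 : AdmL wf (D ++ shP x.right D') := by
      intro z hz
      rcases List.mem_append.1 hz with hz | hz
      · exact h1 z hz
      · exact (h1'.sh x.right) z hz
    have := cQ2_le (q := x * y) a1 (by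
      rw [SemidirectProduct.mul_left, List.map_append, ← mul_mk, h2, ← h2', act_mk]
      simp [shP, Function.comp_def])
    refine this.trans ?_
    rw [List.map_append, h3, h3', ← plen_smul x.right 1 (D'.map Prod.fst) y.right,
      mul_one]
    have e1 : (shP x.right D').map Prod.fst = (D'.map Prod.fst).map (x.right * ·) := by
      simp [shP, Function.comp_def]
    rw [e1, SemidirectProduct.mul_right]
    exact plen_append_le _ _ _ _ _
  eq e := (cQ2_beta e).symm

/-- lower bound for the second cost -/
theorem plen_le_of_same (D D' : Pos) (h : AdmL wf D) (h' : AdmL wf D')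
    (hs : D.map Prod.snd = D'.map Prod.snd) (a a' e) :
    plen a (D.map Prod.fst) e ≤ (a⁻¹ * a').norm + plen a' (D'.map Prod.fst) e +
      2 * (D.map fun y => Bw wf y.2.1.1.1).sum := by
  induction D generalizing D' a a' with
  | nil =>
    cases D' with
    | nil => simpa [plen] using d_tri a a' e
    | cons => simp at hs
  | cons x D ih =>
    cases D' with
    | nil => simp at hs
    | cons x' D' =>
      simp only [List.map_cons, List.cons.injEq] at hs
      have i := ih D' (fun y hy => h y (List.mem_cons_of_mem _ hy))
        (fun y hy => h' y (List.mem_cons_of_mem _ hy)) hs.2 x.1 x'.1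
      have b1 := h x List.mem_cons_self
      have b2 := h' x' List.mem_cons_self
      rw [← hs.1] at b2
      have b3 := b1.dist b2
      have t1 := d_tri a a' x.1
      have t2 := d_tri a' x'.1 x.1
      rw [d_symm x'.1] at t2
      simp only [List.map_cons, plen, List.sum_cons]
      omega

theorem exists_sub (D : Pos) {u : List (Gen × Bool)} (h : List.Sublist u (D.map Prod.snd)) :
    ∃ D', List.Sublist D' D ∧ D'.map Prod.snd = u := by
  obtain ⟨l, h1, h2⟩ := List.sublist_map_iff.1 h
  exact ⟨l, h1, h2.symm⟩

theorem cQ2_ge (q : Qg) (D : Pos) (h : AdmL wf D) (hr : FreeGroup.IsReduced (D.map Prod.snd))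
    (h2 : mk (D.map Prod.snd) = q.left) :
    plen 1 (D.map Prod.fst) q.right ≤ cQ2 wf q + 2 * (D.map fun y => Bw wf y.2.1.1.1).sum := by
  obtain ⟨D', h1', h2', h3'⟩ := cQ2_spec (wf := wf) q
  have : List.Sublist (D.map Prod.snd) (D'.map Prod.snd) := by
    have e : reduce (D'.map Prod.snd) = D.map Prod.snd := by
      rw [← toWord_mk, h2', ← h2, toWord_mk]; exact isReduced_iff_reduce_eq.1 hr
    rw [← e]
    exact (reduce.red (L := D'.map Prod.snd)).sublist
  obtain ⟨D'', s1, s2⟩ := exists_sub D' this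
  have k1 := plen_le_of_same D D'' h (fun y hy => h1' y (s1.subset hy)) s2.symm 1 1 q.right
  have k2 := plen_sublist (s1.map Prod.fst) 1 q.right
  simp at k1
  omega

end can
end ICP

namespace ICP
open FreeGroup hiding map_mul map_one map_inv IsReduced norm

def embK (k : Kl) : Fin 46 := if k.1 then genA k.2 else genB k.2
def embL (l : Fin 6) : Fin 46 := ⟨40 + l, by omega⟩

def dec46 (n : Fin 46) : Kl ⊕ Fin 6 :=
  if h : (n : ℕ) < 20 then .inl (true, ⟨n, h⟩)
  else if h : (n : ℕ) < 40 then .inl (false, ⟨n - 20, by omega⟩)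
  else .inr ⟨n - 40, by omega⟩

theorem dec_embK (k : Kl) : dec46 (embK k) = .inl k := by revert k; decide
theorem dec_embL (k) : dec46 (embL k) = .inr k := by revert k; decide
theorem emb_dec (n) : Sum.elim embK embL (dec46 n) = n := by revert n; decide

/-- mapping letters -/
def lmap {X Y : Type*} (g : X → Y) (w : Word X) : Word Y := w.map fun x => (g x.1, x.2)

def W6 (i t : ℕ) : Word (Fin 6) :=
  List.replicate i (0, true) ++ List.replicate t (3, true) ++
  List.replicate i (1, true) ++ List.replicate t (4, true) ++
  List.replicate i (2, true) ++ List.replicate t (5, true)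

theorem conjWord_eq (i t) : conjWord i t = lmap embL (W6 i t) := by
  simp [conjWord, W6, lmap, genPow, List.map_replicate]
  rfl

theorem conjWordInv_eq (i t) : conjWordInv i t = invRev (conjWord i t) := by
  simp [conjWordInv, conjWord, invRev, genPow, List.map_replicate]

theorem aWord_eq (j) : aWord (j+1) = lmap embK (zw (j, true) true) := by
  rw [zw_true_eq]
  have : List.range 20 = [0,1,2,3,4,5,6,7,8,9,10,11,12,13,14,15,16,17,18,19] := rfl
  simp only [this, aWord, genPow, lmap, List.flatMap_cons, List.flatMap_nil, List.map_append, List.map_replicate]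
  simp only [List.ofFn_succ, List.flatten_cons, List.ofFn_zero, List.flatten_nil]
  rfl

theorem bWord_eq (j) : bWord (j+1) = lmap embK (zw (j, false) true) := by
  rw [zw_true_eq]
  have : List.range 20 = [0,1,2,3,4,5,6,7,8,9,10,11,12,13,14,15,16,17,18,19] := rfl
  simp only [this, bWord, genPow, lmap, List.flatMap_cons, List.flatMap_nil, List.map_append, List.map_replicate]
  simp only [List.ofFn_succ, List.flatten_cons, List.ofFn_zero, List.flatten_nil]
  rfl

theorem invRev_app {X : Type*} (u v : Word X) : invRev (u ++ v) = invRev v ++ invRev u := by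
  simp [invRev]

theorem bWordRevInv_eq (j) : bWordRevInv j = invRev (bWord j) := by
  simp only [bWordRevInv, bWord, List.ofFn_succ, List.flatten_cons, List.ofFn_zero, List.flatten_nil,
    invRev_app, List.append_assoc]
  simp only [genPow, invRev, List.map_replicate, List.reverse_replicate, List.nil_append, List.append_nil, List.map_nil, List.reverse_nil]
  rfl

theorem mk_lmap {X Y : Type*} (g : X → Y) (w : Word X) : mk (lmap g w) = FreeGroup.map g (mk w) := rfl

theorem mk_relator (f t : ℕ → ℕ) (i j : ℕ) (h : f i = j + 1) :
    mk (relatorWord f t i) = FreeGroup.map embK (mk (zw (j, true) true)) * FreeGroup.map embL (mk (W6 i (t i))) *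
      (FreeGroup.map embK (mk (zw (j, false) true)))⁻¹ * (FreeGroup.map embL (mk (W6 i (t i))))⁻¹ := by
  rw [relatorWord, h, bWordRevInv_eq, conjWordInv_eq, aWord_eq, bWord_eq, conjWord_eq]
  simp only [← mul_mk, ← inv_mk, mk_lmap]

theorem isReduced_W6 (i t) : FreeGroup.IsReduced (W6 i t) := by
  have h : ∀ x ∈ W6 i t, x.2 = true := by
    intro x hx
    simp only [W6, List.mem_append, List.mem_replicate] at hx
    aesop
  unfold FreeGroup.IsReduced
  rw [List.isChain_iff_getElem]
  intro n hn _
  rw [h _ (List.getElem_mem _), h _ (List.getElem_mem _)]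

theorem norm_W6 (i t) : (mk (W6 i t)).norm = 3 * i + 3 * t := by
  rw [FreeGroup.norm, toWord_mk, isReduced_iff_reduce_eq.1 (isReduced_W6 i t)]
  simp [W6]; ring

section G
variable (f t : ℕ → ℕ)
open Classical in
/-- the conjugator attached to exponent `j+1` -/
noncomputable def wfOf (j : ℕ) : Option Lg :=
  if h : ∃ i, 1 ≤ i ∧ f i = j + 1 then some (mk (W6 h.choose (t h.choose))) else none

theorem wfOf_some (hf : Function.Injective f) {i j} (hi : 1 ≤ i) (h : f i = j + 1) :
    wfOf f t j = some (mk (W6 i (t i))) := by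
  have hh : ∃ i, 1 ≤ i ∧ f i = j + 1 := ⟨i, hi, h⟩
  have : hh.choose = i := hf (hh.choose_spec.2.trans h.symm)
  unfold wfOf
  rw [dif_pos hh, this]

theorem wfOf_elim {j W} (h : wfOf f t j = some W) : ∃ i, 1 ≤ i ∧ f i = j + 1 ∧ W = mk (W6 i (t i)) := by
  unfold wfOf at h
  split at h
  · rename_i hh
    exact ⟨_, hh.choose_spec.1, hh.choose_spec.2, (Option.some.inj h).symm⟩
  · simp at h

theorem wfOf_ne (j W) (h : wfOf f t j = some W) : W ≠ 1 := by
  obtain ⟨i, hi, _, rfl⟩ := wfOf_elim f t h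
  intro h1
  have := norm_W6 i (t i)
  rw [h1, FreeGroup.norm_one] at this
  omega

def toG : FreeGroup (Fin 46) →* GroupG f t := QuotientGroup.mk' _
def evK : FreeGroup Kl →* GroupG f t := (toG f t).comp (FreeGroup.map embK)
def evL : Lg →* GroupG f t := (toG f t).comp (FreeGroup.map embL)
def evZ (z : Zt) : GroupG f t := evK f t (mk (zw z true))
def evN : NQ →* GroupG f t := FreeGroup.lift fun x => evL f t x.2 * evZ f t x.1 * (evL f t x.2)⁻¹
def evQ : Qg →* GroupG f t := SemidirectProduct.lift (evN f t) (evL f t) (by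
  intro l
  ext x
  show evN f t (act l (of x)) = evL f t l * evN f t (of x) * (evL f t l)⁻¹
  have : act l (of x) = of (x.1, l * x.2) := rfl
  rw [this]
  simp [evN, mul_assoc])

theorem evRel {i j} (hi : 1 ≤ i) (h : f i = j + 1) :
    evZ f t (j, true) = evL f t (mk (W6 i (t i))) * evZ f t (j, false) * (evL f t (mk (W6 i (t i))))⁻¹ := by
  have h1 : toG f t (mk (relatorWord f t i)) = 1 := by
    apply (QuotientGroup.eq_one_iff _).2
    exact Subgroup.subset_normalClosure ⟨i, hi, rfl⟩
  rw [mk_relator f t i j h] at h1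
  simp only [map_mul, map_inv] at h1
  simp only [evZ, evK, evL, MonoidHom.comp_apply]
  rw [mul_inv_eq_one, mul_inv_eq_iff_eq_mul] at h1
  rw [← h1]
  simp

theorem evN_can (x : Gen) : evN f t (of (can (wfOf f t) x)) = evN f t (of x) := by
  obtain ⟨⟨j, s⟩, p⟩ := x
  cases s
  · cases h : wfOf f t j with
    | none => simp [can, h]
    | some W =>
      obtain ⟨i, hi, hj, rfl⟩ := wfOf_elim f t h
      have := evRel f t hi hj
      simp only [can, h, evN, FreeGroup.lift_apply_of, this, map_mul, map_inv]
      group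
  · rfl

theorem ev_beta (e) : evQ f t (beta (wfOf f t) e) = evK f t (alph e) := by
  have : (evQ f t).comp (beta (wfOf f t)) = (evK f t).comp alph := by
    ext z
    show evQ f t (SemidirectProduct.inl (of (canE (wfOf f t) z))) = evK f t (alph (of z))
    rw [evQ, SemidirectProduct.lift_inl, canE, evN_can]
    simp [evN, evZ, alph]
  exact DFunLike.congr_fun this e

variable (hf : Function.Injective f) (hf1 : ∀ i : ℕ, 1 ≤ i → 1 ≤ f i)

noncomputable abbrev P0 := PP alph (beta (wfOf f t))

noncomputable def gam0 : FreeGroup (Fin 46) →* P0 f t := FreeGroup.lift fun n =>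
  Sum.elim (fun k => iP alph (beta (wfOf f t)) (of k))
    (fun l => jP alph (beta (wfOf f t)) (SemidirectProduct.inr (of l))) (dec46 n)

theorem gam0_K (k) : gam0 f t (FreeGroup.map embK k) = iP alph (beta (wfOf f t)) k := by
  have : (gam0 f t).comp (FreeGroup.map embK) = iP alph (beta (wfOf f t)) := by
    ext z
    simp [gam0, dec_embK]
  exact DFunLike.congr_fun this k

theorem gam0_L (k) : gam0 f t (FreeGroup.map embL k) =
    jP alph (beta (wfOf f t)) (SemidirectProduct.inr k) := by
  have : (gam0 f t).comp (FreeGroup.map embL) =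
      (jP alph (beta (wfOf f t))).comp SemidirectProduct.inr := by
    ext z
    simp [gam0, dec_embL]
  exact DFunLike.congr_fun this k

theorem amalgG : Amalg alph (beta (wfOf f t)) (iP alph (beta (wfOf f t))) (jP alph (beta (wfOf f t))) :=
  amalgP _ _ alph_injective (beta_inj (wfOf_ne f t))

theorem iP_zw (z) : iP alph (beta (wfOf f t)) (mk (zw z true)) =
    jP alph (beta (wfOf f t)) (SemidirectProduct.inl (of (canE (wfOf f t) z))) := by
  have := (amalgG f t).ab (of z)
  rw [show alph (of z) = mk (zw z true) by simp [alph]] at this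
  rw [this]; rfl

theorem jP_conj (p : Lg) (x : Gen) : jP alph (beta (wfOf f t)) (SemidirectProduct.inr p) *
    jP alph (beta (wfOf f t)) (SemidirectProduct.inl (of x)) *
    (jP alph (beta (wfOf f t)) (SemidirectProduct.inr p))⁻¹ =
    jP alph (beta (wfOf f t)) (SemidirectProduct.inl (of (shE p x))) := by
  rw [← map_inv, ← map_mul, ← map_mul]
  congr 1
  exact (SemidirectProduct.inl_aut p (of x)).symm

theorem gam0_ker (hf : Function.Injective f) (hf1 : ∀ i : ℕ, 1 ≤ i → 1 ≤ f i) : Subgroup.normalClosure (relatorSet f t) ≤ (gam0 f t).ker := by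
  apply Subgroup.normalClosure_le_normal
  rintro r ⟨i, hi, rfl⟩
  obtain ⟨j, hj⟩ : ∃ j, f i = j + 1 := ⟨f i - 1, by have := hf1 i hi; omega⟩
  have hw := wfOf_some f t hf hi hj
  show gam0 f t _ = 1
  rw [mk_relator f t i j hj]
  simp only [map_mul, map_inv, gam0_K, gam0_L, iP_zw]
  rw [mul_inv_eq_one, mul_inv_eq_iff_eq_mul, ← mul_inv_eq_iff_eq_mul, mul_inv_eq_iff_eq_mul]
  symm
  rw [← mul_inv_eq_iff_eq_mul, jP_conj]
  congr 3
  simp only [canE, can, hw, shE, Equiv.prodCongr_apply, Prod.map, Equiv.coe_mulLeft, one_mul, mul_inv_cancel]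
  rfl

noncomputable def gam : GroupG f t →* P0 f t :=
  QuotientGroup.lift _ (gam0 f t) (gam0_ker f t hf hf1)

theorem gam_K (k) : gam f t hf hf1 (evK f t k) = iP alph (beta (wfOf f t)) k := gam0_K f t k
theorem gam_L (k) : gam f t hf hf1 (evL f t k) =
  jP alph (beta (wfOf f t)) (SemidirectProduct.inr k) := gam0_L f t k

def canQ (wf : ℕ → Option Lg) (q : Qg) : Qg := ⟨FreeGroup.map (can wf) q.left, q.right⟩

theorem gam_Q (q) : gam f t hf hf1 (evQ f t q) = jP alph (beta (wfOf f t)) (canQ (wfOf f t) q) := by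
  have h1 : (gam f t hf hf1).comp (evN f t) = (jP alph (beta (wfOf f t))).comp
      (SemidirectProduct.inl.comp (FreeGroup.map (can (wfOf f t)))) := by
    ext x
    simp only [MonoidHom.comp_apply, evN, FreeGroup.lift_apply_of, map_mul, map_inv, gam_L, evZ, gam_K, iP_zw,
      jP_conj, FreeGroup.map.of]
    congr 3
    simp [canE, ← can_smul]
  have h2 := DFunLike.congr_fun h1 q.left
  simp only [MonoidHom.comp_apply] at h2
  rw [← SemidirectProduct.inl_left_mul_inr_right q, map_mul, map_mul, evQ, SemidirectProduct.lift_inl,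
    SemidirectProduct.lift_inr, h2, gam_L, ← map_mul]
  congr 1
  ext <;> simp [canQ]

theorem evQ_canQ (q) : evQ f t (canQ (wfOf f t) q) = evQ f t q := by
  have h1 : (evN f t).comp (FreeGroup.map (can (wfOf f t))) = evN f t := by
    ext x; simp [evN_can]
  have h2 := DFunLike.congr_fun h1 q.left
  simp only [MonoidHom.comp_apply] at h2
  conv_rhs => rw [← SemidirectProduct.inl_left_mul_inr_right q]
  rw [← SemidirectProduct.inl_left_mul_inr_right (canQ _ _)]
  simp only [map_mul, evQ, SemidirectProduct.lift_inl, SemidirectProduct.lift_inr, canQ]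
  rw [h2]

end G
end ICP

namespace ICP
open FreeGroup hiding map_mul map_one map_inv IsReduced norm

theorem cyc_iff {X : Type*} (w : Word X) : FreeGroup.IsCyclicallyReduced w ↔ FreeGroup.IsReduced (w ++ w) := by
  unfold FreeGroup.IsCyclicallyReduced FreeGroup.IsReduced
  rw [List.isChain_append]
  tauto

theorem exists_cyc {X : Type*} [DecidableEq X] (x : FreeGroup X) :
    ∃ w : Word X, FreeGroup.IsReduced (w ++ w) ∧ IsConj x (mk w) := by
  refine ⟨reduceCyclically x.toWord, (cyc_iff _).1 (reduceCyclically.isCyclicallyReduced isReduced_toWord), ?_⟩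
  have h := congrArg mk (reduceCyclically.conj_conjugator_reduceCyclically x.toWord)
  rw [mk_toWord, ← mul_mk, ← mul_mk, ← inv_mk] at h
  apply IsConj.symm
  rw [isConj_iff]
  exact ⟨_, h⟩

theorem IsConj.map' {A B : Type*} [Group A] [Group B] (φ : A →* B) {x y : A} (h : IsConj x y) :
    IsConj (φ x) (φ y) := by
  rw [isConj_iff] at *
  obtain ⟨c, rfl⟩ := h
  exact ⟨φ c, by simp⟩

theorem conj_comm' {A : Type*} [Group A] (x y : A) : IsConj (x * y) (y * x) :=
  isConj_iff.2 ⟨y, by group⟩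

section
variable (f t : ℕ → ℕ)

theorem canQ_mul (wf) (x y : Qg) : canQ wf (x * y) = canQ wf x * canQ wf y := by
  ext
  · simp only [canQ, SemidirectProduct.mul_left, map_mul]
    congr 1
    obtain ⟨u, hu⟩ : ∃ u, y.left = mk u := ⟨_, mk_toWord.symm⟩
    rw [hu, act_mk, map.mk, map.mk, act_mk, List.map_map, List.map_map]
    congr 1
    apply List.map_congr_left
    intro z _
    exact canL_sh wf x.right z
  · rfl

theorem canQ_canQ (wf) (x : Qg) : canQ wf (canQ wf x) = canQ wf x := by
  ext
  · simp only [canQ, FreeGroup.map.comp]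
    congr 2
    ext1 z
    exact can_can wf z
  · rfl

theorem canQ_left_norm (wf) (x : Qg) : (canQ wf x).left.norm ≤ x.left.norm := by
  conv_lhs => rw [canQ, ← mk_toWord (x := x.left), map.mk]
  exact norm_mk_le.trans (by simp [FreeGroup.norm])

/-- the good Q-elements -/
def GoodQ (wf : ℕ → Option Lg) (q : Qg) : Prop :=
  (∀ y ∈ q.left.toWord, canL wf y = y) ∧
  (q.left = 1 ∧ FreeGroup.IsReduced (q.right.toWord ++ q.right.toWord) ∨
    (q.left.toWord.head?.map fun y => y.1.2) = some 1 ∧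
      FreeGroup.IsReduced (q.left.toWord ++ q.left.toWord.map (sh q.right)))

theorem can_letters (wf) (q : Qg) (h : canQ wf q = q) : ∀ y ∈ q.left.toWord, canL wf y = y := by
  have h1 : FreeGroup.map (can wf) q.left = q.left := congrArg SemidirectProduct.left h
  conv_lhs at h1 => rw [← mk_toWord (x := q.left), map.mk]
  have h2 := congrArg toWord h1
  rw [toWord_mk] at h2
  have h3 : List.Sublist (reduce (q.left.toWord.map (canL wf))) (q.left.toWord.map (canL wf)) :=
    (reduce.red).sublist
  change reduce (q.left.toWord.map (canL wf)) = _ at h2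
  rw [h2] at h3
  have h4 := h3.eq_of_length (by simp)
  intro y hy
  have : ∀ l : List (Gen × Bool), l = l.map (canL wf) → ∀ y ∈ l, canL wf y = y := by
    intro l
    induction l with
    | nil => simp
    | cons a l ih =>
      intro h
      simp only [List.map_cons, List.cons.injEq] at h
      intro y hy
      rcases List.mem_cons.1 hy with rfl | hy
      · exact h.1.symm
      · exact ih h.2 y hy
  exact this _ h4 y hy

theorem conj_inr (q : Qg) (p : Lg) : IsConj q ⟨act p q.left, p * q.right * p⁻¹⟩ := by
  refine isConj_iff.2 ⟨SemidirectProduct.inr p, ?_⟩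
  ext <;> simp

theorem conj_inl (q : Qg) (x : NQ) : IsConj q ⟨x⁻¹ * q.left * act q.right x, q.right⟩ := by
  refine isConj_iff.2 ⟨SemidirectProduct.inl x⁻¹, ?_⟩
  ext <;> simp

theorem coverQ (g : GroupG f t) (q0 : Qg) (h : IsConj g (evQ f t q0)) :
    ∃ q, GoodQ (wfOf f t) q ∧ IsConj g (evQ f t q) := by
  have hne : ∃ n, ∃ q, IsConj g (evQ f t q) ∧ q.left.norm = n := ⟨_, q0, h, rfl⟩
  classical
  obtain ⟨q1, hq1, hn1⟩ := Nat.find_spec hne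
  have hmin : ∀ q, IsConj g (evQ f t q) → Nat.find hne ≤ q.left.norm := fun q hq =>
    Nat.find_min' hne ⟨q, hq, rfl⟩
  generalize Nat.find hne = n at *
  -- canonical
  obtain ⟨q, hc, hq, hn⟩ : ∃ q, canQ (wfOf f t) q = q ∧ IsConj g (evQ f t q) ∧ q.left.norm = n := by
    refine ⟨canQ (wfOf f t) q1, canQ_canQ _ _, by rwa [evQ_canQ], le_antisymm ?_ ?_⟩
    · rw [← hn1]; exact canQ_left_norm _ _
    · exact hmin _ (by rwa [evQ_canQ])
  rcases hw : q.left.toWord with _ | ⟨x, ν⟩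
  · have hl : q.left = 1 := by rwa [toWord_eq_nil_iff] at hw
    obtain ⟨w, hw1, hw2⟩ := exists_cyc q.right
    have hq' : q = SemidirectProduct.inr q.right := by ext <;> simp [hl]
    refine ⟨SemidirectProduct.inr (mk w), ⟨by simp, .inl ⟨by simp, ?_⟩⟩, ?_⟩
    · have : FreeGroup.IsReduced w := red_left hw1
      simp only [SemidirectProduct.right_inr, toWord_mk, isReduced_iff_reduce_eq.1 this]
      exact hw1
    · refine hq.trans ?_
      rw [hq']
      exact IsConj.map' _ (IsConj.map' _ hw2)
  · set p := x.1.2⁻¹ with hp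
    refine ⟨⟨act p q.left, p * q.right * p⁻¹⟩, ⟨?_, .inr ⟨?_, ?_⟩⟩, hq.trans (IsConj.map' _ (conj_inr q p))⟩
    · intro y hy
      rw [toWord_act] at hy
      obtain ⟨z, hz, rfl⟩ := List.mem_map.1 hy
      rw [canL_sh, can_letters _ q hc z hz]
    · simp only [toWord_act, hw]
      simp [sh, hp]
    · simp only [toWord_act, List.map_map]
      have : (sh (p * q.right * p⁻¹) ∘ sh p) = sh p ∘ sh q.right := by
        ext1 y; simp [sh_sh]
      rw [this, ← List.map_map, ← List.map_append]
      apply isReduced_sh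
      have hr : FreeGroup.IsReduced q.left.toWord := isReduced_toWord
      refine List.isChain_append.2 ⟨hr, isReduced_sh _ hr, ?_⟩
      intro y hy z hz h1
      by_contra h2
      rw [hw] at hz
      simp at hz
      subst hz
      rcases List.eq_nil_or_concat ν with rfl | ⟨ν2, y', rfl⟩
      · rw [hw] at hy
        simp at hy
        subst hy
        simp [sh] at h2
      · rw [hw] at hy
        have hy' : y' = y := by
          rw [List.concat_eq_append, ← List.cons_append, List.getLast?_append] at hy
          simpa using hy
        subst hy'
        have hyz : y' = ((sh q.right x).1, !(sh q.right x).2) := by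
          ext1
          · exact h1
          · exact Bool.eq_not_of_ne h2
        have key := hmin _ (hq.trans (IsConj.map' _ (conj_inl q (mk [x]))))
        have : (mk [x])⁻¹ * q.left * act q.right (mk [x]) = mk ν2 := by
          rw [← mk_toWord (x := q.left), hw, act_mk]
          have e1 : (mk (x :: ν2.concat y') : NQ) = mk [x] * mk ν2 * mk [y'] := by
            simp [mul_mk]
          have e2 : (mk [y'] : NQ) = (mk [sh q.right x])⁻¹ := by
            rw [inv_mk, hyz]; rfl
          rw [e1, e2]
          simp only [List.map_cons, List.map_nil]
          group
        simp only [this] at key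
        have k2 := norm_mk_le (L₁ := ν2)
        have k3 : q.left.norm = ν2.length + 2 := by simp [FreeGroup.norm, hw]
        omega

/-- evaluation of lists -/
def evl (l : List (FreeGroup Kl × Qg)) : GroupG f t := (l.map fun x => evK f t x.1 * evQ f t x.2).prod

theorem evl_append (l m) : evl f t (l ++ m) = evl f t l * evl f t m := by simp [evl]
theorem evl_cons (x l) : evl f t (x :: l) = evK f t x.1 * evQ f t x.2 * evl f t l := by simp [evl]

theorem evl_snoc (l) (hl : l ≠ []) (q : Qg) : ∃ l', l'.map Prod.fst = l.map Prod.fst ∧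
    evl f t l' = evl f t l * evQ f t q := by
  obtain ⟨l0, x, rfl⟩ := List.eq_nil_or_concat l |>.resolve_left hl
  refine ⟨l0 ++ [(x.1, x.2 * q)], by simp, ?_⟩
  simp [evl, mul_assoc]

theorem exists_evl (g : GroupG f t) : ∃ l, g = evl f t l := by
  obtain ⟨w, rfl⟩ := QuotientGroup.mk_surjective g
  induction w using FreeGroup.induction_on with
  | C1 => exact ⟨[], rfl⟩
  | of n =>
    have := emb_dec n
    rcases h : dec46 n with k | l
    · refine ⟨[(of k, 1)], ?_⟩
      rw [h] at this
      simp [evl, evK, toG, ← this]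
    · refine ⟨[(1, SemidirectProduct.inr (of l))], ?_⟩
      rw [h] at this
      simp [evl, evQ, evL, toG, ← this]
  | inv_of n _ =>
    have := emb_dec n
    rcases h : dec46 n with k | l
    · refine ⟨[((of k)⁻¹, 1)], ?_⟩
      rw [h] at this
      simp only [evl, evK, toG, ← this]; simp [-inv_mk]
    · refine ⟨[(1, (SemidirectProduct.inr (of l))⁻¹)], ?_⟩
      rw [h] at this
      simp only [evl, evQ, evL, toG, ← this]; simp
  | mul x y hx hy =>
    obtain ⟨l, hl⟩ := hx
    obtain ⟨m, hm⟩ := hy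
    exact ⟨l ++ m, by rw [evl_append, ← hl, ← hm]; rfl⟩

def GoodI (wf : ℕ → Option Lg) (x : FreeGroup Kl × Qg) : Prop :=
  x.1 ≠ 1 ∧ DK x.1 ∧ canQ wf x.2 = x.2 ∧ x.2 ∉ (beta wf).range

theorem evK_zw (z s) : evK f t (mk (zw z s)) = evQ f t (beta (wfOf f t) (mk [(z, s)])) := by
  rw [ev_beta, alph_cons, ← one_eq_mk, map_one, mul_one]

def nsum (l : List (FreeGroup Kl × Qg)) : ℕ := ((l.map Prod.fst).map FreeGroup.norm).sum

theorem cover (g : GroupG f t) :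
    (∃ k : Word Kl, FreeGroup.IsReduced (k ++ k) ∧ IsConj g (evK f t (mk k))) ∨
    (∃ q, GoodQ (wfOf f t) q ∧ IsConj g (evQ f t q)) ∨
    (∃ l : List (FreeGroup Kl × Qg), l ≠ [] ∧ (∀ x ∈ l, GoodI (wfOf f t) x) ∧ IsConj g (evl f t l)) := by
  by_cases hK : ∃ k, IsConj g (evK f t k)
  · obtain ⟨k, hk⟩ := hK
    obtain ⟨w, h1, h2⟩ := exists_cyc k
    exact .inl ⟨w, h1, hk.trans (IsConj.map' _ h2)⟩
  by_cases hQ : ∃ q, IsConj g (evQ f t q)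
  · obtain ⟨q, hq⟩ := hQ
    exact .inr (.inl (coverQ f t g q hq))
  right; right
  push Not at hK hQ
  classical
  have ex1 : ∃ n, ∃ l, IsConj g (evl f t l) ∧ l.length = n := by
    obtain ⟨l, hl⟩ := exists_evl f t g
    exact ⟨_, l, hl ▸ IsConj.refl _, rfl⟩
  have hmin1 : ∀ l, IsConj g (evl f t l) → Nat.find ex1 ≤ l.length := fun q hq =>
    Nat.find_min' ex1 ⟨q, hq, rfl⟩
  have ex1' := Nat.find_spec ex1
  generalize Nat.find ex1 = n at *
  have ex2 : ∃ m, ∃ l, IsConj g (evl f t l) ∧ l.length = n ∧ nsum l = m := by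
    obtain ⟨l, h1, h2⟩ := ex1'
    exact ⟨_, l, h1, h2, rfl⟩
  have hmin2 : ∀ l, IsConj g (evl f t l) → l.length = n → Nat.find ex2 ≤ nsum l := fun q hq hl =>
    Nat.find_min' ex2 ⟨q, hq, hl, rfl⟩
  obtain ⟨l, hl, hn, hm⟩ := Nat.find_spec ex2
  generalize Nat.find ex2 = m at *
  have hgood : ∀ x ∈ l, x.1 ≠ 1 ∧ DK x.1 ∧ canQ (wfOf f t) x.2 ∉ (beta (wfOf f t)).range := by
    intro x hx
    obtain ⟨l1, l2, rfl⟩ := List.append_of_mem hx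
    obtain ⟨k, q⟩ := x
    set r := l2 ++ l1 with hr
    have c1 : IsConj g (evl f t ((k, q) :: r)) := by
      refine hl.trans ?_
      rw [evl_append, hr, ← List.cons_append, evl_append]
      exact conj_comm' _ _
    have hn' : r.length + 1 = n := by simp [hr] at hn ⊢; omega
    have hm' : k.norm + ((r.map Prod.fst).map FreeGroup.norm).sum = m := by
      rw [← hm]; simp [nsum, hr]; ring
    clear_value r
    clear hr hm hn hl hx
    rw [evl_cons] at c1
    dsimp only at c1 ⊢
    have hk1 : k ≠ 1 := by
      rintro rfl
      rw [map_one, one_mul] at c1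
      by_cases hr0 : r = []
      · subst hr0
        simp only [evl, List.map_nil, List.prod_nil, mul_one] at c1
        exact hQ _ c1
      · obtain ⟨l', h1, h2⟩ := evl_snoc f t r hr0 q
        have := hmin1 l' (by rw [h2]; exact c1.trans (conj_comm' _ _))
        have h3 := congrArg List.length h1
        simp at h3
        omega
    refine ⟨hk1, ?_, ?_⟩
    · intro z s
      constructor
      · by_contra hlt
        push Not at hlt
        obtain ⟨l', h1, h2⟩ := evl_snoc f t ((mk (zw z s) * k, q) :: r) (by simp) (beta (wfOf f t) (mk [(z, s)]))⁻¹
        have c2 : IsConj g (evl f t l') := by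
          rw [h2, evl_cons, map_inv, ← evK_zw]
          refine c1.trans (isConj_iff.2 ⟨evK f t (mk (zw z s)), ?_⟩)
          simp [mul_assoc]
        have h3 := congrArg List.length h1
        simp at h3
        have := hmin2 l' c2 (by omega)
        rw [nsum, h1] at this
        simp only [List.map_cons, List.sum_cons] at this
        omega
      · by_contra hlt
        push Not at hlt
        have c2 : IsConj g (evl f t ((k * mk (zw z s), (beta (wfOf f t) (mk [(z, s)]))⁻¹ * q) :: r)) := by
          rw [evl_cons]
          dsimp only
          rw [map_mul, map_mul, map_inv, ← evK_zw]
          simpa [mul_assoc] using c1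
        have := hmin2 _ c2 (by simpa using hn')
        rw [nsum] at this
        simp only [List.map_cons, List.sum_cons] at this
        omega
    · rintro ⟨e, he⟩
      have hq : evQ f t q = evK f t (alph e) := by rw [← evQ_canQ, ← he, ev_beta]
      rw [hq] at c1
      rcases r with _ | ⟨⟨k2, q2⟩, r⟩
      · rw [← map_mul] at c1
        simp only [evl, List.map_nil, List.prod_nil, mul_one] at c1
        exact hK _ c1
      · have := hmin1 ((k * alph e * k2, q2) :: r) (by
          rw [evl_cons] at c1 ⊢
          simpa [mul_assoc] using c1)
        simp at this hn'
        omega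
  refine ⟨l.map fun x => (x.1, canQ (wfOf f t) x.2), ?_, ?_, ?_⟩
  · intro h0
    have : l = [] := by simpa using h0
    subst this
    exact hK 1 (by simpa [evl] using hl)
  · intro x hx
    obtain ⟨y, hy, rfl⟩ := List.mem_map.1 hx
    obtain ⟨h1, h2, h3⟩ := hgood y hy
    exact ⟨h1, h2, canQ_canQ _ _, h3⟩
  · convert hl using 1
    simp [evl, Function.comp_def, evQ_canQ]

end
end ICP

namespace ICP
open FreeGroup hiding map_mul map_one map_inv IsReduced norm

/-! concrete data -/
abbrev Pw := Word (Fin 6)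
abbrev CL := (Zt × Pw) × Bool
abbrev QD := List CL × Pw
abbrev Item := Word Kl × QD

def gl (x : CL) : Gen × Bool := ((x.1.1, mk x.1.2), x.2)
def qv (D : QD) : Qg := ⟨mk (D.1.map gl), mk D.2⟩
def iv (x : Item) : FreeGroup Kl × Qg := (mk x.1, qv x.2)

def canW (wf : ℕ → Option Lg) (D : QD) : List (Gen × Bool) := (D.1.map gl).map (canL wf)

def RW (D : QD) : Prop := (∀ y ∈ D.1, FreeGroup.IsReduced y.1.2) ∧ FreeGroup.IsReduced D.2

def CQ (wf : ℕ → Option Lg) (D : QD) : Prop := RW D ∧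
  (D.1 = [] ∧ FreeGroup.IsReduced (D.2 ++ D.2) ∨
   (D.1.head?.map fun y => y.1.2) = some [] ∧
    FreeGroup.IsReduced (canW wf D ++ (canW wf D).map (sh (mk D.2))))

def CI (wf : ℕ → Option Lg) (x : Item) : Prop :=
  FreeGroup.IsReduced x.1 ∧ x.1 ≠ [] ∧ DK (mk x.1) ∧ RW x.2 ∧ FreeGroup.IsReduced (canW wf x.2) ∧
  (⟨mk (canW wf x.2), mk x.2.2⟩ : Qg) ∉ (beta wf).range

theorem canQ_qv (wf D) : canQ wf (qv D) = ⟨mk (canW wf D), mk D.2⟩ := rfl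

/-! boundedness -/
def Bd (n : ℕ) (D : QD) : Prop := D.1.length ≤ n ∧ D.2.length ≤ n ∧
  ∀ y ∈ D.1, y.1.1.1 ≤ n ∧ y.1.2.length ≤ n

theorem finite_lists {X : Type*} {s : Set X} (hs : s.Finite) (n : ℕ) :
    {l : List X | l.length ≤ n ∧ ∀ x ∈ l, x ∈ s}.Finite := by
  have := hs.to_subtype
  refine ((List.finite_length_le s n).image (List.map Subtype.val)).subset ?_
  rintro l ⟨h1, h2⟩
  refine ⟨l.attach.map fun x => ⟨x.1, h2 x.1 x.2⟩, by simpa using h1, ?_⟩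
  simp

theorem finite_Bd (n : ℕ) : {D | Bd n D}.Finite := by
  have h1 := List.finite_length_le (Fin 6 × Bool) n
  have h2 : {y : CL | y.1.1.1 ≤ n ∧ y.1.2.length ≤ n}.Finite := by
    refine ((((Set.finite_Iic n).prod (Set.finite_univ (α := Bool))).prod h1).prod
      (Set.finite_univ (α := Bool))).subset ?_
    rintro y ⟨a, b⟩
    exact ⟨⟨⟨a, trivial⟩, b⟩, trivial⟩
  refine ((finite_lists h2 n).prod h1).subset ?_
  rintro D ⟨a, b, c⟩
  exact ⟨⟨a, c⟩, b⟩

theorem norm_of_red {X : Type*} [DecidableEq X] {w : Word X} (h : FreeGroup.IsReduced w) :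
    (mk w).norm = w.length := by
  rw [FreeGroup.norm, toWord_mk, isReduced_iff_reduce_eq.1 h]

/-- position sequence -/
def posD (wf : ℕ → Option Lg) (D : QD) : Pos := (D.1.map gl).map fun x => (x.1.2, canL wf x)

theorem posD_snd (wf D) : (posD wf D).map Prod.snd = canW wf D := by
  simp [posD, canW, Function.comp_def]
theorem posD_fst (wf D) : (posD wf D).map Prod.fst = D.1.map fun y => mk y.1.2 := by
  simp [posD, Function.comp_def, gl]
theorem posD_adm (wf D) : AdmL wf (posD wf D) := by
  intro y hy
  obtain ⟨x, hx, rfl⟩ := List.mem_map.1 hy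
  exact adm_can x.1

def sumBw (wf : ℕ → Option Lg) (D : QD) : ℕ := ((posD wf D).map fun y => Bw wf y.2.1.1.1).sum

theorem sumBw_eq (wf D) : sumBw wf D = (D.1.map fun y => Bw wf y.1.1.1).sum := by
  simp [sumBw, posD, Function.comp_def, canL, can_fst, gl]

def zD (D : QD) : ℕ := (D.1.map fun y => y.1.1.1 + 1).sum

theorem zwt_canW (wf D) : zwt (canW wf D) = zD D := by
  rw [canW, zwt_canL]; simp [zwt, zD, Function.comp_def, gl]

theorem bd_of (wf : ℕ → Option Lg) (c1 c2 : ℕ) : ∃ n, ∀ D, RW D → zD D ≤ c1 →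
    plen 1 ((posD wf D).map Prod.fst) (mk D.2) ≤ c2 + 2 * sumBw wf D → Bd n D := by
  set B := ∑ j ∈ Finset.range (c1 + 1), Bw wf j with hB
  refine ⟨c1 + c2 + 2 * (c1 * B), ?_⟩
  rintro ⟨ν, e⟩ ⟨hr1, hr2⟩ hz hp
  dsimp only at *
  have hlen : ν.length ≤ zD (ν, e) := by
    have := List.sum_le_sum (l := ν) (f := fun _ => 1) (g := fun y => y.1.1.1 + 1) (by simp)
    simpa [zD] using this
  have hj : ∀ y ∈ ν, y.1.1.1 + 1 ≤ zD (ν, e) := by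
    intro y hy
    exact List.single_le_sum (by simp) _ (List.mem_map.2 ⟨y, hy, rfl⟩)
  have hS : sumBw wf (ν, e) ≤ c1 * B := by
    rw [sumBw_eq]
    have := List.sum_le_card_nsmul (ν.map fun y => Bw wf y.1.1.1) B (by
      intro x hx
      obtain ⟨y, hy, rfl⟩ := List.mem_map.1 hx
      have := hj y hy
      exact Finset.single_le_sum (f := Bw wf) (fun _ _ => Nat.zero_le _) (Finset.mem_range.2 (by omega)))
    simp only [List.length_map, smul_eq_mul] at this
    refine this.trans (Nat.mul_le_mul_right _ (by omega))
  have hP : plen 1 ((posD wf (ν, e)).map Prod.fst) (mk e) ≤ c2 + 2 * (c1 * B) := by omega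
  rw [posD_fst] at hP
  refine ⟨by dsimp only; omega, ?_, ?_⟩
  · have := plen_end (ν.map fun y => mk y.1.2) 1 (mk e)
    rw [inv_one, one_mul, norm_of_red hr2] at this
    dsimp only at *
    omega
  · intro y hy
    have h1 := hj y hy
    have := plen_mem (l := ν.map fun y => mk y.1.2) (p := mk y.1.2) (List.mem_map.2 ⟨y, hy, rfl⟩) 1 (mk e)
    rw [inv_one, one_mul, norm_of_red (hr1 y hy)] at this
    dsimp only at *
    exact ⟨by omega, by omega⟩

/-! powers -/
theorem norm_pow_cyc {X : Type*} [DecidableEq X] {w : Word X} (h : FreeGroup.IsReduced (w ++ w)) (N : ℕ) :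
    (mk w ^ N).norm = N * w.length := by
  rw [pow_mk, norm_of_red (((cyc_iff w).2 h).flatten_replicate N).1]
  simp

def upow (a : Lg) (d : Pos) : ℕ → Pos
  | 0 => []
  | N + 1 => d ++ shP a (upow a d N)

theorem shP_snd (a D) : (shP a D).map Prod.snd = (D.map Prod.snd).map (sh a) := by
  simp [shP, Function.comp_def]
theorem shP_fst (a D) : (shP a D).map Prod.fst = (D.map Prod.fst).map (a * ·) := by
  simp [shP, Function.comp_def]

theorem upow_adm {wf a d} (h : AdmL wf d) (N) : AdmL wf (upow a d N) := by
  induction N with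
  | zero => intro y hy; simp [upow] at hy
  | succ N ih =>
    intro y hy
    rcases List.mem_append.1 hy with hy | hy
    · exact h y hy
    · exact ih.sh a y hy

theorem upow_val (a : Lg) (d : Pos) (N) :
    (⟨mk (d.map Prod.snd), a⟩ : Qg) ^ N = ⟨mk ((upow a d N).map Prod.snd), a ^ N⟩ := by
  induction N with
  | zero => simp [upow, ← one_eq_mk]
  | succ N ih =>
    rw [pow_succ', ih]
    ext
    · simp only [SemidirectProduct.mul_left, upow, List.map_append, shP_snd, act_mk, ← mul_mk]
    · simp only [SemidirectProduct.mul_right, pow_succ']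

theorem upow_red {a : Lg} {d : Pos} (hd : d ≠ [])
    (h : FreeGroup.IsReduced (d.map Prod.snd ++ (d.map Prod.snd).map (sh a))) (N) :
    FreeGroup.IsReduced ((upow a d (N+1)).map Prod.snd) ∧
      ((upow a d (N+1)).map Prod.snd).head? = (d.map Prod.snd).head? := by
  obtain ⟨h1, h2, h3⟩ := List.isChain_append.1 h
  induction N with
  | zero => simp only [upow, shP, List.map_nil, List.append_nil]; exact ⟨h1, trivial⟩
  | succ N ih =>
    rw [upow, List.map_append, shP_snd]
    refine ⟨List.isChain_append.2 ⟨h1, isReduced_sh a ih.1, ?_⟩, ?_⟩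
    · rw [List.head?_map, ih.2, ← List.head?_map]; exact h3
    · rw [List.head?_append_of_ne_nil]; simpa using hd

theorem upow_plen {a : Lg} {d : Pos} (hd : (d.map Prod.fst).head? = some 1) (N) :
    plen 1 ((upow a d N).map Prod.fst) (a ^ N) = N * plen 1 (d.map Prod.fst) a := by
  induction N with
  | zero => simp [upow, plen]
  | succ N ih =>
    rw [upow, List.map_append, shP_fst]
    cases N with
    | zero => simp [upow]
    | succ N =>
      have hh : ((upow a d (N+1)).map Prod.fst).head? = some 1 := by
        rw [upow, List.map_append, List.head?_append_of_ne_nil, hd]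
        intro h0; simp [h0] at hd
      obtain ⟨m, hm⟩ : ∃ m, (upow a d (N+1)).map Prod.fst = 1 :: m := by
        cases hl : (upow a d (N+1)).map Prod.fst with
        | nil => simp [hl] at hh
        | cons x m => rw [hl] at hh; simp at hh; exact ⟨m, by rw [hh]⟩
      rw [hm] at ih ⊢
      have k := plen_smul a 1 (1 :: m) (a ^ (N+1))
      rw [ih, mul_one, ← pow_succ'] at k
      simp only [List.map_cons, mul_one] at k ⊢
      rw [plen_append]
      simp only [plen, inv_mul_cancel, FreeGroup.norm_one, zero_add] at k
      rw [k]; ring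

theorem upow_zwt (a : Lg) (d : Pos) (N) :
    zwt ((upow a d N).map Prod.snd) = N * zwt (d.map Prod.snd) := by
  induction N with
  | zero => simp [upow, zwt]
  | succ N ih => rw [upow, List.map_append, shP_snd, zwt_append, zwt_sh, ih]; ring

theorem upow_sumBw (wf) (a : Lg) (d : Pos) (N) :
    ((upow a d N).map fun y => Bw wf y.2.1.1.1).sum = N * (d.map fun y => Bw wf y.2.1.1.1).sum := by
  induction N with
  | zero => simp [upow]
  | succ N ih =>
    have : ((shP a (upow a d N)).map fun y => Bw wf y.2.1.1.1) = (upow a d N).map fun y => Bw wf y.2.1.1.1 := by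
      simp [shP, sh, Function.comp_def]
    rw [upow, List.map_append, List.sum_append, this, ih]; ring

section
variable (f t : ℕ → ℕ) (hf : Function.Injective f) (hf1 : ∀ i : ℕ, 1 ≤ i → 1 ≤ f i)

def flat (l : List (FreeGroup Kl × Qg)) : List (FreeGroup Kl ⊕ Qg) := l.flatMap fun x => [.inl x.1, .inr x.2]

theorem gam_evl (l) : gam f t hf hf1 (evl f t l) = lprod (iP alph (beta (wfOf f t))) (jP alph (beta (wfOf f t)))
    (flat (l.map fun x => (x.1, canQ (wfOf f t) x.2))) := by
  induction l with
  | nil => simp [evl, flat, lprod]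
  | cons x l ih =>
    rw [evl_cons, map_mul, map_mul, gam_K, gam_Q, ih]
    simp [flat, lprod, mul_assoc]

theorem conj_data (w : GroupG f t) : ∃ lw, ∀ g, IsConj g w → ∃ lx ly,
    lprod (iP alph (beta (wfOf f t))) (jP alph (beta (wfOf f t))) lx *
    lprod (iP alph (beta (wfOf f t))) (jP alph (beta (wfOf f t))) ly = 1 ∧
    gam f t hf hf1 g = lprod (iP alph (beta (wfOf f t))) (jP alph (beta (wfOf f t))) lx *
      lprod (iP alph (beta (wfOf f t))) (jP alph (beta (wfOf f t))) lw *
      lprod (iP alph (beta (wfOf f t))) (jP alph (beta (wfOf f t))) ly := by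
  obtain ⟨l, hl⟩ := exists_evl f t w
  refine ⟨flat (l.map fun x => (x.1, canQ (wfOf f t) x.2)), fun g hg => ?_⟩
  · obtain ⟨c, hc⟩ := isConj_iff.1 hg.symm
    obtain ⟨m, hm⟩ := exists_evl f t c
    refine ⟨flat (m.map fun x => (x.1, canQ (wfOf f t) x.2)),
      revinv (flat (m.map fun x => (x.1, canQ (wfOf f t) x.2))), by simp, ?_⟩
    rw [lprod_revinv, ← gam_evl f t hf hf1, ← gam_evl f t hf hf1, ← hc, ← hl, ← hm]
    simp

theorem finK (w : GroupG f t) (hf : Function.Injective f) (hf1 : ∀ i : ℕ, 1 ≤ i → 1 ≤ f i) :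
    {k : Word Kl | FreeGroup.IsReduced (k ++ k) ∧ IsConj (evK f t (mk k)) w}.Finite := by
  obtain ⟨lw, hlw⟩ := conj_data f t hf hf1 w
  refine (List.finite_length_le _ (lcost cK1 cQ1 lw)).subset ?_
  rintro k ⟨h1, h2⟩
  obtain ⟨lx, ly, hxy, hp⟩ := hlw _ h2
  rw [gam_K] at hp
  have := (amalgG f t).stable_single (cost1 (wfOf_ne f t)) (fun N => .inl (mk k ^ N)) _ (fun N => by
    simp only [Sum.elim_inl, map_pow]) (9 * k.length) (fun N => by
      simp only [Sum.elim_inl, cK1, norm_pow_cyc h1]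
      refine le_trans (le_of_eq ?_) (le_max_right _ _)
      ring) lx ly lw hxy hp
  simp only [Set.mem_ofPred_eq]
  omega

theorem finQ (w : GroupG f t) (hf : Function.Injective f) (hf1 : ∀ i : ℕ, 1 ≤ i → 1 ≤ f i) :
    {D : QD | CQ (wfOf f t) D ∧ IsConj (evQ f t (qv D)) w}.Finite := by
  obtain ⟨lw, hlw⟩ := conj_data f t hf hf1 w
  obtain ⟨n, hn⟩ := bd_of (wfOf f t) (lcost cK1 cQ1 lw) (lcost (fun _ => 0) (cQ2 (wfOf f t)) lw)
  refine (finite_Bd n).subset ?_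
  rintro D ⟨⟨hD, hD'⟩, h2⟩
  obtain ⟨lx, ly, hxy, hp⟩ := hlw _ h2
  rw [gam_Q, canQ_qv, ← posD_snd] at hp
  have hx : ∀ N, Sum.elim (iP alph (beta (wfOf f t))) (jP alph (beta (wfOf f t)))
      (.inr ⟨mk ((upow (mk D.2) (posD (wfOf f t) D) N).map Prod.snd), mk D.2 ^ N⟩) =
      (jP alph (beta (wfOf f t)) ⟨mk ((posD (wfOf f t) D).map Prod.snd), mk D.2⟩) ^ N := by
    intro N
    rw [← map_pow, upow_val]; rfl
  have hred : ∀ N, FreeGroup.IsReduced ((upow (mk D.2) (posD (wfOf f t) D) N).map Prod.snd) := by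
    intro N
    rcases hD' with ⟨h0, h0'⟩ | ⟨h0, h0'⟩
    · have : posD (wfOf f t) D = [] := by simp [posD, h0]
      rw [this]
      have : upow (mk D.2) [] N = [] := by
        induction N with
        | zero => rfl
        | succ N ih => simp [upow, ih, shP]
      rw [this]; simp
    · cases N with
      | zero => simp [upow]
      | succ N =>
        refine (upow_red ?_ ?_ N).1
        · intro h
          have : D.1 = [] := by simpa [posD] using h
          simp [this] at h0
        · rw [posD_snd]; exact h0'
  have hpl : ∀ N, plen 1 ((upow (mk D.2) (posD (wfOf f t) D) N).map Prod.fst) (mk D.2 ^ N) =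
      N * plen 1 ((posD (wfOf f t) D).map Prod.fst) (mk D.2) := by
    intro N
    rcases hD' with ⟨h0, h0'⟩ | ⟨h0, h0'⟩
    · have : posD (wfOf f t) D = [] := by simp [posD, h0]
      rw [this]
      have : upow (mk D.2) [] N = [] := by
        induction N with
        | zero => rfl
        | succ N ih => simp [upow, ih, shP]
      rw [this]
      simp only [List.map_nil, plen, inv_one, one_mul]
      rw [norm_pow_cyc h0', norm_of_red hD.2]
    · apply upow_plen
      rw [posD_fst, List.head?_map]
      cases hh : D.1.head? with
      | none => simp [hh] at h0
      | some y => simp [hh] at h0; simp [h0, ← one_eq_mk]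
  have b1 := (amalgG f t).stable_single (cost1 (wfOf_ne f t)) _ _ hx
    (180 * zwt ((posD (wfOf f t) D).map Prod.snd)) (fun N => by
      simp only [Sum.elim_inr, cQ1, toWord_mk, isReduced_iff_reduce_eq.1 (hred N), upow_zwt]
      apply le_of_eq; ring) lx ly lw hxy hp
  have b2 := (amalgG f t).stable_single cost2 _ _ hx
    (plen 1 ((posD (wfOf f t) D).map Prod.fst) (mk D.2) - 2 * sumBw (wfOf f t) D) (fun N => by
      have := cQ2_ge (wf := wfOf f t) ⟨mk ((upow (mk D.2) (posD (wfOf f t) D) N).map Prod.snd), mk D.2 ^ N⟩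
        _ (upow_adm (posD_adm _ D) N) (hred N) rfl
      rw [upow_sumBw] at this
      simp only [Sum.elim_inr]
      dsimp only at this
      rw [hpl] at this
      rw [Nat.mul_sub]
      have e : 2 * (N * ((posD (wfOf f t) D).map fun y => Bw (wfOf f t) y.2.1.1.1).sum) =
        N * (2 * sumBw (wfOf f t) D) := by unfold sumBw; ring
      omega) lx ly lw hxy hp
  rw [posD_snd, zwt_canW] at b1
  exact hn D hD (by omega) (by omega)

theorem redL_flat (wf) (hW : ∀ j W, wf j = some W → W ≠ 1) (l : List (FreeGroup Kl × Qg))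
    (h : ∀ x ∈ l, x.1 ≠ 1 ∧ DK x.1 ∧ x.2 ∉ (beta wf).range) : RedL alph (beta wf) (flat l) := by
  constructor
  · intro y hy
    obtain ⟨x, hx, hy⟩ := List.mem_flatMap.1 hy
    obtain ⟨h1, h2, h3⟩ := h x hx
    simp only [List.mem_cons, List.not_mem_nil, or_false] at hy
    rcases hy with rfl | rfl
    · rintro ⟨e, he⟩
      have := LB h1 h2 e 1
      rw [← he] at this
      simp [-FreeGroup.norm_eq_zero] at this
      apply h1
      rw [← FreeGroup.norm_eq_zero, ← he]; omega
    · exact h3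
  · have : ∀ l : List (FreeGroup Kl × Qg), (flat l).IsChain (fun x y => x.isLeft ≠ y.isLeft) ∧
        ∀ y ∈ (flat l).head?, y.isLeft = true := by
      intro l
      induction l with
      | nil => simp [flat]
      | cons x l ih =>
        have e : flat (x :: l) = .inl x.1 :: .inr x.2 :: flat l := rfl
        rw [e]
        refine ⟨?_, by simp⟩
        rw [List.isChain_cons_cons]
        refine ⟨by simp, List.isChain_cons.2 ⟨?_, ih.1⟩⟩
        intro y hy
        simp [ih.2 y hy]
    exact (this l).1

theorem flat_flatten (N l) : (List.replicate N (flat l)).flatten = flat (List.replicate N l).flatten := by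
  induction N with
  | zero => rfl
  | succ N ih => simp [List.replicate_succ, ih]; simp [flat]

theorem omg_inv (e : FreeGroup Zt) : omg e⁻¹.toWord = omg e.toWord := by
  rw [toWord_inv]
  simp [omg, invRev, Function.comp_def]

theorem cQ1_beta (wf) (hW : ∀ j W, wf j = some W → W ≠ 1) (e) : cQ1 (beta wf e) = 180 * omg e.toWord := by
  rw [← (cost1 hW).eq, cK1_alph]

theorem finH (w : GroupG f t) (hf : Function.Injective f) (hf1 : ∀ i : ℕ, 1 ≤ i → 1 ≤ f i) :
    {l : List Item | l ≠ [] ∧ (∀ x ∈ l, CI (wfOf f t) x) ∧ IsConj (evl f t (l.map iv)) w}.Finite := by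
  obtain ⟨lw, hlw⟩ := conj_data f t hf hf1 w
  set c := lcost cK1 cQ1 lw with hc
  obtain ⟨n, hn⟩ := bd_of (wfOf f t) (10 * c) (lcost (fun _ => 0) (cQ2 (wfOf f t)) lw)
  refine (finite_lists ((List.finite_length_le (Kl × Bool) (10 * c)).prod (finite_Bd n)) (10 * c)).subset ?_
  rintro l ⟨h0, h1, h2⟩
  obtain ⟨lx, ly, hxy, hp⟩ := hlw _ h2
  rw [gam_evl, List.map_map] at hp
  set L := l.map ((fun x => (x.1, canQ (wfOf f t) x.2)) ∘ iv) with hL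
  have hLm : ∀ x ∈ L, ∃ y ∈ l, x = (mk y.1, canQ (wfOf f t) (qv y.2)) := by
    intro x hx
    obtain ⟨y, hy, rfl⟩ := List.mem_map.1 hx
    exact ⟨y, hy, rfl⟩
  have hg : ∀ x ∈ L, x.1 ≠ 1 ∧ DK x.1 ∧ x.2 ∉ (beta (wfOf f t)).range := by
    intro x hx
    obtain ⟨y, hy, rfl⟩ := hLm x hx
    obtain ⟨g1, g2, g3, g4, g5, g6⟩ := h1 y hy
    refine ⟨?_, g3, g6⟩
    intro hh
    have := norm_of_red g1
    dsimp only at hh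
    rw [hh, FreeGroup.norm_one] at this
    exact g2 (List.length_eq_zero_iff.1 this.symm)
  have hred : ∀ N, RedL alph (beta (wfOf f t)) (List.replicate N (flat L)).flatten := by
    intro N
    rw [flat_flatten]
    apply redL_flat _ (wfOf_ne f t)
    intro x hx
    obtain ⟨m, hm, hx⟩ := List.mem_flatten.1 hx
    rw [(List.mem_replicate.1 hm).2] at hx
    exact hg x hx
  have hne : flat L ≠ [] := by
    intro h
    apply h0
    cases hl : l with
    | nil => rfl
    | cons x l' => rw [hL, hl] at h; simp [flat] at h
  have mK : ∀ k, .inl k ∈ flat L → k ≠ 1 ∧ DK k := by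
    intro k hk
    obtain ⟨x, hx, hk⟩ := List.mem_flatMap.1 hk
    simp at hk; subst hk
    exact ⟨(hg x hx).1, (hg x hx).2.1⟩
  have b1 := (amalgG f t).stable_list (cost1 (wfOf_ne f t)) (Sum.elim (fun k => 18 * k.norm) cQ1) 10 (flat L)
    hred hne (by
      intro k hk e e'
      have := LB (mK k hk).1 (mK k hk).2 e e'
      rw [cK1_alph, cK1_alph]
      have h3 : 9 * ((alph e)⁻¹ * k * alph e').norm ≤ cK1 ((alph e)⁻¹ * k * alph e') := le_max_right _ _
      simp only [Sum.elim_inl]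
      omega) (by
      intro q hq e e'
      simp only [Sum.elim_inr]
      set x := (beta (wfOf f t) e)⁻¹ * q * beta (wfOf f t) e' with hx
      have e1 : q = beta (wfOf f t) e * x * beta (wfOf f t) e'⁻¹ := by rw [hx, map_inv]; group
      have m1 := (cost1 (wfOf_ne f t)).mulQ (beta (wfOf f t) e * x) (beta (wfOf f t) e'⁻¹)
      have m2 := (cost1 (wfOf_ne f t)).mulQ (beta (wfOf f t) e) x
      rw [← e1] at m1
      rw [cQ1_beta _ (wfOf_ne f t), omg_inv] at m1
      rw [cQ1_beta _ (wfOf_ne f t)] at m2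
      rw [cK1_alph, cK1_alph]
      omega) lx ly lw hxy hp
  have b2 := (amalgG f t).stable_list (cost2 (wf := wfOf f t)) (Sum.elim (fun _ => 0) (cQ2 (wfOf f t))) 1 (flat L)
    hred hne (by intro k hk e e'; simp) (by
      intro q hq e e'
      simp only [Sum.elim_inr, one_mul, add_zero]
      set x := (beta (wfOf f t) e)⁻¹ * q * beta (wfOf f t) e' with hx
      have e1 : q = beta (wfOf f t) e * x * beta (wfOf f t) e'⁻¹ := by rw [hx, map_inv]; group
      have m1 := (cost2 (wf := wfOf f t)).mulQ (beta (wfOf f t) e * x) (beta (wfOf f t) e'⁻¹)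
      have m2 := (cost2 (wf := wfOf f t)).mulQ (beta (wfOf f t) e) x
      rw [← e1] at m1
      rw [cQ2_beta] at m1 m2
      omega) lx ly lw hxy hp
  have hflat : ∀ h : FreeGroup Kl ⊕ Qg → ℕ, ((flat L).map h).sum =
      (l.map fun y => h (.inl (mk y.1)) + h (.inr (canQ (wfOf f t) (qv y.2)))).sum := by
    intro h
    rw [hL]
    clear hL
    clear_value L
    clear h0 h1 h2 hp hLm hg hred hne mK b1 b2
    induction l with
    | nil => rfl
    | cons y l ih =>
      have e : flat (List.map ((fun x => (x.1, canQ (wfOf f t) x.2)) ∘ iv) (y :: l)) = .inl (mk y.1) ::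
        .inr (canQ (wfOf f t) (qv y.2)) :: flat (List.map ((fun x => (x.1, canQ (wfOf f t) x.2)) ∘ iv) l) := rfl
      rw [e, List.map_cons, List.map_cons, List.sum_cons, List.sum_cons, ih, List.map_cons, List.sum_cons]
      ring
  rw [hflat] at b1 b2
  simp only [Sum.elim_inl, Sum.elim_inr, one_mul, zero_add] at b1 b2
  have hb1 : ∀ y ∈ l, 18 * y.1.length + 180 * zD y.2 ≤ 10 * c := by
    intro y hy
    refine le_trans ?_ b1
    refine le_trans ?_ (List.single_le_sum (by simp) _ (List.mem_map.2 ⟨y, hy, rfl⟩))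
    obtain ⟨g1, g2, g3, g4, g5, g6⟩ := h1 y hy
    rw [norm_of_red g1, canQ_qv, cQ1]
    simp only [toWord_mk, isReduced_iff_reduce_eq.1 g5, zwt_canW]
    exact le_rfl
  refine ⟨?_, ?_⟩
  · have h5 := List.sum_le_sum (l := l) (f := fun _ => 1)
      (g := fun y => 18 * (mk y.1).norm + cQ1 (canQ (wfOf f t) (qv y.2))) (by
        intro y hy
        obtain ⟨g1, g2, g3, g4, g5, g6⟩ := h1 y hy
        rw [norm_of_red g1]
        have := List.length_pos_iff.2 g2
        omega)
    simp only [List.map_const', List.sum_replicate, smul_eq_mul, mul_one] at h5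
    omega
  · intro y hy
    have hy1 := hb1 y hy
    obtain ⟨g1, g2, g3, g4, g5, g6⟩ := h1 y hy
    refine ⟨?_, hn y.2 g4 (by omega) ?_⟩
    · simp only [Set.mem_ofPred_eq]; omega
    · have k1 := cQ2_ge (wf := wfOf f t) (canQ (wfOf f t) (qv y.2)) (posD (wfOf f t) y.2) (posD_adm _ _)
        (by rw [posD_snd]; exact g5) (by rw [posD_snd]; rfl)
      have k2 : cQ2 (wfOf f t) (canQ (wfOf f t) (qv y.2)) ≤ lcost (fun _ => 0) (cQ2 (wfOf f t)) lw :=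
        le_trans (List.single_le_sum (by simp) _ (List.mem_map.2 ⟨y, hy, rfl⟩)) b2
      have e : (canQ (wfOf f t) (qv y.2)).right = mk y.2.2 := rfl
      rw [e] at k1
      unfold sumBw
      omega

end
end ICP

namespace ICP
open FreeGroup hiding map_mul map_one map_inv IsReduced norm

section
variable (f t : ℕ → ℕ)

def unq (q : Qg) : QD := (q.left.toWord.map fun y => ((y.1.1, y.1.2.toWord), y.2), q.right.toWord)

theorem gl_unq (q : Qg) : (unq q).1.map gl = q.left.toWord := by
  simp [unq, gl, Function.comp_def, mk_toWord]

theorem qv_unq (q : Qg) : qv (unq q) = q := by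
  ext
  · show mk ((unq q).1.map gl) = _
    rw [gl_unq, mk_toWord]
  · exact mk_toWord

theorem RW_unq (q) : RW (unq q) := by
  refine ⟨?_, isReduced_toWord⟩
  intro y hy
  obtain ⟨x, hx, rfl⟩ := List.mem_map.1 hy
  exact isReduced_toWord

theorem canW_unq (wf) (q) (h : ∀ y ∈ q.left.toWord, canL wf y = y) : canW wf (unq q) = q.left.toWord := by
  rw [canW, gl_unq]
  conv_rhs => rw [← List.map_id q.left.toWord]
  exact List.map_congr_left h

theorem cover' (g : GroupG f t) :
    (∃ k : Word Kl, FreeGroup.IsReduced (k ++ k) ∧ IsConj g (evK f t (mk k))) ∨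
    (∃ D, CQ (wfOf f t) D ∧ IsConj g (evQ f t (qv D))) ∨
    (∃ l : List Item, l ≠ [] ∧ (∀ x ∈ l, CI (wfOf f t) x) ∧ IsConj g (evl f t (l.map iv))) := by
  rcases cover f t g with h | ⟨q, ⟨h1, h2⟩, h3⟩ | ⟨l, h1, h2, h3⟩
  · exact .inl h
  · refine .inr (.inl ⟨unq q, ⟨RW_unq q, ?_⟩, by rwa [qv_unq]⟩)
    rcases h2 with ⟨h4, h5⟩ | ⟨h4, h5⟩
    · left
      exact ⟨by simp [unq, h4], h5⟩
    · right
      rw [canW_unq _ q h1]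
      refine ⟨?_, ?_⟩
      · cases hh : q.left.toWord with
        | nil => simp [hh] at h4
        | cons x l =>
          simp [hh] at h4
          simp [unq, hh, h4]
      · show FreeGroup.IsReduced (_ ++ List.map (sh (mk q.right.toWord)) _)
        rwa [mk_toWord]
  · refine .inr (.inr ⟨l.map fun x => (x.1.toWord, unq x.2), by simpa using h1, ?_, ?_⟩)
    · intro y hy
      obtain ⟨x, hx, rfl⟩ := List.mem_map.1 hy
      obtain ⟨g1, g2, g3, g4⟩ := h2 x hx
      have hw := canW_unq _ _ (can_letters _ _ g3)
      refine ⟨isReduced_toWord, by simpa using g1, by simpa [mk_toWord] using g2, RW_unq _, ?_, ?_⟩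
      · rw [hw]; exact isReduced_toWord
      · dsimp only
        rw [hw]
        have : (⟨mk x.2.left.toWord, mk (unq x.2).2⟩ : Qg) = x.2 := by
          ext
          · exact mk_toWord
          · exact mk_toWord
        rwa [this]
    · rw [List.map_map]
      have : (iv ∘ fun x : FreeGroup Kl × Qg => (x.1.toWord, unq x.2)) = id := by
        ext1 x; simp [iv, qv_unq, mk_toWord]
      rwa [this, List.map_id]

/-- table of conjugators -/
def tab : ℕ → List (ℕ × Pw)
  | 0 => []
  | N + 1 => tab N ++ [(f (N+1), W6 (N+1) (t (N+1)))]

theorem tab_elim {N k W} (h : (tab f t N).lookup k = some W) :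
    ∃ i, 1 ≤ i ∧ i ≤ N ∧ f i = k ∧ W = W6 i (t i) := by
  induction N with
  | zero => simp [tab] at h
  | succ N ih =>
    rw [tab, List.lookup_append, Option.or_eq_some_iff] at h
    rcases h with h | ⟨_, h⟩
    · obtain ⟨i, h1, h2, h3⟩ := ih h
      exact ⟨i, h1, by omega, h3⟩
    · by_cases hk : k = f (N+1)
      · subst hk
        rw [List.lookup_cons_self, Option.some.injEq] at h
        exact ⟨N+1, by omega, le_rfl, rfl, h.symm⟩
      · rw [List.lookup_cons, beq_false_of_ne hk] at h
        simp at h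

theorem tab_intro (hf : Function.Injective f) {N i} (h1 : 1 ≤ i) (h2 : i ≤ N) :
    (tab f t N).lookup (f i) = some (W6 i (t i)) := by
  induction N with
  | zero => omega
  | succ N ih =>
    rw [tab, List.lookup_append]
    rcases Nat.lt_or_ge N i with h | h
    · have : i = N + 1 := by omega
      subst this
      cases hl : (tab f t N).lookup (f (N+1)) with
      | none => simp
      | some W =>
        obtain ⟨i, _, h5, h6, _⟩ := tab_elim f t hl
        have := hf h6
        omega
    · rw [ih h]; rfl

def wfT (T : List (ℕ × Pw)) (j : ℕ) : Option Lg := (T.lookup (j + 1)).map mk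

theorem wfT_some {N j W} (hf : Function.Injective f) : wfT (tab f t N) j = some W ↔ wfOf f t j = some W ∧
    ∃ i, 1 ≤ i ∧ i ≤ N ∧ f i = j + 1 := by
  constructor
  · intro h
    obtain ⟨w, h1, rfl⟩ := Option.map_eq_some_iff.1 h
    obtain ⟨i, h2, h3, h4, rfl⟩ := tab_elim f t h1
    exact ⟨wfOf_some f t hf h2 h4, i, h2, h3, h4⟩
  · rintro ⟨h, i, h1, h2, h3⟩
    rw [wfOf_some f t hf h1 h3] at h
    rw [wfT, ← h3, tab_intro f t hf h1 h2]
    exact h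

def canT (T : List (ℕ × Pw)) (x : CL) : CL :=
  if x.1.1.2 = true then x else
    match T.lookup (x.1.1.1 + 1) with
    | none => x
    | some W => (((x.1.1.1, true), reduce (x.1.2 ++ invRev W)), x.2)

theorem mk_reduce {X : Type*} [DecidableEq X] (w : Word X) : mk (reduce w) = mk w := by
  rw [← toWord_mk, mk_toWord]

theorem gl_canT (T x) : gl (canT T x) = canL (wfT T) (gl x) := by
  obtain ⟨⟨⟨j, s⟩, p⟩, e⟩ := x
  cases s
  · cases h : T.lookup (j + 1) with
    | none => simp [canT, gl, canL, can, wfT, h]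
    | some W => simp [canT, gl, canL, can, wfT, h, mk_reduce, mul_mk]
  · rfl

theorem red_canT (T) (x : CL) (h : FreeGroup.IsReduced x.1.2) : FreeGroup.IsReduced (canT T x).1.2 := by
  unfold canT
  split
  · exact h
  · split
    · exact h
    · exact isReduced_iff_reduce_eq.2 (reduce.idem)

theorem gl_inj {x y : CL} (hx : FreeGroup.IsReduced x.1.2) (hy : FreeGroup.IsReduced y.1.2) :
    gl x = gl y ↔ x = y := by
  refine ⟨fun h => ?_, fun h => h ▸ rfl⟩
  obtain ⟨⟨z, p⟩, s⟩ := x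
  obtain ⟨⟨z', p'⟩, s'⟩ := y
  simp only [gl, Prod.mk.injEq] at h ⊢
  refine ⟨⟨h.1.1, ?_⟩, h.2⟩
  have := congrArg toWord h.1.2
  rwa [toWord_mk, toWord_mk, isReduced_iff_reduce_eq.1 hx, isReduced_iff_reduce_eq.1 hy] at this

theorem can_TF (wf) (j j' p p') : can wf ((j, true), p) = can wf ((j', false), p') ↔
    j = j' ∧ ∃ W, wf j = some W ∧ p = p' * W⁻¹ := by
  cases h : wf j' with
  | none =>
    simp [can, h]
    rintro rfl; simp [h]
  | some W =>
    simp [can, h]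
    rintro rfl; simp [h]

theorem can_FF (wf) (j j' p p') : can wf ((j, false), p) = can wf ((j', false), p') ↔ j = j' ∧ p = p' := by
  constructor
  · intro h
    have h0 := congrArg (fun x => x.1.1) h
    simp only [can_fst] at h0
    subst h0
    refine ⟨rfl, ?_⟩
    cases hw : wf j <;> simp [can, hw] at h <;> exact h
  · rintro ⟨rfl, rfl⟩; rfl

theorem can_TF_iff (hf : Function.Injective f) {N} (j j') (p p' : Lg) (h : p.norm + p'.norm ≤ N) :
    can (wfT (tab f t N)) ((j, true), p) = can (wfT (tab f t N)) ((j', false), p') ↔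
    can (wfOf f t) ((j, true), p) = can (wfOf f t) ((j', false), p') := by
  rw [can_TF, can_TF]
  refine and_congr_right fun hj => exists_congr fun W => ?_
  rw [wfT_some f t hf]
  constructor
  · rintro ⟨⟨h1, _⟩, h2⟩; exact ⟨h1, h2⟩
  · rintro ⟨h1, h2⟩
    refine ⟨⟨h1, ?_⟩, h2⟩
    obtain ⟨i, h3, h4, rfl⟩ := wfOf_elim f t h1
    refine ⟨i, h3, ?_, h4⟩
    have : mk (W6 i (t i)) = p⁻¹ * p' := by rw [h2]; group
    have h5 := norm_W6 i (t i)
    rw [this] at h5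
    have := norm_mul_le p⁻¹ p'
    rw [norm_inv_eq] at this
    omega

theorem can_iff (hf : Function.Injective f) {N} (x y : Gen) (h : x.2.norm + y.2.norm ≤ N) :
    can (wfT (tab f t N)) x = can (wfT (tab f t N)) y ↔ can (wfOf f t) x = can (wfOf f t) y := by
  obtain ⟨⟨j, s⟩, p⟩ := x
  obtain ⟨⟨j', s'⟩, p'⟩ := y
  cases s <;> cases s'
  · rw [can_FF, can_FF]
  · rw [eq_comm, can_TF_iff f t hf _ _ _ _ (by simpa [add_comm] using h), eq_comm]
  · exact can_TF_iff f t hf _ _ _ _ h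
  · rfl

theorem canT_iff (hf : Function.Injective f) {N} (x y : CL) (hx : FreeGroup.IsReduced x.1.2)
    (hy : FreeGroup.IsReduced y.1.2) (h : x.1.2.length + y.1.2.length ≤ N) :
    (canT (tab f t N) x).1 = (canT (tab f t N) y).1 ↔
    (canL (wfOf f t) (gl x)).1 = (canL (wfOf f t) (gl y)).1 := by
  have := can_iff f t hf (N := N) (gl x).1 (gl y).1 (by simpa [gl, norm_of_red hx, norm_of_red hy] using h)
  simp only [canL]
  rw [← this]
  have e : ∀ x : CL, FreeGroup.IsReduced x.1.2 → ∀ T, (canT T x).1 = (canT T (x.1, true)).1 := by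
    intro x _ T
    unfold canT
    split
    · rfl
    · dsimp only; split <;> rfl
  rw [e x hx, e y hy]
  have k := gl_inj (red_canT (tab f t N) (x.1, true) hx) (red_canT (tab f t N) (y.1, true) hy)
  rw [gl_canT, gl_canT] at k
  have e2 : ∀ x : CL, (canT (tab f t N) (x.1, true)).2 = true := by
    intro x
    unfold canT
    split
    · rfl
    · split <;> rfl
  constructor
  · intro h
    exact congrArg Prod.fst (k.2 (Prod.ext h (by rw [e2, e2])))
  · intro h
    exact congrArg Prod.fst (k.1 (Prod.ext h rfl))

/-- total length of the positions -/
def msz (ν : List CL) : ℕ := (ν.map fun y => y.1.2.length).sum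

theorem msz_mem {ν : List CL} {x} (h : x ∈ ν) : x.1.2.length ≤ msz ν :=
  List.single_le_sum (by simp) _ (List.mem_map.2 ⟨x, h, rfl⟩)

theorem canT_snd (T x) : (canT T x).2 = x.2 := by
  unfold canT
  split
  · rfl
  · split <;> rfl

theorem isReduced_congr {X Y Z : Type*} (g : X → Y × Bool) (h : X → Z × Bool) (ν : List X)
    (h1 : ∀ x ∈ ν, ∀ y ∈ ν, ((g x).1 = (g y).1 ↔ (h x).1 = (h y).1))
    (h2 : ∀ x ∈ ν, (g x).2 = (h x).2) :
    FreeGroup.IsReduced (ν.map g) ↔ FreeGroup.IsReduced (ν.map h) := by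
  unfold FreeGroup.IsReduced
  rw [List.isChain_map, List.isChain_map]
  induction ν with
  | nil => simp
  | cons a l ih =>
    have ih' := ih (fun x hx y hy => h1 x (List.mem_cons_of_mem _ hx) y (List.mem_cons_of_mem _ hy))
      (fun x hx => h2 x (List.mem_cons_of_mem _ hx))
    cases l with
    | nil => simp
    | cons b l =>
      rw [List.isChain_cons_cons, List.isChain_cons_cons, ih', h1 a (by simp) b (by simp),
        h2 a (by simp), h2 b (by simp)]

theorem redT_iff (hf : Function.Injective f) (ν : List CL) {N} (hN : 2 * msz ν ≤ N) (hν : ∀ y ∈ ν, FreeGroup.IsReduced y.1.2) :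
    reduce (ν.map (canT (tab f t N))) = ν.map (canT (tab f t N)) ↔
    FreeGroup.IsReduced ((ν.map gl).map (canL (wfOf f t))) := by
  rw [← isReduced_iff_reduce_eq, List.map_map]
  apply isReduced_congr
  · intro x hx y hy
    refine canT_iff f t hf x y (hν x hx) (hν y hy) ?_
    have := msz_mem hx
    have := msz_mem hy
    omega
  · intro x _
    rw [canT_snd]; rfl

def shW (e : Pw) (x : CL) : CL := ((x.1.1, reduce (e ++ x.1.2)), x.2)
theorem gl_shW (e x) : gl (shW e x) = sh (mk e) (gl x) := by
  simp [gl, shW, sh, mk_reduce, mul_mk]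

def dbl (D : QD) : List CL := D.1 ++ D.1.map (shW D.2)

theorem dbl_canW (wf) (D : QD) : ((dbl D).map gl).map (canL wf) = canW wf D ++ (canW wf D).map (sh (mk D.2)) := by
  simp only [dbl, canW, List.map_append, List.map_map]
  congr 1
  apply List.map_congr_left
  intro x _
  simp [gl_shW, canL_sh]

/-- decidable version of `RW` -/
def tRW (D : QD) : Prop := (∀ y ∈ D.1, reduce y.1.2 = y.1.2) ∧ reduce D.2 = D.2
theorem tRW_iff (D) : tRW D ↔ RW D := by
  simp [tRW, RW, isReduced_iff_reduce_eq]

def tCQ (T : List (ℕ × Pw)) (D : QD) : Prop := tRW D ∧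
  (D.1 = [] ∧ reduce (D.2 ++ D.2) = D.2 ++ D.2 ∨
   (D.1.head?.map fun y => y.1.2) = some [] ∧
   reduce ((dbl D).map (canT T)) = (dbl D).map (canT T))

theorem tCQ_iff (hf : Function.Injective f) (D : QD) {N} (hN : 2 * msz (dbl D) ≤ N) :
    tCQ (tab f t N) D ↔ CQ (wfOf f t) D := by
  unfold tCQ CQ
  rw [tRW_iff]
  refine and_congr_right fun hD => ?_
  rw [redT_iff f t hf _ hN, dbl_canW, ← isReduced_iff_reduce_eq]
  intro y hy
  rcases List.mem_append.1 hy with h | h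
  · exact hD.1 y h
  · obtain ⟨x, _, rfl⟩ := List.mem_map.1 h
    exact isReduced_iff_reduce_eq.2 (reduce.idem)

/-- check for membership in the edge group -/
def tE (T : List (ℕ × Pw)) (D : QD) : Prop := D.2 = [] ∧
  ∀ y ∈ D.1, (canT T y).1 = (canT T (((y.1.1.1, true), []), true)).1 ∨
    (canT T y).1 = (canT T (((y.1.1.1, false), []), true)).1

theorem tE_iff (hf : Function.Injective f) (D : QD) {N} (hN : 2 * msz D.1 ≤ N) (hD : RW D)
    (hr : FreeGroup.IsReduced (canW (wfOf f t) D)) :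
    tE (tab f t N) D ↔ (⟨mk (canW (wfOf f t) D), mk D.2⟩ : Qg) ∈ (beta (wfOf f t)).range := by
  have key : ∀ y ∈ D.1, (((canT (tab f t N) y).1 =
      (canT (tab f t N) (((y.1.1.1, true), []), true)).1 ∨
      (canT (tab f t N) y).1 = (canT (tab f t N) (((y.1.1.1, false), []), true)).1) ↔
      ∃ z, (canL (wfOf f t) (gl y)).1 = canE (wfOf f t) z) := by
    intro y hy
    have := msz_mem hy
    rw [canT_iff f t hf _ _ (hD.1 y hy) (by simp) (by simp; omega),
      canT_iff f t hf _ _ (hD.1 y hy) (by simp) (by simp; omega)]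
    have e : ∀ s, (canL (wfOf f t) (gl (((y.1.1.1, s), []), true))).1 = canE (wfOf f t) (y.1.1.1, s) := by
      intro s
      simp [canL, gl, canE, ← one_eq_mk]
    rw [e, e]
    constructor
    · rintro (h | h)
      · exact ⟨_, h⟩
      · exact ⟨_, h⟩
    · rintro ⟨⟨j, s⟩, h⟩
      have h0 := congrArg (fun x => x.1.1) h
      simp only [canL, canE, can_fst] at h0
      have : y.1.1.1 = j := h0
      subst this
      cases s
      · exact .inr h
      · exact .inl h
  constructor
  · rintro ⟨h1, h2⟩
    have h3 : ∀ y ∈ D.1, ∃ z, (canL (wfOf f t) (gl y)).1 = canE (wfOf f t) z := fun y hy => (key y hy).1 (h2 y hy)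
    have h4 : ∀ ν : List CL, (∀ y ∈ ν, ∃ z, (canL (wfOf f t) (gl y)).1 = canE (wfOf f t) z) →
        ∃ e : List (Zt × Bool), (ν.map gl).map (canL (wfOf f t)) = e.map fun y => (canE (wfOf f t) y.1, y.2) := by
      intro ν
      induction ν with
      | nil => intro _; exact ⟨[], rfl⟩
      | cons y ν ih =>
        intro h
        obtain ⟨e, he⟩ := ih fun x hx => h x (List.mem_cons_of_mem _ hx)
        obtain ⟨z, hz⟩ := h y List.mem_cons_self
        refine ⟨(z, y.2) :: e, ?_⟩
        simp only [List.map_cons, he, ← hz]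
        rfl
    obtain ⟨e, he⟩ := h4 D.1 h3
    refine ⟨mk e, ?_⟩
    ext
    · show mk _ = mk _
      rw [canW, he]
    · show 1 = mk D.2
      rw [h1]; rfl
  · rintro ⟨e, he⟩
    have hl := congrArg (fun q => q.left.toWord) he
    have hrr := congrArg (fun q => q.right) he
    simp only [toWord_beta (wfOf_ne f t), toWord_mk, isReduced_iff_reduce_eq.1 hr] at hl
    refine ⟨?_, ?_⟩
    · have := congrArg FreeGroup.norm hrr
      simp only [beta_right, norm_of_red hD.2, FreeGroup.norm_one] at this
      exact List.length_eq_zero_iff.1 this.symm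
    · intro y hy
      rw [key y hy]
      have : canL (wfOf f t) (gl y) ∈ canW (wfOf f t) D :=
        List.mem_map.2 ⟨_, List.mem_map.2 ⟨y, hy, rfl⟩, rfl⟩
      rw [← hl] at this
      obtain ⟨z, _, hz⟩ := List.mem_map.1 this
      exact ⟨z.1, by rw [← hz]⟩

def tDK (k : Word Kl) : Prop := ∀ j ∈ List.range k.length, ∀ b ∈ [(true, true), (true, false), (false, true), (false, false)],
  k.length ≤ (reduce (zw (j, b.1) b.2 ++ k)).length ∧ k.length ≤ (reduce (k ++ zw (j, b.1) b.2)).length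

theorem tDK_iff (k : Word Kl) (hk : FreeGroup.IsReduced k) : tDK k ↔ DK (mk k) := by
  have e1 : ∀ z s, (mk (zw z s) * mk k).norm = (reduce (zw z s ++ k)).length := by
    intro z s; rw [mul_mk, FreeGroup.norm, toWord_mk]
  have e2 : ∀ z s, (mk k * mk (zw z s)).norm = (reduce (k ++ zw z s)).length := by
    intro z s; rw [mul_mk, FreeGroup.norm, toWord_mk]
  constructor
  · intro h z s
    by_cases hz : z.1 < k.length
    · have := h z.1 (List.mem_range.2 hz) (z.2, s) (by cases z.2 <;> cases s <;> simp)
      rw [norm_of_red hk, e1, e2]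
      exact this
    · have n1 := norm_mul_le (mk (zw z s) * mk k) (mk k)⁻¹
      have n2 := norm_mul_le (mk k)⁻¹ (mk k * mk (zw z s))
      rw [mul_inv_cancel_right] at n1
      rw [inv_mul_cancel_left] at n2
      rw [norm_inv_eq, norm_zw] at n1 n2
      have := norm_of_red hk
      constructor <;> omega
  · intro h j _ b _
    have := h (j, b.1) b.2
    rw [norm_of_red hk, e1, e2] at this
    exact this

def tCI (T : List (ℕ × Pw)) (x : Item) : Prop :=
  reduce x.1 = x.1 ∧ x.1 ≠ [] ∧ tDK x.1 ∧ tRW x.2 ∧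
  reduce (x.2.1.map (canT T)) = x.2.1.map (canT T) ∧ ¬ tE T x.2

theorem tCI_iff (hf : Function.Injective f) (x : Item) {N} (hN : 2 * msz x.2.1 ≤ N) :
    tCI (tab f t N) x ↔ CI (wfOf f t) x := by
  unfold tCI CI
  rw [← isReduced_iff_reduce_eq, tRW_iff]
  refine and_congr_right fun h1 => and_congr_right fun h2 => and_congr (tDK_iff _ h1) (and_congr_right fun h4 => ?_)
  rw [redT_iff f t hf _ hN h4.1]
  refine and_congr_right fun h5 => not_congr (tE_iff f t hf _ hN h4 h5)

end
end ICP

namespace ICP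
open FreeGroup hiding map_mul map_one map_inv IsReduced norm

section
variable {A B X Y : Type*} [Primcodable A] [Primcodable B] [Primcodable X] [Primcodable Y]

theorem pr_reduce [DecidableEq X] {g : A → Word X} (hg : Primrec g) : Primrec fun a => reduce (g a) := by
  refine Primrec.of_eq (Primrec.list_foldr (f := g) (g := fun _ => ([] : Word X))
    (h := fun _ (p : (X × Bool) × Word X) => List.casesOn p.2 [p.1] fun hd tl =>
        if p.1.1 = hd.1 ∧ p.1.2 = not hd.2 then tl else p.1 :: hd :: tl)
    hg (Primrec.const _) ?_) ?_
  · have p1 : Primrec fun x : A × ((X × Bool) × Word X) => x.2.1 := Primrec.fst.comp Primrec.snd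
    have p2 : Primrec fun x : A × ((X × Bool) × Word X) => x.2.2 := Primrec.snd.comp Primrec.snd
    refine Primrec.list_casesOn (h := fun (x : A × ((X × Bool) × Word X)) (y : (X × Bool) × Word X) =>
        if x.2.1.1 = y.1.1 ∧ x.2.1.2 = not y.1.2 then y.2 else x.2.1 :: y.1 :: y.2) p2
      (Primrec.list_cons.comp p1 (Primrec.const _)) ?_
    have q1 : Primrec fun x : (A × ((X × Bool) × Word X)) × ((X × Bool) × Word X) => x.1.2.1 :=
      p1.comp Primrec.fst
    have q2 : Primrec fun x : (A × ((X × Bool) × Word X)) × ((X × Bool) × Word X) => x.2.1 :=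
      Primrec.fst.comp Primrec.snd
    have q3 : Primrec fun x : (A × ((X × Bool) × Word X)) × ((X × Bool) × Word X) => x.2.2 :=
      Primrec.snd.comp Primrec.snd
    exact Primrec.ite (PrimrecPred.and
      (Primrec.eq.comp (Primrec.fst.comp q1) (Primrec.fst.comp q2))
      (Primrec.eq.comp (Primrec.snd.comp q1) (Primrec.not.comp (Primrec.snd.comp q2)))) q3
      (Primrec.list_cons.comp q1 (Primrec.list_cons.comp q2 q3))
  · intro a
    induction g a with
    | nil => rfl
    | cons x l ih => rw [List.foldr_cons, ih, reduce.cons]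

theorem pr_map {g : A → List X} {h : A → X → Y} (hg : Primrec g)
    (hh : Primrec fun x : A × X => h x.1 x.2) : Primrec fun a => (g a).map (h a) :=
  Primrec.list_map hg hh

theorem pr_app {g h : A → List X} (hg : Primrec g) (hh : Primrec h) : Primrec fun a => g a ++ h a :=
  Primrec.list_append.comp hg hh

theorem pr_flatMap {g : A → List X} {h : A → X → List Y} (hg : Primrec g)
    (hh : Primrec fun x : A × X => h x.1 x.2) : Primrec fun a => (g a).flatMap (h a) :=
  Primrec.list_flatMap hg hh

theorem pr_invRev {g : A → Word X} (hg : Primrec g) : Primrec fun a => invRev (g a) := by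
  unfold invRev
  exact Primrec.list_reverse.comp (pr_map hg (Primrec.pair (Primrec.fst.comp Primrec.snd)
    (Primrec.not.comp (Primrec.snd.comp Primrec.snd))))

theorem pr_rep {g : A → ℕ} {h : A → X} (hg : Primrec g) (hh : Primrec h) :
    Primrec fun a => List.replicate (g a) (h a) := by
  refine Primrec.of_eq (pr_map (h := fun a (_ : ℕ) => h a) (Primrec.list_range.comp hg) (hh.comp Primrec.fst)) ?_
  intro a
  simp

theorem pr_lmap [Finite X] (e : X → Y) {g : A → Word X} (hg : Primrec g) :
    Primrec fun a => lmap e (g a) := by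
  unfold lmap
  exact pr_map hg (Primrec.pair ((Primrec.dom_finite e).comp (Primrec.fst.comp Primrec.snd))
    (Primrec.snd.comp Primrec.snd))

theorem pr_sum {g : A → List ℕ} (hg : Primrec g) : Primrec fun a => (g a).sum := by
  refine Primrec.of_eq (Primrec.list_foldr (f := g) (g := fun _ => 0) (h := fun _ p => p.1 + p.2)
    hg (Primrec.const _) ?_) ?_
  · exact Primrec.nat_add.comp (Primrec.fst.comp Primrec.snd) (Primrec.snd.comp Primrec.snd)
  · intro a; rfl

theorem pr_all {g : A → List X} {p : A → X → Prop} (hg : Primrec g)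
    (hp : PrimrecPred fun x : A × X => p x.1 x.2) : PrimrecPred fun a => ∀ x ∈ g a, p a x := by
  have : PrimrecRel fun (x : X) (a : A) => p a x :=
    hp.comp (Primrec.pair Primrec.snd Primrec.fst)
  exact (PrimrecRel.forall_mem_list this).comp hg Primrec.id

theorem pr_eq {g h : A → X} (hg : Primrec g) (hh : Primrec h) : PrimrecPred fun a => g a = h a :=
  Primrec.eq.comp hg hh

theorem pr_zw {g : A → Zt} {s : A → Bool} (hg : Primrec g) (hs : Primrec s) :
    Primrec fun a => zw (g a) (s a) := by
  have h20 : Primrec (Fin.ofNat 20) := by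
    have e : Primrec fun n : ℕ => ([0,1,2,3,4,5,6,7,8,9,10,11,12,13,14,15,16,17,18,19] : List (Fin 20)).getD (n % 20) 0 :=
      (Primrec.list_getD (0 : Fin 20)).comp (Primrec.const _) (Primrec.nat_mod.comp Primrec.id (Primrec.const 20))
    refine e.of_eq ?_
    intro n
    have : Fin.ofNat 20 n = Fin.ofNat 20 (n % 20) := by ext; simp
    rw [this]
    have h : n % 20 < 20 := Nat.mod_lt _ (by norm_num)
    generalize n % 20 = m at h
    interval_cases m <;> rfl
  have g1 : Primrec fun a => (g a).1 + 1 := Primrec.succ.comp (Primrec.fst.comp hg)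
  refine pr_map (Primrec.list_range.comp (Primrec.nat_mul.comp (Primrec.const 20) g1)) ?_
  have k : Primrec fun x : A × ℕ => x.2 / ((g x.1).1 + 1) :=
    Primrec.nat_div.comp Primrec.snd (g1.comp Primrec.fst)
  have k2 : Primrec fun x : A × ℕ => (g x.1).2 := (Primrec.snd.comp hg).comp Primrec.fst
  refine Primrec.ite (pr_eq (hs.comp Primrec.fst) (Primrec.const true)) ?_ ?_
  · exact Primrec.pair (Primrec.pair k2 (h20.comp k)) (Primrec.const _)
  · exact Primrec.pair (Primrec.pair k2 (h20.comp (Primrec.nat_sub.comp (Primrec.const 19) k))) (Primrec.const _)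

theorem pr_W6 : Primrec₂ W6 := by
  unfold W6
  exact pr_app (pr_app (pr_app (pr_app (pr_app (pr_rep Primrec.fst (Primrec.const _))
    (pr_rep Primrec.snd (Primrec.const _))) (pr_rep Primrec.fst (Primrec.const _)))
    (pr_rep Primrec.snd (Primrec.const _))) (pr_rep Primrec.fst (Primrec.const _)))
    (pr_rep Primrec.snd (Primrec.const _))

abbrev Tb := List (ℕ × Pw)

theorem pr_canT {T : A → Tb} {x : A → CL} (hT : Primrec T) (hx : Primrec x) :
    Primrec fun a => canT (T a) (x a) := by
  have hj : Primrec fun a => (x a).1.1.1 := Primrec.fst.comp (Primrec.fst.comp (Primrec.fst.comp hx))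
  have hs : Primrec fun a => (x a).1.1.2 := Primrec.snd.comp (Primrec.fst.comp (Primrec.fst.comp hx))
  have hp : Primrec fun a => (x a).1.2 := Primrec.snd.comp (Primrec.fst.comp hx)
  have he : Primrec fun a => (x a).2 := Primrec.snd.comp hx
  have hl : Primrec fun a => (T a).lookup ((x a).1.1.1 + 1) :=
    Primrec.listLookup.comp (Primrec.succ.comp hj) hT
  refine Primrec.ite (pr_eq hs (Primrec.const true)) hx ?_
  have := Primrec.option_casesOn (o := fun a => (T a).lookup ((x a).1.1.1 + 1)) (f := x)
    (g := fun a W => ((((x a).1.1.1, true), reduce ((x a).1.2 ++ invRev W)), (x a).2)) hl hx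
    (Primrec.pair (Primrec.pair (Primrec.pair (hj.comp Primrec.fst) (Primrec.const _))
      (pr_reduce (pr_app (hp.comp Primrec.fst) (pr_invRev Primrec.snd)))) (he.comp Primrec.fst))
  refine this.of_eq ?_
  intro a
  cases (T a).lookup ((x a).1.1.1 + 1) <;> rfl

theorem pr_msz {g : A → List CL} (hg : Primrec g) : Primrec fun a => msz (g a) :=
  pr_sum (pr_map hg (Primrec.list_length.comp (Primrec.snd.comp (Primrec.fst.comp Primrec.snd))))

theorem pr_dbl {D : A → QD} (hD : Primrec D) : Primrec fun a => dbl (D a) := by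
  have h1 : Primrec fun a => (D a).1 := Primrec.fst.comp hD
  have h2 : Primrec fun a => (D a).2 := Primrec.snd.comp hD
  refine pr_app h1 (pr_map h1 ?_)
  have k : Primrec fun x : A × CL => x.2 := Primrec.snd
  exact Primrec.pair (Primrec.pair (Primrec.fst.comp (Primrec.fst.comp k))
    (pr_reduce (pr_app (h2.comp Primrec.fst) (Primrec.snd.comp (Primrec.fst.comp k))))) (Primrec.snd.comp k)

theorem pr_red [DecidableEq X] {g : A → Word X} (hg : Primrec g) : PrimrecPred fun a => reduce (g a) = g a :=
  pr_eq (pr_reduce hg) hg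

theorem pr_tRW {D : A → QD} (hD : Primrec D) : PrimrecPred fun a => tRW (D a) := by
  have h1 : Primrec fun a => (D a).1 := Primrec.fst.comp hD
  have h2 : Primrec fun a => (D a).2 := Primrec.snd.comp hD
  refine PrimrecPred.and (pr_all (p := fun _ y => reduce y.1.2 = y.1.2) h1 ?_) (pr_red h2)
  exact pr_red (Primrec.snd.comp (Primrec.fst.comp Primrec.snd))

theorem pr_redT {T : A → Tb} {ν : A → List CL} (hT : Primrec T) (hν : Primrec ν) :
    PrimrecPred fun a => reduce ((ν a).map (canT (T a))) = (ν a).map (canT (T a)) :=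
  pr_red (pr_map hν (pr_canT (hT.comp Primrec.fst) Primrec.snd))

theorem pr_tCQ {T : A → Tb} {D : A → QD} (hT : Primrec T) (hD : Primrec D) :
    PrimrecPred fun a => tCQ (T a) (D a) := by
  have h1 : Primrec fun a => (D a).1 := Primrec.fst.comp hD
  have h2 : Primrec fun a => (D a).2 := Primrec.snd.comp hD
  refine PrimrecPred.and (pr_tRW hD) (PrimrecPred.or
    (PrimrecPred.and (pr_eq h1 (Primrec.const _)) (pr_red (pr_app h2 h2)))
    (PrimrecPred.and (pr_eq ?_ (Primrec.const _)) (pr_redT hT (pr_dbl hD))))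
  exact Primrec.option_map (Primrec.list_head?.comp h1) (Primrec.snd.comp (Primrec.fst.comp Primrec.snd))

theorem pr_tE {T : A → Tb} {D : A → QD} (hT : Primrec T) (hD : Primrec D) :
    PrimrecPred fun a => tE (T a) (D a) := by
  have h1 : Primrec fun a => (D a).1 := Primrec.fst.comp hD
  have h2 : Primrec fun a => (D a).2 := Primrec.snd.comp hD
  have hT' : Primrec fun x : A × CL => T x.1 := hT.comp Primrec.fst
  have k : Primrec fun x : A × CL => x.2 := Primrec.snd
  have kj : Primrec fun x : A × CL => x.2.1.1.1 := Primrec.fst.comp (Primrec.fst.comp (Primrec.fst.comp k))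
  have c : ∀ s : Bool, Primrec fun x : A × CL => ((((x.2.1.1.1, s), []), true) : CL) := fun s =>
    Primrec.pair (Primrec.pair (Primrec.pair kj (Primrec.const s)) (Primrec.const _)) (Primrec.const _)
  refine PrimrecPred.and (pr_eq h2 (Primrec.const _)) (pr_all
    (p := fun a y => (canT (T a) y).1 = (canT (T a) (((y.1.1.1, true), []), true)).1 ∨
    (canT (T a) y).1 = (canT (T a) (((y.1.1.1, false), []), true)).1) h1 (PrimrecPred.or ?_ ?_))
  · exact pr_eq (Primrec.fst.comp (pr_canT hT' k)) (Primrec.fst.comp (pr_canT hT' (c true)))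
  · exact pr_eq (Primrec.fst.comp (pr_canT hT' k)) (Primrec.fst.comp (pr_canT hT' (c false)))

theorem pr_tDK {k : A → Word Kl} (hk : Primrec k) : PrimrecPred fun a => tDK (k a) := by
  refine pr_all (Primrec.list_range.comp (Primrec.list_length.comp hk))
    (p := fun a j => ∀ b ∈ [(true, true), (true, false), (false, true), (false, false)],
  (k a).length ≤ (reduce (zw (j, b.1) b.2 ++ k a)).length ∧ (k a).length ≤ (reduce (k a ++ zw (j, b.1) b.2)).length) ?_
  refine pr_all (Primrec.const _) (p := fun (x : A × ℕ) (b : Bool × Bool) =>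
    (k x.1).length ≤ (reduce (zw (x.2, b.1) b.2 ++ k x.1)).length ∧
    (k x.1).length ≤ (reduce (k x.1 ++ zw (x.2, b.1) b.2)).length) ?_
  have hk' : Primrec fun x : (A × ℕ) × (Bool × Bool) => k x.1.1 := hk.comp (Primrec.fst.comp Primrec.fst)
  have hz : Primrec fun x : (A × ℕ) × (Bool × Bool) => zw (x.1.2, x.2.1) x.2.2 :=
    pr_zw (Primrec.pair (Primrec.snd.comp Primrec.fst) (Primrec.fst.comp Primrec.snd)) (Primrec.snd.comp Primrec.snd)
  exact PrimrecPred.and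
    (Primrec.nat_le.comp (Primrec.list_length.comp hk') (Primrec.list_length.comp (pr_reduce (pr_app hz hk'))))
    (Primrec.nat_le.comp (Primrec.list_length.comp hk') (Primrec.list_length.comp (pr_reduce (pr_app hk' hz))))

theorem pr_tCI {T : A → Tb} {x : A → Item} (hT : Primrec T) (hx : Primrec x) :
    PrimrecPred fun a => tCI (T a) (x a) := by
  have h1 : Primrec fun a => (x a).1 := Primrec.fst.comp hx
  have h2 : Primrec fun a => (x a).2 := Primrec.snd.comp hx
  exact PrimrecPred.and (pr_red h1) (PrimrecPred.and (PrimrecPred.not (pr_eq h1 (Primrec.const _)))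
    (PrimrecPred.and (pr_tDK h1) (PrimrecPred.and (pr_tRW h2) (PrimrecPred.and
      (pr_redT hT (Primrec.fst.comp h2)) (PrimrecPred.not (pr_tE hT h2))))))

end
end ICP

namespace ICP
open FreeGroup hiding map_mul map_one map_inv IsReduced norm

/-! computability of tables and tests -/
section
variable {A B : Type*} [Primcodable A] [Primcodable B]

theorem comp_tab (f t : ℕ → ℕ) (hf : Computable f) (ht : Computable t) : Computable (tab f t) := by
  have := Computable.nat_rec (f := fun n : ℕ => n) (g := fun _ => ([] : Tb))
    (h := fun _ p => p.2 ++ [(f (p.1+1), W6 (p.1+1) (t (p.1+1)))]) Computable.id (Computable.const _) ?_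
  · refine this.of_eq ?_
    intro n
    induction n with
    | zero => rfl
    | succ n ih => rw [tab, ← ih]
  · have k : Computable fun x : ℕ × (ℕ × Tb) => x.2.1 + 1 :=
      Computable.succ.comp (Computable.fst.comp Computable.snd)
    exact Computable.list_concat.comp (Computable.snd.comp Computable.snd)
      (Computable.pair (hf.comp k) (pr_W6.to_comp.comp k (ht.comp k)))

theorem cp_comp {p : B → Prop} {g : A → B} (hp : PrimrecPred p) (hg : Computable g) :
    ComputablePred fun a => p (g a) := by
  obtain ⟨_, h⟩ := hp
  exact ComputablePred.computable_iff.2 ⟨fun a => decide (p (g a)), h.to_comp.comp hg, by simp⟩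

theorem re_ex {p : A → B → Prop} (hp : ComputablePred fun x : A × B => p x.1 x.2) :
    REPred fun a => ∃ b, p a b := by
  obtain ⟨q, hq, hpq⟩ := ComputablePred.computable_iff.1 hp
  have hpq' : ∀ a b, p a b ↔ q (a, b) = true := fun a b => by
    have := congrFun hpq (a, b)
    simpa using this
  have h1 : Computable₂ fun (a : A) (n : ℕ) => (Encodable.decode (α := B) n).bind fun b =>
      if q (a, b) then some b else none := by
    refine Computable.option_bind (Computable.decode.comp Computable.snd) ?_
    have : Computable fun x : (A × ℕ) × B => q (x.1.1, x.2) :=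
      hq.comp (Computable.pair (Computable.fst.comp Computable.fst) Computable.snd)
    refine (Computable.cond this (Computable.option_some.comp Computable.snd) (Computable.const none)).of_eq ?_
    intro x
    dsimp only
    cases q (x.1.1, x.2) <;> rfl
  refine (Partrec.dom_re (Partrec.rfindOpt h1)).of_eq ?_
  intro a
  rw [Nat.rfindOpt_dom]
  constructor
  · rintro ⟨n, b, h⟩
    simp only [Option.mem_def, Option.bind_eq_some_iff] at h
    obtain ⟨c, _, h⟩ := h
    split at h
    · exact ⟨c, (hpq' _ _).2 (by assumption)⟩
    · simp at h
  · rintro ⟨b, h⟩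
    exact ⟨Encodable.encode b, b, by simp [(hpq' _ _).1 h]⟩

end

abbrev W46 := Word (Fin 46)

def relT (x : ℕ × Pw) : W46 := aWord x.1 ++ lmap embL x.2 ++ bWordRevInv x.1 ++ invRev (lmap embL x.2)

theorem relT_eq (f t : ℕ → ℕ) (i) : relT (f i, W6 i (t i)) = relatorWord f t i := by
  simp only [relT, relatorWord, conjWordInv_eq, conjWord_eq]

def cjE (T : Tb) (x : W46 × ℕ × Bool) : W46 :=
  x.1 ++ (if x.2.2 = true then ((T[x.2.1]?).map relT).getD [] else invRev (((T[x.2.1]?).map relT).getD []))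
    ++ invRev x.1

/-- witness: table size, conjugator, list of conjugated relators -/
abbrev Wit := W46 × List (W46 × ℕ × Bool)
def cjT (T : Tb) (v w : W46) (c : Wit) : Prop :=
  reduce (c.1 ++ v ++ invRev c.1 ++ invRev w) = reduce (c.2.flatMap (cjE T))

section
variable {A : Type*} [Primcodable A]

theorem pr_relT : Primrec relT := by
  have h1 : Primrec fun x : ℕ × Pw => aWord x.1 :=
    Primrec.list_flatten.comp (Primrec.list_ofFn fun k => pr_rep Primrec.fst (Primrec.const _))
  have h2 : Primrec fun x : ℕ × Pw => bWordRevInv x.1 :=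
    Primrec.list_flatten.comp (Primrec.list_ofFn fun k => pr_rep Primrec.fst (Primrec.const _))
  have h3 : Primrec fun x : ℕ × Pw => lmap embL x.2 := pr_lmap _ Primrec.snd
  exact pr_app (pr_app (pr_app h1 h3) h2) (pr_invRev h3)

theorem pr_cjT {T : A → Tb} {v w : A → W46} {c : A → Wit} (hT : Primrec T) (hv : Primrec v) (hw : Primrec w)
    (hc : Primrec c) : PrimrecPred fun a => cjT (T a) (v a) (w a) (c a) := by
  have h1 : Primrec fun a => (c a).1 := Primrec.fst.comp hc
  refine pr_eq (pr_reduce (pr_app (pr_app (pr_app h1 hv) (pr_invRev h1)) (pr_invRev hw)))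
    (pr_reduce (pr_flatMap (Primrec.snd.comp hc) ?_))
  have k : Primrec fun x : A × (W46 × ℕ × Bool) => x.2 := Primrec.snd
  have k1 := Primrec.fst.comp k
  have k2 : Primrec fun x : A × (W46 × ℕ × Bool) => (((T x.1)[x.2.2.1]?).map relT).getD [] :=
    Primrec.option_getD.comp ((Primrec.option_map₁ pr_relT).comp (Primrec.list_getElem?.comp (hT.comp Primrec.fst)
      (Primrec.fst.comp (Primrec.snd.comp k)))) (Primrec.const _)
  exact pr_app (pr_app k1 (Primrec.ite (pr_eq (Primrec.snd.comp (Primrec.snd.comp k)) (Primrec.const true))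
    k2 (pr_invRev k2))) (pr_invRev k1)
end

section
variable (f t : ℕ → ℕ)

theorem tab_getElem? (N i) : (tab f t N)[i]? = if i < N then some (f (i+1), W6 (i+1) (t (i+1))) else none := by
  induction N with
  | zero => simp [tab]
  | succ N ih =>
    have hl : ∀ N, (tab f t N).length = N := by
      intro N; induction N with
      | zero => rfl
      | succ N ih => simp [tab, ih]
    rw [tab, List.getElem?_append, hl]
    split
    · rw [ih, if_pos (by assumption), if_pos (by omega)]
    · by_cases h : i = N
      · subst h; simp
      · rw [if_neg (by omega), List.getElem?_eq_none]
        simp; omega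

theorem cjE_mem (N x) : mk (cjE (tab f t N) x) ∈ Subgroup.normalClosure (relatorSet f t) := by
  have h : mk ((((tab f t N)[x.2.1]?).map relT).getD []) ∈ Subgroup.normalClosure (relatorSet f t) := by
    rw [tab_getElem?]
    split
    · simp only [Option.map_some, Option.getD_some, relT_eq]
      exact Subgroup.subset_normalClosure ⟨_, by omega, rfl⟩
    · exact one_mem _
  rw [cjE, ← mul_mk, ← mul_mk, ← inv_mk]
  apply Subgroup.Normal.conj_mem Subgroup.normalClosure_normal
  split
  · exact h
  · rw [← inv_mk]; exact inv_mem h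

theorem mk_flatMap {X Y : Type*} (g : X → Word Y) (l : List X) : mk (l.flatMap g) = (l.map fun x => mk (g x)).prod := by
  induction l with
  | nil => rfl
  | cons a l ih => simp [← mul_mk, ih]

theorem nc_iff (x : FreeGroup (Fin 46)) : x ∈ Subgroup.normalClosure (relatorSet f t) ↔
    ∃ N l, x = mk (List.flatMap (cjE (tab f t N)) l) := by
  constructor
  · intro h
    have key : ∀ x ∈ Group.conjugatesOfSet (relatorSet f t), ∀ s : Bool,
        ∃ N, ∀ M, N ≤ M → ∃ l, (if s = true then x else x⁻¹) = mk (List.flatMap (cjE (tab f t M)) l) := by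
      intro x hx s
      obtain ⟨r, ⟨i, hi, rfl⟩, hc⟩ := Group.mem_conjugatesOfSet_iff.1 hx
      obtain ⟨c, rfl⟩ := isConj_iff.1 hc
      refine ⟨i, fun M hM => ⟨[(c.toWord, i - 1, s)], ?_⟩⟩
      have hi' : i - 1 + 1 = i := by omega
      have hlt : i - 1 < M := by omega
      rw [List.flatMap_singleton, cjE, tab_getElem?]
      simp only [if_pos hlt, hi', Option.map_some, Option.getD_some, relT_eq]
      rw [← mul_mk, ← mul_mk, ← inv_mk, mk_toWord]
      cases s
      · simp only [Bool.false_eq_true, if_false, ← inv_mk]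
        group
      · simp
    have : ∃ N, ∀ M, N ≤ M → ∃ l, x = mk (List.flatMap (cjE (tab f t M)) l) := by
      refine Subgroup.closure_induction'' (p := fun x _ => ∃ N, ∀ M, N ≤ M → ∃ l, x = mk (List.flatMap (cjE (tab f t M)) l))
        ?_ ?_ ?_ ?_ h
      · intro x hx; exact key x hx true
      · intro x hx; exact key x hx false
      · exact ⟨0, fun M _ => ⟨[], rfl⟩⟩
      · rintro x y _ _ ⟨N, hN⟩ ⟨N', hN'⟩
        refine ⟨max N N', fun M hM => ?_⟩
        obtain ⟨l, rfl⟩ := hN M (le_trans (le_max_left _ _) hM)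
        obtain ⟨l', rfl⟩ := hN' M (le_trans (le_max_right _ _) hM)
        exact ⟨l ++ l', by rw [List.flatMap_append, ← mul_mk]⟩
    obtain ⟨N, hN⟩ := this
    obtain ⟨l, hl⟩ := hN N le_rfl
    exact ⟨N, l, hl⟩
  · rintro ⟨N, l, rfl⟩
    rw [mk_flatMap]
    apply Subgroup.list_prod_mem
    intro y hy
    obtain ⟨x, _, rfl⟩ := List.mem_map.1 hy
    exact cjE_mem f t N x

theorem mkG_eq (w : W46) : mkG f t w = toG f t (mk w) := rfl

theorem conj_iff (v w : W46) : IsConj (mkG f t v) (mkG f t w) ↔ ∃ x : ℕ × Wit, cjT (tab f t x.1) v w x.2 := by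
  have e : ∀ x : ℕ × Wit, cjT (tab f t x.1) v w x.2 ↔
      mk x.2.1 * mk v * (mk x.2.1)⁻¹ * (mk w)⁻¹ = mk (List.flatMap (cjE (tab f t x.1)) x.2.2) := by
    intro x
    rw [cjT, ← toWord_mk, ← toWord_mk, toWord_inj]
    simp only [← mul_mk, ← inv_mk]
  have e2 : ∀ u : W46, (toG f t (mk u) * mkG f t v * (toG f t (mk u))⁻¹ = mkG f t w ↔
      mk u * mk v * (mk u)⁻¹ * (mk w)⁻¹ ∈ Subgroup.normalClosure (relatorSet f t)) := by
    intro u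
    rw [← QuotientGroup.eq_one_iff, ← mul_inv_eq_one]
    rfl
  rw [isConj_iff]
  constructor
  · rintro ⟨c, hc⟩
    obtain ⟨u, rfl⟩ := QuotientGroup.mk_surjective c
    have h := (e2 u.toWord).1 (by rw [mk_toWord]; exact hc)
    obtain ⟨N, l, hl⟩ := (nc_iff f t _).1 h
    exact ⟨(N, u.toWord, l), (e _).2 hl⟩
  · rintro ⟨x, hx⟩
    exact ⟨_, (e2 x.2.1).2 ((nc_iff f t _).2 ⟨_, _, (e x).1 hx⟩)⟩

/-! evaluation words -/
def wQ (D : QD) : W46 := (D.1.flatMap fun y => lmap embL y.1.2 ++ lmap embK (zw y.1.1 y.2) ++ invRev (lmap embL y.1.2)) ++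
  lmap embL D.2
def wH (l : List Item) : W46 := l.flatMap fun x => lmap embK x.1 ++ wQ x.2

theorem mkG_app (u v : W46) : mkG f t (u ++ v) = mkG f t u * mkG f t v := by
  rw [mkG_eq, ← mul_mk, map_mul]; rfl
theorem mkG_inv (u : W46) : mkG f t (invRev u) = (mkG f t u)⁻¹ := by
  rw [mkG_eq, ← inv_mk, map_inv]; rfl
theorem mkG_flatMap {X} (g : X → W46) (l : List X) : mkG f t (l.flatMap g) = (l.map fun x => mkG f t (g x)).prod := by
  induction l with
  | nil => rfl
  | cons a l ih => simp [mkG_app, ih]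

theorem mkG_K (k : Word Kl) : mkG f t (lmap embK k) = evK f t (mk k) := by
  rw [mkG_eq, mk_lmap]; rfl
theorem mkG_L (k : Pw) : mkG f t (lmap embL k) = evL f t (mk k) := by
  rw [mkG_eq, mk_lmap]; rfl

theorem mkG_Q (D : QD) : mkG f t (wQ D) = evQ f t (qv D) := by
  have h1 : evQ f t (qv D) = evN f t (mk (D.1.map gl)) * evL f t (mk D.2) := rfl
  rw [h1, wQ, mkG_app, mkG_L, mkG_flatMap]
  congr 1
  clear h1
  obtain ⟨ν, e⟩ := D
  dsimp only
  induction ν with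
  | nil => rfl
  | cons y ν ih =>
    rw [List.map_cons, List.prod_cons, List.map_cons, ← List.singleton_append, ← mul_mk, map_mul, ih]
    congr 1
    rw [mkG_app, mkG_app, mkG_inv, mkG_L, mkG_K]
    obtain ⟨⟨z, p⟩, s⟩ := y
    cases s
    · have : (mk [gl ((z, p), false)] : NQ) = (of (z, mk p))⁻¹ := rfl
      rw [this, map_inv, evN, lift_apply_of]
      have : zw z false = invRev (zw z true) := by rw [invRev_zw]; rfl
      simp only [evZ, this, ← inv_mk, map_inv]
      group
    · have : (mk [gl ((z, p), true)] : NQ) = of (z, mk p) := rfl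
      rw [this, evN, lift_apply_of]
      rfl

theorem mkG_H (l : List Item) : mkG f t (wH l) = evl f t (l.map iv) := by
  rw [wH, mkG_flatMap, evl, List.map_map]
  congr 1
  apply List.map_congr_left
  intro x _
  rw [mkG_app, mkG_K, mkG_Q]; rfl

end

section
variable {A : Type*} [Primcodable A]
theorem pr_wQ {D : A → QD} (hD : Primrec D) : Primrec fun a => wQ (D a) := by
  refine pr_app (pr_flatMap (Primrec.fst.comp hD) ?_) (pr_lmap _ (Primrec.snd.comp hD))
  have k : Primrec fun x : A × CL => x.2 := Primrec.snd
  have k1 : Primrec fun x : A × CL => lmap embL x.2.1.2 := pr_lmap _ (Primrec.snd.comp (Primrec.fst.comp k))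
  exact pr_app (pr_app k1 (pr_lmap _ (pr_zw (Primrec.fst.comp (Primrec.fst.comp k)) (Primrec.snd.comp k)))) (pr_invRev k1)

theorem pr_wH {l : A → List Item} (hl : Primrec l) : Primrec fun a => wH (l a) :=
  pr_flatMap hl (pr_app (pr_lmap _ (Primrec.fst.comp Primrec.snd)) (pr_wQ (Primrec.snd.comp Primrec.snd)))

theorem pr_nmem {S : Set A} (hS : S.Finite) : PrimrecPred fun a => a ∉ S := by
  have h := PrimrecRel.exists_mem_list (R := fun x y : A => x = y) Primrec.eq
  have h2 : PrimrecPred fun a : A => ∃ x ∈ hS.toFinset.toList, x = a :=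
    h.comp (Primrec.const _) Primrec.id
  refine h2.not.of_eq ?_
  intro a
  simp
end

/-- certificates -/
abbrev Cert := Word Kl × QD × List Item × ℕ × Wit

def NT (w1 : Set (Word Kl)) (w2 : Set QD) (w3 : Set (List Item)) (T : Tb) (T' : Tb) (v : W46) (c : Cert) : Prop :=
  (reduce (c.1 ++ c.1) = c.1 ++ c.1 ∧ c.1 ∉ w1 ∧ cjT T' v (lmap embK c.1) c.2.2.2.2) ∨
  (tCQ T c.2.1 ∧ c.2.1 ∉ w2 ∧ cjT T' v (wQ c.2.1) c.2.2.2.2) ∨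
  ((c.2.2.1 ≠ [] ∧ ∀ x ∈ c.2.2.1, tCI T x) ∧ c.2.2.1 ∉ w3 ∧ cjT T' v (wH c.2.2.1) c.2.2.2.2)

def bnd (c : Cert) : ℕ := 2 * msz (dbl c.2.1) + (c.2.2.1.map fun x => 2 * msz x.2.1).sum

theorem pr_NT {w1 w2 w3} (h1 : Set.Finite w1) (h2 : Set.Finite w2) (h3 : Set.Finite w3) :
    PrimrecPred fun x : (Tb × Tb) × W46 × Cert => NT w1 w2 w3 x.1.1 x.1.2 x.2.1 x.2.2 := by
  have hT : Primrec fun x : (Tb × Tb) × W46 × Cert => x.1.1 := Primrec.fst.comp Primrec.fst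
  have hT' : Primrec fun x : (Tb × Tb) × W46 × Cert => x.1.2 := Primrec.snd.comp Primrec.fst
  have hv : Primrec fun x : (Tb × Tb) × W46 × Cert => x.2.1 := Primrec.fst.comp Primrec.snd
  have hc : Primrec fun x : (Tb × Tb) × W46 × Cert => x.2.2 := Primrec.snd.comp Primrec.snd
  have c1 : Primrec fun x : (Tb × Tb) × W46 × Cert => x.2.2.1 := Primrec.fst.comp hc
  have c' : Primrec fun x : (Tb × Tb) × W46 × Cert => x.2.2.2 := Primrec.snd.comp hc
  have c2 : Primrec fun x : (Tb × Tb) × W46 × Cert => x.2.2.2.1 := Primrec.fst.comp c'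
  have c'' : Primrec fun x : (Tb × Tb) × W46 × Cert => x.2.2.2.2 := Primrec.snd.comp c'
  have c3 : Primrec fun x : (Tb × Tb) × W46 × Cert => x.2.2.2.2.1 := Primrec.fst.comp c''
  have c4 : Primrec fun x : (Tb × Tb) × W46 × Cert => x.2.2.2.2.2.2 := Primrec.snd.comp (Primrec.snd.comp c'')
  refine PrimrecPred.or (PrimrecPred.and (pr_red (pr_app c1 c1)) (PrimrecPred.and ((pr_nmem h1).comp c1)
    (pr_cjT hT' hv (pr_lmap _ c1) c4))) (PrimrecPred.or (PrimrecPred.and (pr_tCQ hT c2)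
    (PrimrecPred.and ((pr_nmem h2).comp c2) (pr_cjT hT' hv (pr_wQ c2) c4)))
    (PrimrecPred.and (PrimrecPred.and (PrimrecPred.not (pr_eq c3 (Primrec.const _))) ?_)
    (PrimrecPred.and ((pr_nmem h3).comp c3) (pr_cjT hT' hv (pr_wH c3) c4))))
  exact pr_all (p := fun (x : (Tb × Tb) × W46 × Cert) y => tCI x.1.1 y) c3 (pr_tCI (hT.comp Primrec.fst) Primrec.snd)

theorem pr_bnd : Primrec bnd := by
  have c2 : Primrec fun c : Cert => c.2.1 := Primrec.fst.comp Primrec.snd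
  have c3 : Primrec fun c : Cert => c.2.2.1 := Primrec.fst.comp (Primrec.snd.comp Primrec.snd)
  refine Primrec.nat_add.comp (Primrec.nat_mul.comp (Primrec.const 2) (pr_msz (pr_dbl c2))) (pr_sum (pr_map c3 ?_))
  exact Primrec.nat_mul.comp (Primrec.const 2) (pr_msz (Primrec.fst.comp (Primrec.snd.comp Primrec.snd)))

theorem main (f t : ℕ → ℕ) (hf : Function.Injective f)
    (hf1 : ∀ i : ℕ, 1 ≤ i → 1 ≤ f i) (hfc : Computable f) (htc : Computable t) (w₀ : W46) :
    ComputablePred fun v : W46 => IsConj (mkG f t v) (mkG f t w₀) := by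
  have hT := comp_tab f t hfc htc
  rw [ComputablePred.computable_iff_re_compl_re']
  constructor
  · refine REPred.of_eq (re_ex (B := ℕ × Wit) (p := fun v x => cjT (tab f t x.1) v w₀ x.2) ?_)
      fun v => (conj_iff f t v w₀).symm
    have h : PrimrecPred fun x : Tb × W46 × Wit => cjT x.1 x.2.1 w₀ x.2.2 :=
      pr_cjT Primrec.fst (Primrec.fst.comp Primrec.snd) (Primrec.const _) (Primrec.snd.comp Primrec.snd)
    exact cp_comp (A := W46 × (ℕ × Wit)) (g := fun x => (tab f t x.2.1, x.1, x.2.2)) h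
      (Computable.pair (hT.comp (Computable.fst.comp Computable.snd))
        (Computable.pair Computable.fst (Computable.snd.comp Computable.snd)))
  · have f1 := finK f t (mkG f t w₀) hf hf1
    have f2 := finQ f t (mkG f t w₀) hf hf1
    have f3 := finH f t (mkG f t w₀) hf hf1
    refine REPred.of_eq (re_ex (B := Cert) (p := fun v c => NT _ _ _ (tab f t (bnd c)) (tab f t c.2.2.2.1) v c)
      (cp_comp (A := W46 × Cert) (g := fun x => ((tab f t (bnd x.2), tab f t x.2.2.2.2.1), x.1, x.2))
      (pr_NT f1 f2 f3)
      (Computable.pair (Computable.pair (hT.comp (pr_bnd.to_comp.comp Computable.snd))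
        (hT.comp (Computable.fst.comp (Computable.snd.comp (Computable.snd.comp (Computable.snd.comp Computable.snd))))))
        (Computable.pair Computable.fst Computable.snd)))) ?_
    intro v
    have hI : ∀ c : Cert, (∀ x ∈ c.2.2.1, tCI (tab f t (bnd c)) x) ↔ ∀ x ∈ c.2.2.1, CI (wfOf f t) x := by
      intro c
      refine forall_congr' fun x => forall_congr' fun hx => tCI_iff f t hf x ?_
      have : 2 * msz x.2.1 ≤ (c.2.2.1.map fun x => 2 * msz x.2.1).sum :=
        List.single_le_sum (by simp) _ (List.mem_map.2 ⟨x, hx, rfl⟩)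
      unfold bnd; omega
    have hQ : ∀ c : Cert, tCQ (tab f t (bnd c)) c.2.1 ↔ CQ (wfOf f t) c.2.1 := fun c =>
      tCQ_iff f t hf _ (by unfold bnd; omega)
    constructor
    · rintro ⟨c, ⟨h1, h2, h3⟩ | ⟨h1, h2, h3⟩ | ⟨h1, h2, h3⟩⟩ hv
      · have h4 := (conj_iff f t _ _).2 ⟨c.2.2.2, h3⟩
        rw [mkG_K] at h4
        exact h2 ⟨isReduced_iff_reduce_eq.2 h1, h4.symm.trans hv⟩
      · have h4 := (conj_iff f t _ _).2 ⟨c.2.2.2, h3⟩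
        rw [mkG_Q] at h4
        exact h2 ⟨(hQ c).1 h1, h4.symm.trans hv⟩
      · have h4 := (conj_iff f t _ _).2 ⟨c.2.2.2, h3⟩
        rw [mkG_H] at h4
        exact h2 ⟨h1.1, (hI c).1 h1.2, h4.symm.trans hv⟩
    · intro hv
      rcases cover' f t (mkG f t v) with ⟨k, h1, h2⟩ | ⟨D, h1, h2⟩ | ⟨l, h0, h1, h2⟩
      · have h3 := h2
        rw [← mkG_K, conj_iff] at h3
        obtain ⟨x, hx⟩ := h3
        exact ⟨(k, ([], []), [], x), .inl ⟨isReduced_iff_reduce_eq.1 h1, fun hm => hv (h2.trans hm.2), hx⟩⟩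
      · have h3 := h2
        rw [← mkG_Q, conj_iff] at h3
        obtain ⟨x, hx⟩ := h3
        exact ⟨([], D, [], x), .inr (.inl ⟨(hQ ([], D, [], x)).2 h1, fun hm => hv (h2.trans hm.2), hx⟩)⟩
      · have h3 := h2
        rw [← mkG_H, conj_iff] at h3
        obtain ⟨x, hx⟩ := h3
        exact ⟨([], ([], []), l, x), .inr (.inr ⟨⟨h0, (hI ([], ([], []), l, x)).2 h1⟩,
          fun hm => hv (h2.trans hm.2.2), hx⟩)⟩

end ICP

/-- If `f` and `t` are computable, every individual conjugacy problem in `G` is decidable: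
for every fixed word `w₀`, the set of words whose image in `G` is conjugate to the image
of `w₀` is computable. -/
theorem individual_conjugacy_decidable (f t : ℕ → ℕ) (hf : Function.Injective f)
    (hf1 : ∀ i : ℕ, 1 ≤ i → 1 ≤ f i) (ht1 : ∀ i : ℕ, 1 ≤ i → 1 ≤ t i)
    (hfc : Computable f) (htc : Computable t) :
    ∀ w₀ : Word (Fin 46),
      ComputablePred fun v : Word (Fin 46) => IsConj (mkG f t v) (mkG f t w₀) := by
  exact fun w₀ => ICP.main f t hf hf1 hfc htc w₀
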